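/- Let n ≥ 2 be an integer and p > 0 real. Every proper holomorphic self-mapping f : 𝔼_{p,n} → 𝔼_{p,n} is an automorphism of 𝔼_{p,n}. -/

import Mathlib

open Finset

/-- The symmetrization map `π_n : ℂⁿ → ℂⁿ`, whose `k`-th component is the
`(k+1)`-st elementary symmetric polynomial of the coordinates. -/
noncomputable def piMap (n : ℕ) (z : Fin n → ℂ) : Fin n → ℂ :=
  fun k => ∑ s ∈ Finset.powersetCard (k.1 + 1) Finset.univ, ∏ j ∈ s, z j

/-- The generalized complex ellipsoid `𝔹_{p,n} = {z : ∑ |z_j|^(2p) < 1}`. -/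
noncomputable def ellipsoid (p : ℝ) (n : ℕ) : Set (Fin n → ℂ) :=
  {z | ∑ j, ‖z j‖ ^ (2 * p) < 1}

/-- The symmetrized `(p,n)`-ellipsoid `𝔼_{p,n} = π_n(𝔹_{p,n})`. -/
noncomputable def symEllipsoid (p : ℝ) (n : ℕ) : Set (Fin n → ℂ) :=
  piMap n '' ellipsoid p n

/-- The Euclidean unit ball in `ℂⁿ`. -/
def unitBall (n : ℕ) : Set (Fin n → ℂ) :=
  {z | ∑ j, ‖z j‖ ^ 2 < 1}

/-- `f` is a proper holomorphic map from the domain `D` onto (into) the domain `G`: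
it is holomorphic on `D`, maps `D` into `G`, and preimages of compact subsets of `G`
are compact. -/
def IsProperHolomorphic {n : ℕ} (f : (Fin n → ℂ) → (Fin n → ℂ))
    (D G : Set (Fin n → ℂ)) : Prop :=
  DifferentiableOn ℂ f D ∧ Set.MapsTo f D G ∧
    ∀ K : Set (Fin n → ℂ), K ⊆ G → IsCompact K → IsCompact (D ∩ f ⁻¹' K)

/-- `φ` is an automorphism of the domain `D`: a holomorphic bijection of `D` onto
itself with holomorphic inverse. -/
def IsAutomorphismOf {n : ℕ} (φ : (Fin n → ℂ) → (Fin n → ℂ))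
    (D : Set (Fin n → ℂ)) : Prop :=
  DifferentiableOn ℂ φ D ∧ Set.BijOn φ D D ∧
    ∃ ψ : (Fin n → ℂ) → (Fin n → ℂ), DifferentiableOn ℂ ψ D ∧ Set.InvOn ψ φ D D

/-- `f : ℂⁿ → ℂⁿ` is a polynomial mapping. -/
def IsPolynomialMap {n : ℕ} (f : (Fin n → ℂ) → (Fin n → ℂ)) : Prop :=
  ∃ P : Fin n → MvPolynomial (Fin n) ℂ, ∀ z k, f z k = MvPolynomial.eval z (P k)

section
open MeasureTheory Metric Filter Topology

/-- Cauchy estimate for directional derivatives. -/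
lemma holo_cauchy {E : Type*} [NormedAddCommGroup E] [NormedSpace ℂ E] {f : E → ℂ} {z : E} {r M : ℝ} (hr : 0 < r)
    (hf : DifferentiableOn ℂ f (ball z r)) (hM : ∀ w ∈ ball z r, ‖f w‖ ≤ M) :
    ‖fderiv ℂ f z‖ ≤ M / r := by
  have hM0 : 0 ≤ M := (norm_nonneg _).trans (hM z (mem_ball_self hr))
  refine ContinuousLinearMap.opNorm_le_bound _ (by positivity) fun v => ?_
  by_cases hv : v = 0
  · simp [hv]
  have hv' : 0 < ‖v‖ := norm_pos_iff.2 hv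
  -- for every ρ < r
  have key : ∀ ρ, 0 < ρ → ρ < r → ‖fderiv ℂ f z v‖ ≤ M / ρ * ‖v‖ := by
    intro ρ h0 h1
    set g : ℂ → ℂ := fun l => f (z + l • v) with hg
    have hmem : ∀ l ∈ closedBall (0:ℂ) (ρ / ‖v‖), z + l • v ∈ ball z r := by
      intro l hl
      rw [mem_closedBall_zero_iff] at hl
      rw [mem_ball, dist_eq_norm, add_sub_cancel_left, norm_smul]
      calc ‖l‖ * ‖v‖ ≤ ρ / ‖v‖ * ‖v‖ := by gcongr
        _ = ρ := by field_simp
        _ < r := h1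
    have hline : ∀ l : ℂ, HasDerivAt (fun l : ℂ => z + l • v) v l := by
      intro l
      simpa using ((hasDerivAt_id l).smul_const v).const_add z
    have hdiff : DifferentiableOn ℂ g (closedBall (0:ℂ) (ρ / ‖v‖)) := by
      intro l hl
      have := (hf _ (hmem l hl)).differentiableAt (isOpen_ball.mem_nhds (hmem l hl))
      exact (this.comp l (hline l).differentiableAt).differentiableWithinAt
    have hder : HasDerivAt g (fderiv ℂ f z v) 0 := by
      have h2 := (hf z (mem_ball_self hr)).differentiableAt (isOpen_ball.mem_nhds (mem_ball_self hr))
      have h3 : HasFDerivAt f (fderiv ℂ f z) (z + (0:ℂ) • v) := by simpa using h2.hasFDerivAt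
      exact h3.comp_hasDerivAt 0 (hline 0)
    have := Complex.norm_deriv_le_of_forall_mem_sphere_norm_le (f := g) (c := 0) (R := ρ / ‖v‖) (C := M)
      (by positivity) (hdiff.diffContOnCl_ball (subset_refl _))
      (fun l hl => hM _ (hmem l (sphere_subset_closedBall hl)))
    rw [hder.deriv] at this
    calc _ ≤ _ := this
      _ = _ := by field_simp
  have hlim : Tendsto (fun ρ : ℝ => M / ρ * ‖v‖) (𝓝[<] r) (𝓝 (M / r * ‖v‖)) := by
    apply Tendsto.mono_left _ nhdsWithin_le_nhds
    exact (tendsto_const_nhds.div tendsto_id hr.ne').mul_const _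
  refine ge_of_tendsto hlim ?_
  filter_upwards [Ioo_mem_nhdsLT hr] with ρ hρ using key ρ hρ.1 hρ.2

lemma clm_pi_eq {n : ℕ} (L : (Fin n → ℂ) →L[ℂ] ℂ) :
    L = ∑ k, L (Pi.single k 1) • (ContinuousLinearMap.proj k : (Fin n → ℂ) →L[ℂ] ℂ) := by
  ext v
  conv_lhs => rw [← Finset.univ_sum_single v]
  simp only [map_sum, FunLike.coe_sum, Finset.sum_apply, smul_apply, ContinuousLinearMap.proj_apply,
    smul_eq_mul]
  refine Finset.sum_congr rfl fun k _ => ?_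
  have : (Pi.single k (v k) : Fin n → ℂ) = v k • Pi.single k 1 := by
    rw [← Pi.single_smul]; simp
  rw [this, map_smul, smul_eq_mul, mul_comm]

/-- Integrals of holomorphic functions depending continuously on a parameter. -/
lemma holo_param {n : ℕ} {W : Set (Fin n → ℂ)} (hW : IsOpen W) {a b : ℝ} (hab : a ≤ b)
    {G : (Fin n → ℂ) → ℝ → ℂ}
    (hc : ContinuousOn (fun q : (Fin n → ℂ) × ℝ => G q.1 q.2) (W ×ˢ Set.univ))
    (hd : ∀ t, DifferentiableOn ℂ (fun z => G z t) W) :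
    DifferentiableOn ℂ (fun z => ∫ t in a..b, G z t) W := by
  intro z hz
  obtain ⟨r, hr, hrW⟩ := Metric.nhds_basis_closedBall.mem_iff.1 (hW.mem_nhds hz)
  have hcomp : IsCompact (closedBall z r ×ˢ Set.Icc a b) := (isCompact_closedBall z r).prod isCompact_Icc
  obtain ⟨M, hM⟩ := hcomp.exists_bound_of_continuousOn
    (hc.mono (Set.prod_mono hrW (Set.subset_univ _)))
  have hcz : ∀ w ∈ W, Continuous (G w) := by
    intro w hw
    have : ContinuousOn ((fun q : (Fin n → ℂ) × ℝ => G q.1 q.2) ∘ fun t => (w, t)) Set.univ :=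
      hc.comp (by fun_prop) (fun t _ => ⟨hw, trivial⟩)
    rw [← continuousOn_univ]; exact this
  have hmeas : ∀ v : Fin n → ℂ, Measurable fun t => fderiv ℂ (fun z => G z t) z v := by
    intro v
    obtain ⟨K, hK⟩ := exists_nat_gt (‖v‖ / r)
    have hK0 : (0:ℝ) < K := lt_of_le_of_lt (by positivity) hK
    have hmemK : ∀ m : ℕ, z + (((m + K : ℕ) : ℂ))⁻¹ • v ∈ W := by
      intro m
      apply hrW
      rw [mem_closedBall, dist_eq_norm, add_sub_cancel_left, norm_smul, norm_inv, Complex.norm_natCast]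
      have h1 : (K:ℝ) ≤ ((m + K : ℕ) : ℝ) := by push_cast; linarith [(Nat.cast_nonneg m : (0:ℝ) ≤ m)]
      rw [inv_mul_le_iff₀ (by linarith)]
      rw [div_lt_iff₀ hr] at hK
      nlinarith
    have hlim : ∀ t, Tendsto (fun m : ℕ => (((m + K : ℕ) : ℂ)) • (G (z + (((m + K : ℕ) : ℂ))⁻¹ • v) t - G z t)) atTop
        (𝓝 (fderiv ℂ (fun z => G z t) z v)) := by
      intro t
      have h1 := ((hd t z hz).differentiableAt (hW.mem_nhds hz)).hasFDerivAt
      refine HasFDerivAt.lim (f := fun z => G z t) h1 v ?_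
      simp only [Complex.norm_natCast]
      exact tendsto_natCast_atTop_atTop.comp (tendsto_add_atTop_nat K)
    refine measurable_of_tendsto_metrizable (f := fun (m : ℕ) t => (((m + K : ℕ) : ℂ)) • (G (z + (((m + K : ℕ) : ℂ))⁻¹ • v) t - G z t)) (fun m => ?_) (tendsto_pi_nhds.2 hlim)
    exact (((hcz _ (hmemK m)).sub (hcz z hz)).const_smul (((m + K : ℕ) : ℂ))).measurable
  have hball : ∀ w ∈ ball z (r/2), ball w (r/2) ⊆ closedBall z r := by
    intro w hw
    refine (ball_subset_ball' ?_).trans ball_subset_closedBall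
    rw [mem_ball] at hw; linarith
  have hder := intervalIntegral.hasFDerivAt_integral_of_dominated_of_fderiv_le (𝕜 := ℂ) (μ := volume)
    (F := G) (F' := fun w t => fderiv ℂ (fun z => G z t) w) (x₀ := z) (s := ball z (r/2)) (a := a) (b := b)
    (bound := fun _ => M / (r/2)) (ball_mem_nhds z (half_pos hr)) ?_ ?_ ?_ ?_ ?_ ?_
  · exact hder.differentiableAt.differentiableWithinAt
  · filter_upwards [hW.mem_nhds hz] with w hw
    exact (hcz w hw).aestronglyMeasurable
  · exact (hcz z hz).intervalIntegrable _ _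
  · apply Measurable.aestronglyMeasurable
    have : (fun t => fderiv ℂ (fun z => G z t) z) = fun t => ∑ k, (fderiv ℂ (fun z => G z t) z) (Pi.single k 1) •
        (ContinuousLinearMap.proj k : (Fin n → ℂ) →L[ℂ] ℂ) := by
      funext t; exact clm_pi_eq _
    rw [this]
    refine Finset.measurable_sum _ fun k _ => ?_
    exact (hmeas _).smul_const _
  · refine Eventually.of_forall fun t ht w hw => ?_
    rw [Set.uIoc_of_le hab] at ht
    refine holo_cauchy (half_pos hr) ((hd t).mono ((hball w hw).trans hrW)) fun x hx => ?_
    exact hM (x, t) ⟨hball w hw hx, Set.Ioc_subset_Icc_self ht⟩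
  · exact intervalIntegrable_const
  · refine Eventually.of_forall fun t ht w hw => ?_
    have hw' : w ∈ W := hrW (ball_subset_closedBall (ball_subset_ball (by linarith) hw))
    exact ((hd t w hw').differentiableAt (hW.mem_nhds hw')).hasFDerivAt

/-- Cauchy formula for the directional derivative and holomorphy of derivatives. -/
lemma holo_fderiv {n : ℕ} {U : Set (Fin n → ℂ)} (hU : IsOpen U) {f : (Fin n → ℂ) → ℂ}
    (hf : DifferentiableOn ℂ f U) (v : Fin n → ℂ) :
    DifferentiableOn ℂ (fun z => fderiv ℂ f z v) U := by
  intro z hz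
  obtain ⟨r, hr, hrU⟩ := Metric.nhds_basis_ball.mem_iff.1 (hU.mem_nhds hz)
  set ρ : ℝ := r / 2 / (‖v‖ + 1) with hρ
  have hρ0 : 0 < ρ := by positivity
  have hρv : ρ * ‖v‖ < r / 2 := by
    rw [hρ, div_mul_eq_mul_div, div_lt_iff₀ (by positivity)]
    nlinarith [norm_nonneg v]
  set W := ball z (r/2)
  have hmem : ∀ w ∈ W, ∀ l ∈ closedBall (0:ℂ) ρ, w + l • v ∈ U := by
    intro w hw l hl
    apply hrU
    rw [mem_closedBall_zero_iff] at hl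
    have h1 : dist (w + l • v) w < r / 2 := by
      rw [dist_eq_norm, add_sub_cancel_left, norm_smul]
      exact lt_of_le_of_lt (by gcongr) hρv
    have := dist_triangle (w + l • v) w z
    rw [mem_ball] at hw ⊢
    linarith
  have hcm : ∀ t : ℝ, circleMap 0 ρ t ∈ closedBall (0:ℂ) ρ := fun t => circleMap_mem_closedBall 0 hρ0.le t
  have hform : ∀ w ∈ W, fderiv ℂ f w v = (2 * Real.pi * Complex.I : ℂ)⁻¹ * ∫ t in (0:ℝ)..2 * Real.pi,
      deriv (circleMap 0 ρ) t • ((1 / (circleMap 0 ρ t - 0) ^ 2) • f (w + circleMap 0 ρ t • v)) := by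
    intro w hw
    have hline : ∀ l : ℂ, HasDerivAt (fun l : ℂ => w + l • v) v l := by
      intro l
      simpa using ((hasDerivAt_id l).smul_const v).const_add w
    have hd : DifferentiableOn ℂ (fun l : ℂ => f (w + l • v)) (closedBall 0 ρ) := by
      intro l hl
      have := (hf _ (hmem w hw l hl)).differentiableAt (hU.mem_nhds (hmem w hw l hl))
      exact (this.comp l (hline l).differentiableAt).differentiableWithinAt
    have hder : HasDerivAt (fun l : ℂ => f (w + l • v)) (fderiv ℂ f w v) 0 := by
      have hwU : w ∈ U := by simpa using hmem w hw 0 (mem_closedBall_self hρ0.le)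
      have h2 := (hf w hwU).differentiableAt (hU.mem_nhds hwU)
      have h3 : HasFDerivAt f (fderiv ℂ f w) (w + (0:ℂ) • v) := by simpa using h2.hasFDerivAt
      exact h3.comp_hasDerivAt 0 (hline 0)
    have h4 := hd.deriv_eq_smul_circleIntegral hρ0
    rw [hder.deriv] at h4
    have h5 : (2 * Real.pi * Complex.I : ℂ) ≠ 0 := by simp [Real.pi_ne_zero]
    rw [eq_inv_mul_iff_mul_eq₀ h5]
    rw [smul_eq_mul] at h4
    exact h4.symm
  have hzW : z ∈ W := mem_ball_self (half_pos hr)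
  have hWo : IsOpen W := isOpen_ball
  have hmain : DifferentiableOn ℂ (fun w => ∫ t in (0:ℝ)..2 * Real.pi,
      deriv (circleMap 0 ρ) t • ((1 / (circleMap 0 ρ t - 0) ^ 2) • f (w + circleMap 0 ρ t • v))) W := by
    refine holo_param hWo (by positivity) (G := fun w t => deriv (circleMap 0 ρ) t • ((1 / (circleMap 0 ρ t - 0) ^ 2) • f (w + circleMap 0 ρ t • v))) ?_ ?_
    · have hne : ∀ t : ℝ, circleMap 0 ρ t - 0 ≠ 0 := by
        intro t; rw [sub_zero]; exact circleMap_ne_center hρ0.ne'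
      have hcc : Continuous (circleMap (0:ℂ) ρ) := continuous_circleMap 0 ρ
      simp only [deriv_circleMap]
      refine ContinuousOn.smul (f := fun q : (Fin n → ℂ) × ℝ => circleMap 0 ρ q.2 * Complex.I) (by fun_prop)
        (ContinuousOn.smul (f := fun q : (Fin n → ℂ) × ℝ => 1 / (circleMap 0 ρ q.2 - 0) ^ 2) ?_ ?_)
      · refine ContinuousOn.div (by fun_prop) (by fun_prop) fun q _ => pow_ne_zero _ (hne q.2)
      · refine hf.continuousOn.comp (by fun_prop) fun q hq => hmem _ hq.1 _ (hcm q.2)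
    · intro t
      have h7 : DifferentiableOn ℂ (fun z => f (z + circleMap 0 ρ t • v)) W :=
        hf.comp (by fun_prop) fun w hw => hmem w hw _ (hcm t)
      simp only [smul_eq_mul]
      exact (h7.const_mul _).const_mul _
  have h6 := (hmain.const_mul ((2 * Real.pi * Complex.I : ℂ)⁻¹)).congr hform
  exact ((h6 z hzW).differentiableAt (hWo.mem_nhds hzW)).differentiableWithinAt

lemma holo_contDiffOn {n : ℕ} {U : Set (Fin n → ℂ)} (hU : IsOpen U) (m : ℕ) :
    ∀ {f : (Fin n → ℂ) → ℂ}, DifferentiableOn ℂ f U → ContDiffOn ℂ m f U := by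
  induction m with
  | zero => intro f hf; exact contDiffOn_zero.2 hf.continuousOn
  | succ m ih =>
    intro f hf
    have := (contDiffOn_succ_iff_fderiv_of_isOpen (𝕜 := ℂ) (n := (m : WithTop ℕ∞)) (f := f) hU).2
    push_cast
    refine this ⟨hf, by simp, ?_⟩
    rw [contDiffOn_clm_apply]
    intro v
    exact ih (holo_fderiv hU hf v)

lemma holo_contDiffOn_top {n : ℕ} {U : Set (Fin n → ℂ)} (hU : IsOpen U) 
    {f : (Fin n → ℂ) → ℂ} (hf : DifferentiableOn ℂ f U) : ContDiffOn ℂ (⊤ : ℕ∞) f U :=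
  contDiffOn_infty.2 fun m => holo_contDiffOn hU m hf

lemma holo_contDiffAt {n m : ℕ} {U : Set (Fin n → ℂ)} (hU : IsOpen U) 
    {f : (Fin n → ℂ) → (Fin m → ℂ)} (hf : DifferentiableOn ℂ f U) {z} (hz : z ∈ U) (k : ℕ) : ContDiffAt ℂ k f z := by
  rw [contDiffAt_pi]
  intro i
  exact (holo_contDiffOn hU k ((differentiableOn_pi.1 hf) i)).contDiffAt (hU.mem_nhds hz)

lemma holo_cont_fderiv {n : ℕ} {U : Set (Fin n → ℂ)} (hU : IsOpen U) {f : (Fin n → ℂ) → ℂ}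
    (hf : DifferentiableOn ℂ f U) : ContinuousOn (fderiv ℂ f) U :=
  (holo_contDiffOn hU 1 hf).continuousOn_fderiv_of_isOpen hU (by simp)

/-- Local identity principle on balls. -/
lemma holo_zero_ball {E : Type*} [NormedAddCommGroup E] [NormedSpace ℂ E] {f : E → ℂ} {z : E} {r : ℝ}
    (hf : DifferentiableOn ℂ f (ball z r)) {w : E} (hw : w ∈ ball z r) (h0 : f =ᶠ[𝓝 w] 0) :
    ∀ x ∈ ball z r, f x = 0 := by
  intro x hx
  set g : ℂ → ℂ := fun l => f (w + l • (x - w)) with hg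
  set V : Set ℂ := (fun l : ℂ => w + l • (x - w)) ⁻¹' ball z r with hV
  have hcont : Continuous (fun l : ℂ => w + l • (x - w)) := by fun_prop
  have hVo : IsOpen V := isOpen_ball.preimage hcont
  have hVc : Convex ℝ V := by
    let _ : NormedSpace ℝ E := NormedSpace.restrictScalars ℝ ℂ E
    intro l hl m hm a b ha hb hab
    have h1 := convex_ball z r hl hm ha hb hab
    have h2 : w + (a • l + b • m) • (x - w) = a • (w + l • (x - w)) + b • (w + m • (x - w)) := by
      have e1 : ∀ (c : ℝ) (y : E), c • y = (c : ℂ) • y := fun c y => rfl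
      have e2 : (b : ℂ) = 1 - a := by rw [show b = 1 - a by linarith]; push_cast; ring
      rw [e1, e1, Complex.real_smul, Complex.real_smul, e2]
      module
    change w + (a • l + b • m) • (x - w) ∈ ball z r
    rw [h2]; exact h1
  have hgd : DifferentiableOn ℂ g V := by
    refine hf.comp (by fun_prop) fun l hl => hl
  have hga : AnalyticOnNhd ℂ g V := hgd.analyticOnNhd hVo
  have h0V : (0:ℂ) ∈ V := by simpa [hV] using hw
  have h1V : (1:ℂ) ∈ V := by simpa [hV] using hx
  have hev : g =ᶠ[𝓝 0] 0 := by
    have : Tendsto (fun l : ℂ => w + l • (x - w)) (𝓝 0) (𝓝 w) := by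
      have := hcont.tendsto 0; simpa using this
    exact this.eventually h0
  have := hga.eqOn_of_preconnected_of_eventuallyEq (analyticOnNhd_const (v := (0:ℂ))) hVc.isPreconnected h0V hev h1V
  simpa [hg] using this

/-- Identity principle. -/
lemma holo_identity {E : Type*} [NormedAddCommGroup E] [NormedSpace ℂ E] {f : E → ℂ} {U : Set E} (hU : IsOpen U)
    (hc : IsPreconnected U) (hf : DifferentiableOn ℂ f U) {w : E} (hw : w ∈ U) (h0 : f =ᶠ[𝓝 w] 0) :
    ∀ x ∈ U, f x = 0 := by
  set A := {x | f =ᶠ[𝓝 x] 0} with hA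
  have hAo : IsOpen A := by
    rw [isOpen_iff_eventually]
    intro x hx
    exact eventually_eventually_nhds.2 hx
  have hsub : U ⊆ A := by
    refine hc.subset_of_closure_inter_subset hAo ⟨w, hw, h0⟩ ?_
    rintro x ⟨hx, hxU⟩
    obtain ⟨r, hr, hrU⟩ := Metric.nhds_basis_ball.mem_iff.1 (hU.mem_nhds hxU)
    obtain ⟨y, hy, hyA⟩ := mem_closure_iff_nhds.1 hx _ (ball_mem_nhds x hr)
    have := holo_zero_ball (hf.mono hrU) hy hyA
    filter_upwards [ball_mem_nhds x hr] with t ht using this t ht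
  intro x hx
  exact (hsub hx).eq_of_nhds

lemma volume_rot {n : ℕ} (c : Fin n → ℂ) (hc : ∀ k, ‖c k‖ = 1) :
    MeasurePreserving (fun w : Fin n → ℂ => fun k => c k * w k) volume volume := by
  refine volume_preserving_pi (f := fun k (x : ℂ) => c k * x) fun k => ?_
  have : c k ∈ Submonoid.unitSphere ℂ := by simp [Submonoid.unitSphere, hc k]
  let u : Circle := ⟨c k, this⟩
  exact (rotation u).measurePreserving

lemma rot_embedding {n : ℕ} (c : Fin n → ℂ) (hc : ∀ k, ‖c k‖ = 1) :
    MeasurableEmbedding (fun w : Fin n → ℂ => fun k => c k * w k) := by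
  apply Continuous.measurableEmbedding (by fun_prop)
  intro w w' h
  funext k
  have hk : c k ≠ 0 := by intro h0; have := hc k; simp [h0] at this
  exact mul_left_cancel₀ hk (congrFun h k)

lemma rot_setIntegral {n : ℕ} {F : Type*} [NormedAddCommGroup F] [NormedSpace ℝ F] (c : Fin n → ℂ) (hc : ∀ k, ‖c k‖ = 1)
    {S : Set (Fin n → ℂ)} (hS : (fun w : Fin n → ℂ => fun k => c k * w k) ⁻¹' S = S) (g : (Fin n → ℂ) → F) :
    ∫ w in S, g (fun k => c k * w k) = ∫ w in S, g w := by
  have := (volume_rot c hc).setIntegral_preimage_emb (rot_embedding c hc) g S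
  rwa [hS] at this

/-- Mean value inequality over balls. -/
lemma holo_mean {n : ℕ} {f : (Fin n → ℂ) → ℂ} {z : Fin n → ℂ} {r : ℝ} (hr : 0 < r)
    {U : Set (Fin n → ℂ)} (hU : IsOpen U) (hrU : closedBall z r ⊆ U) 
    (hf : DifferentiableOn ℂ f U) :
    (volume (ball z r)).toReal * ‖f z‖ ≤ ∫ w in ball z r, ‖f w‖ := by
  set g : (Fin n → ℂ) → ℂ := fun v => f (z + v) with hg
  have hmaps : Set.MapsTo (fun v => z + v) (closedBall 0 r) U := by
    intro v hv; apply hrU; simpa using hv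
  have hgc : ContinuousOn g (closedBall 0 r) := hf.continuousOn.comp (by fun_prop) hmaps
  have hshift : ∫ w in ball z r, ‖f w‖ = ∫ v in ball 0 r, ‖g v‖ := by
    have h1 := (measurePreserving_add_left (volume : Measure (Fin n → ℂ)) z).setIntegral_preimage_emb
      (measurableEmbedding_addLeft z) (fun w => ‖f w‖) (ball z r)
    rw [← h1]
    congr 2
    ext v; simp
  have hvol : volume (ball z r) = volume (ball (0 : Fin n → ℂ) r) := Measure.addHaar_ball_center _ _ _
  have hrotc : ∀ t : ℝ, ∀ k : Fin n, ‖(fun _ => Complex.exp (t * Complex.I) : Fin n → ℂ) k‖ = 1 := fun t k => by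
    simp [Complex.norm_exp_ofReal_mul_I]
  have hnorm : ∀ (t : ℝ) (v : Fin n → ℂ), ‖Complex.exp (t * Complex.I) • v‖ = ‖v‖ := fun t v => by
    rw [norm_smul, Complex.norm_exp_ofReal_mul_I, one_mul]
  have hrot : ∀ t : ℝ, ∫ v in ball 0 r, ‖g (Complex.exp (t * Complex.I) • v)‖ = ∫ v in ball 0 r, ‖g v‖ := by
    intro t
    refine rot_setIntegral (fun _ => Complex.exp (t * Complex.I)) (hrotc t) (S := ball 0 r) ?_ (fun v => ‖g v‖)
    ext v
    have : (fun k => Complex.exp (t * Complex.I) * v k) = Complex.exp (t * Complex.I) • v := rfl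
    simp only [Set.mem_preimage, this, mem_ball_zero_iff, hnorm]
  have hpt : ∀ v ∈ ball (0 : Fin n → ℂ) r, 2 * Real.pi * ‖f z‖ ≤ ∫ t in (0:ℝ)..2 * Real.pi, ‖g (Complex.exp (t * Complex.I) • v)‖ := by
    intro v hv
    rw [mem_ball_zero_iff] at hv
    have hd : DifferentiableOn ℂ (fun l : ℂ => g (l • v)) (closedBall 0 |1|) := by
      refine hf.comp (by fun_prop) fun l hl => hmaps ?_
      simp only [abs_one, mem_closedBall_zero_iff] at hl
      rw [mem_closedBall_zero_iff, norm_smul]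
      nlinarith [norm_nonneg v]
    have h1 := (hd.diffContOnCl_ball (subset_refl _)).circleAverage
    rw [Real.circleAverage_def] at h1
    have h2 : g ((0:ℂ) • v) = f z := by simp [hg]
    rw [h2, inv_smul_eq_iff₀ (by positivity)] at h1
    have h3 := congrArg norm h1
    rw [norm_smul, Real.norm_of_nonneg (by positivity)] at h3
    rw [← h3]
    refine (intervalIntegral.norm_integral_le_integral_norm (by positivity)).trans (le_of_eq ?_)
    simp [circleMap]
  have h_integ : Integrable (fun q : (Fin n → ℂ) × ℝ => ‖g (Complex.exp (q.2 * Complex.I) • q.1)‖)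
      ((volume.restrict (ball 0 r)).prod (volume.restrict (Set.Ioc 0 (2 * Real.pi)))) := by
    rw [Measure.prod_restrict]
    have hcomp : IsCompact (closedBall (0 : Fin n → ℂ) r ×ˢ Set.Icc 0 (2 * Real.pi)) :=
      (isCompact_closedBall _ _).prod isCompact_Icc
    refine IntegrableOn.mono_set (t := closedBall (0 : Fin n → ℂ) r ×ˢ Set.Icc 0 (2 * Real.pi)) ?_
      (Set.prod_mono ball_subset_closedBall Set.Ioc_subset_Icc_self)
    refine ContinuousOn.integrableOn_compact hcomp (ContinuousOn.norm ?_)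
    refine hgc.comp (by fun_prop) fun q hq => ?_
    rw [mem_closedBall_zero_iff, hnorm]
    simpa using hq.1
  have hfin : volume (ball (0 : Fin n → ℂ) r) ≠ ⊤ := measure_ball_lt_top.ne
  have h1 : ∫ v in ball (0 : Fin n → ℂ) r, 2 * Real.pi * ‖f z‖ ≤
      ∫ v in ball (0 : Fin n → ℂ) r, ∫ t in (0:ℝ)..2 * Real.pi, ‖g (Complex.exp (t * Complex.I) • v)‖ := by
    refine setIntegral_mono_on (integrableOn_const hfin) ?_ measurableSet_ball hpt
    simp_rw [intervalIntegral.integral_of_le Real.two_pi_pos.le]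
    exact h_integ.integral_prod_left
  have h2 : ∫ v in ball (0 : Fin n → ℂ) r, ∫ t in (0:ℝ)..2 * Real.pi, ‖g (Complex.exp (t * Complex.I) • v)‖ =
      ∫ t in (0:ℝ)..2 * Real.pi, ∫ v in ball (0 : Fin n → ℂ) r, ‖g (Complex.exp (t * Complex.I) • v)‖ := by
    simp_rw [intervalIntegral.integral_of_le Real.two_pi_pos.le]
    exact integral_integral_swap h_integ
  rw [h2] at h1
  simp_rw [hrot] at h1
  rw [setIntegral_const, intervalIntegral.integral_const, smul_eq_mul, smul_eq_mul, sub_zero] at h1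
  rw [hshift, hvol]
  have := Real.two_pi_pos
  rw [Measure.real] at h1
  nlinarith [mul_pos this this]
end

section
open MeasureTheory Metric Filter Topology

lemma holo_symm {n : ℕ} {U : Set (Fin n → ℂ)} (hU : IsOpen U) {f : (Fin n → ℂ) → ℂ}
    (hf : DifferentiableOn ℂ f U) {z : Fin n → ℂ} (hz : z ∈ U) (v w : Fin n → ℂ) :
    fderiv ℂ (fun z => fderiv ℂ f z v) z w = fderiv ℂ (fun z => fderiv ℂ f z w) z v := by
  have hc : ContDiffAt ℂ 2 f z := (holo_contDiffOn hU 2 hf).contDiffAt (hU.mem_nhds hz)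
  have hd : DifferentiableAt ℂ (fderiv ℂ f) z :=
    (hc.fderiv_right (m := 1) (by norm_num)).differentiableAt (by simp)
  have h1 := hc.isSymmSndFDerivAt (by simp)
  have h2 : ∀ v w, fderiv ℂ (fun z => fderiv ℂ f z v) z w = fderiv ℂ (fderiv ℂ f) z w v := by
    intro v w
    rw [fderiv_clm_apply hd (by fun_prop)]
    simp
  rw [h2, h2]
  exact h1 w v

/-- The determinant as alternating function of the rows. -/
noncomputable def rdet {n : ℕ} (A : Fin n → Fin n → ℂ) : ℂ := Matrix.det (Matrix.of A)

lemma rdet_eq {n : ℕ} (A : Fin n → Fin n → ℂ) : rdet A = Matrix.detRowAlternating (R := ℂ) (n := Fin n) A := rfl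

/-- rdet as continuous multilinear map -/
noncomputable def rdetC (n : ℕ) : ContinuousMultilinearMap ℂ (fun _ : Fin n => Fin n → ℂ) ℂ :=
  { (Matrix.detRowAlternating (R := ℂ) (n := Fin n)).toMultilinearMap with
    cont := by
      change Continuous (fun A : Fin n → Fin n → ℂ => Matrix.det (Matrix.of A))
      exact Continuous.matrix_det (by fun_prop) }

lemma rdetC_apply {n : ℕ} (A : Fin n → Fin n → ℂ) : rdetC n A = rdet A := rfl

lemma rdet_update_sum {n : ℕ} (A : Fin n → Fin n → ℂ) (j : Fin n) (v : Fin n → ℂ) :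
    rdet (Function.update A j v) = ∑ k, v k * rdet (Function.update A j (Pi.single k 1)) := by
  have hv : v = ∑ k, v k • (Pi.single k 1 : Fin n → ℂ) := by
    conv_lhs => rw [← Finset.univ_sum_single v]
    refine Finset.sum_congr rfl fun k _ => ?_
    rw [← Pi.single_smul]; simp
  conv_lhs => rw [hv]
  rw [rdet_eq, AlternatingMap.map_update_sum]
  refine Finset.sum_congr rfl fun k _ => ?_
  rw [AlternatingMap.map_update_smul]; rfl

lemma rdet_antisymm {n : ℕ} (A : Fin n → Fin n → ℂ) {i j : Fin n} (hij : i ≠ j) (x y : Fin n → ℂ) :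
    rdet (Function.update (Function.update A j x) i y) = - rdet (Function.update (Function.update A j y) i x) := by
  have := AlternatingMap.map_swap (Matrix.detRowAlternating (R := ℂ) (n := Fin n))
    (Function.update (Function.update A j y) i x) hij
  rw [rdet_eq, rdet_eq, ← this]
  congr 1
  funext l
  by_cases hl : l = i
  · subst hl; simp [Function.update_of_ne hij.symm]
  · by_cases hl2 : l = j
    · subst hl2; simp [Function.update_of_ne hl]
    · simp [Function.update_of_ne, hl, hl2, Equiv.swap_apply_of_ne_of_ne hl hl2]

/-- Jacobian rows. -/
noncomputable def jac {n : ℕ} (g : (Fin n → ℂ) → (Fin n → ℂ)) (z : Fin n → ℂ) : Fin n → Fin n → ℂ :=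
  fun i k => fderiv ℂ (fun w => g w i) z (Pi.single k 1)

/-- Cofactors. -/
noncomputable def cof {n : ℕ} (g : (Fin n → ℂ) → (Fin n → ℂ)) (j k : Fin n) (z : Fin n → ℂ) : ℂ :=
  rdet (Function.update (jac g z) j (Pi.single k 1))

section
variable {n : ℕ} {D : Set (Fin n → ℂ)} {g : (Fin n → ℂ) → (Fin n → ℂ)}

lemma jac_row_diff (hD : IsOpen D) (hg : DifferentiableOn ℂ g D) (i : Fin n) : DifferentiableOn ℂ (fun z => jac g z i) D := by
  rw [differentiableOn_pi]
  intro k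
  exact holo_fderiv hD (differentiableOn_pi.1 hg i) _

lemma rdet_diff {A : (Fin n → ℂ) → Fin n → Fin n → ℂ} (hA : ∀ i, DifferentiableOn ℂ (fun z => A z i) D) :
    DifferentiableOn ℂ (fun z => rdet (A z)) D := by
  intro z hz
  have := HasFDerivWithinAt.multilinear_comp (rdetC n) (g := fun i z => A z i) (fun i => (hA i z hz).hasFDerivWithinAt)
  exact this.differentiableWithinAt

lemma cof_diff (hD : IsOpen D) (hg : DifferentiableOn ℂ g D) (j k : Fin n) : DifferentiableOn ℂ (cof g j k) D := by
  apply rdet_diff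
  intro i
  by_cases h : i = j
  · subst h; simp
  · simpa [Function.update_of_ne h] using jac_row_diff hD hg i

lemma piola (hD : IsOpen D) (hg : DifferentiableOn ℂ g D) (j : Fin n) {z : Fin n → ℂ} (hz : z ∈ D) :
    ∑ k, fderiv ℂ (cof g j k) z (Pi.single k 1) = 0 := by
  have hrow : ∀ i, HasFDerivAt (fun z => jac g z i) (fderiv ℂ (fun z => jac g z i) z) z := fun i =>
    ((jac_row_diff hD hg i z hz).differentiableAt (hD.mem_nhds hz)).hasFDerivAt
  have hk : ∀ k, fderiv ℂ (cof g j k) z (Pi.single k 1) = ∑ i, if i = j then 0 else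
      rdet (Function.update (Function.update (jac g z) j (Pi.single k 1)) i (fderiv ℂ (fun z => jac g z i) z (Pi.single k 1))) := by
    intro k
    have h1 : ∀ i, HasFDerivAt (fun z => Function.update (jac g z) j (Pi.single k (1:ℂ)) i)
        (if i = j then 0 else fderiv ℂ (fun z => jac g z i) z) z := by
      intro i
      by_cases h : i = j
      · subst h; simpa using hasFDerivAt_const (𝕜 := ℂ) (Pi.single k (1:ℂ) : Fin n → ℂ) z
      · simpa [Function.update_of_ne h, h] using hrow i
    have h2 := HasFDerivAt.multilinear_comp (rdetC n) h1
    have h3 : HasFDerivAt (cof g j k) _ z := h2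
    rw [h3.fderiv]
    simp only [FunLike.coe_sum, Finset.sum_apply, ContinuousLinearMap.comp_apply, ContinuousMultilinearMap.toContinuousLinearMap_apply]
    refine Finset.sum_congr rfl fun i _ => ?_
    by_cases h : i = j
    · simp only [h, if_true]
      rw [zero_apply]
      exact (rdetC n).toMultilinearMap.map_update_zero _ _
    · simp only [h, if_false]
      rfl
  simp_rw [hk]
  rw [Finset.sum_comm]
  refine Finset.sum_eq_zero fun i _ => ?_
  by_cases h : i = j
  · simp [h]
  simp only [h, if_false]
  have hH : ∀ k l, fderiv ℂ (fun z => jac g z i) z (Pi.single k 1) l = fderiv ℂ (fun z => jac g z i) z (Pi.single l 1) k := by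
    have h0 : ∀ k l, fderiv ℂ (fun z => jac g z i) z (Pi.single k 1) l = fderiv ℂ (fun z => jac g z i l) z (Pi.single k 1) := by
      intro k l
      rw [fderiv_pi (fun l => (((differentiableOn_pi.1 (jac_row_diff hD hg i) l) z hz).differentiableAt (hD.mem_nhds hz)))]
      rfl
    intro k l
    rw [h0, h0]
    exact holo_symm hD (differentiableOn_pi.1 hg i) hz _ _
  simp_rw [rdet_update_sum _ i (fderiv ℂ (fun z => jac g z i) z _)]
  have hanti : ∑ k, ∑ l, fderiv ℂ (fun z => jac g z i) z (Pi.single k 1) l *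
      rdet (Function.update (Function.update (jac g z) j (Pi.single k 1)) i (Pi.single l 1)) =
      - ∑ k, ∑ l, fderiv ℂ (fun z => jac g z i) z (Pi.single k 1) l *
      rdet (Function.update (Function.update (jac g z) j (Pi.single k 1)) i (Pi.single l 1)) := by
    conv_lhs => rw [Finset.sum_comm]
    rw [← Finset.sum_neg_distrib]
    refine Finset.sum_congr rfl fun k _ => ?_
    rw [← Finset.sum_neg_distrib]
    refine Finset.sum_congr rfl fun l _ => ?_
    rw [hH, rdet_antisymm _ h]; ring
  exact self_eq_neg.1 hanti

end

/-- Wirtinger derivative. -/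
noncomputable def wirt {n : ℕ} (u : (Fin n → ℂ) → ℂ) (z : Fin n → ℂ) (k : Fin n) : ℂ :=
  (fderiv ℝ u z (Pi.single k 1) - Complex.I * fderiv ℝ u z (Pi.single k Complex.I)) / 2

lemma wirt_mul {n : ℕ} {u v : (Fin n → ℂ) → ℂ} {z : Fin n → ℂ} (hu : DifferentiableAt ℝ u z) (hv : DifferentiableAt ℝ v z) (k : Fin n) :
    wirt (fun z => u z * v z) z k = wirt u z k * v z + u z * wirt v z k := by
  simp only [wirt]
  rw [fderiv_fun_mul hu hv]
  simp only [add_apply, smul_apply, smul_eq_mul]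
  ring

lemma fderiv_real_of_complex {n : ℕ} {u : (Fin n → ℂ) → ℂ} {z : Fin n → ℂ} (hu : DifferentiableAt ℂ u z) (v : Fin n → ℂ) :
    fderiv ℝ u z v = fderiv ℂ u z v := by
  rw [(hu.hasFDerivAt.restrictScalars ℝ).fderiv]; rfl

lemma single_I {n : ℕ} (k : Fin n) : (Pi.single k Complex.I : Fin n → ℂ) = Complex.I • Pi.single k 1 := by
  rw [← Pi.single_smul]; simp

lemma wirt_holo {n : ℕ} {u : (Fin n → ℂ) → ℂ} {z : Fin n → ℂ} (hu : DifferentiableAt ℂ u z) (k : Fin n) :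
    wirt u z k = fderiv ℂ u z (Pi.single k 1) := by
  simp only [wirt, fderiv_real_of_complex hu, single_I, map_smul, smul_eq_mul]
  rw [← mul_assoc, Complex.I_mul_I]; ring

lemma wirt_conj {n : ℕ} {u : (Fin n → ℂ) → ℂ} {z : Fin n → ℂ} (hu : DifferentiableAt ℂ u z) (k : Fin n) :
    wirt (fun z => (starRingEnd ℂ) (u z)) z k = 0 := by
  have h1 : HasFDerivAt (fun z => (starRingEnd ℂ) (u z)) ((Complex.conjCLE : ℂ →L[ℝ] ℂ).comp ((fderiv ℂ u z).restrictScalars ℝ)) z :=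
    (Complex.conjCLE : ℂ →L[ℝ] ℂ).hasFDerivAt.comp z (hu.hasFDerivAt.restrictScalars ℝ)
  simp only [wirt, h1.fderiv, single_I]
  simp only [ContinuousLinearMap.comp_apply, ContinuousLinearMap.coe_restrictScalars', map_smul, smul_eq_mul,
    ContinuousLinearEquiv.coe_coe, Complex.conjCLE_apply, map_mul, Complex.conj_I]
  rw [← mul_assoc]; simp

lemma integral_fderiv_zero {n : ℕ} {X : (Fin n → ℂ) → ℂ} (hX : ContDiff ℝ 1 X) (hc : HasCompactSupport X) (v : Fin n → ℂ) :
    ∫ z, fderiv ℝ X z v = 0 := by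
  have hcd : Continuous fun z => fderiv ℝ X z v := (hX.continuous_fderiv (by simp)).clm_apply continuous_const
  have h2 : HasCompactSupport fun z => fderiv ℝ X z v := hc.fderiv_apply (𝕜 := ℝ) v
  have := integral_mul_fderiv_eq_neg_fderiv_mul_of_integrable (μ := (volume : Measure (Fin n → ℂ))) (f := fun _ => (1:ℂ)) (g := X) (v := v)
    (by simp) (by simpa using hcd.integrable_of_hasCompactSupport h2)
    (by simpa using hX.continuous.integrable_of_hasCompactSupport hc) (fun x _ => by fun_prop) (fun x _ => hX.differentiable (by simp) x)
  simpa using this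

lemma integral_wirt_zero {n : ℕ} {X : (Fin n → ℂ) → ℂ} (hX : ContDiff ℝ 1 X) (hc : HasCompactSupport X) (k : Fin n) :
    Integrable (fun z => wirt X z k) ∧ ∫ z, wirt X z k = 0 := by
  have hI : ∀ v, Integrable fun z => fderiv ℝ X z v := fun v =>
    ((hX.continuous_fderiv (by simp)).clm_apply continuous_const).integrable_of_hasCompactSupport (hc.fderiv_apply (𝕜 := ℝ) v)
  constructor
  · exact ((hI _).sub ((hI _).const_mul _)).div_const _
  · simp only [wirt]
    rw [integral_div, integral_sub (hI _) ((hI _).const_mul _), integral_const_mul, integral_fderiv_zero hX hc, integral_fderiv_zero hX hc]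
    simp

/-- Integration by parts against a conjugate-holomorphic function. -/
lemma piola_integral {n : ℕ} {D : Set (Fin n → ℂ)} {g : (Fin n → ℂ) → (Fin n → ℂ)} (hD : IsOpen D) (hg : DifferentiableOn ℂ g D)
    {V : (Fin n → ℂ) → ℂ} (hV : ContDiff ℝ 1 V) (hVc : HasCompactSupport V) (hVs : tsupport V ⊆ D)
    {h : (Fin n → ℂ) → ℂ} (hh : DifferentiableOn ℂ h D) (j : Fin n) :
    ∫ z, rdet (Function.update (jac g z) j (wirt V z)) * (starRingEnd ℂ) (h z) = 0 := by
  set X : Fin n → (Fin n → ℂ) → ℂ := fun k z => V z * (cof g j k z * (starRingEnd ℂ) (h z)) with hXdef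
  have hreal : ∀ {u : (Fin n → ℂ) → ℂ}, DifferentiableOn ℂ u D → ∀ z ∈ D, ContDiffAt ℝ 1 u z := by
    intro u hu z hz
    exact ((holo_contDiffOn hD 1 hu).contDiffAt (hD.mem_nhds hz)).restrict_scalars ℝ
  have hat : ∀ {u : (Fin n → ℂ) → ℂ}, DifferentiableOn ℂ u D → ∀ z ∈ D, DifferentiableAt ℂ u z := fun hu z hz =>
    (hu z hz).differentiableAt (hD.mem_nhds hz)
  have hconj : ∀ z ∈ D, ContDiffAt ℝ 1 (fun z => (starRingEnd ℂ) (h z)) z := fun z hz =>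
    (Complex.conjCLE : ℂ →L[ℝ] ℂ).contDiff.contDiffAt.comp z (hreal hh z hz)
  have hsupp : ∀ k, tsupport (X k) ⊆ tsupport V := fun k => tsupport_mul_subset_left
  have hXc : ∀ k, ContDiff ℝ 1 (X k) := by
    intro k
    refine contDiff_iff_contDiffAt.2 fun z => ?_
    by_cases hz : z ∈ tsupport (X k)
    swap
    · exact (contDiffAt_const (c := (0:ℂ))).congr_of_eventuallyEq (notMem_tsupport_iff_eventuallyEq.1 hz)
    have hzD := hVs (hsupp k hz)
    exact hV.contDiffAt.mul ((hreal (cof_diff hD hg j k) z hzD).mul (hconj z hzD))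
  have hXs : ∀ k, HasCompactSupport (X k) := fun k => hVc.mul_right
  have hpt : ∀ z, rdet (Function.update (jac g z) j (wirt V z)) * (starRingEnd ℂ) (h z) = ∑ k, wirt (X k) z k := by
    intro z
    by_cases hz : z ∈ tsupport V
    · have hzD := hVs hz
      have h1 : ∀ k, wirt (X k) z k = wirt V z k * cof g j k z * (starRingEnd ℂ) (h z)
          + V z * (starRingEnd ℂ) (h z) * fderiv ℂ (cof g j k) z (Pi.single k 1) := by
        intro k
        have d1 := (hreal (cof_diff hD hg j k) z hzD).differentiableAt (by simp)
        have d2 := (hconj z hzD).differentiableAt (by simp)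
        simp only [hXdef]
        rw [wirt_mul (hV.differentiable (by simp) z) (d1.fun_mul d2), wirt_mul d1 d2, wirt_conj (hat hh z hzD),
          wirt_holo (hat (cof_diff hD hg j k) z hzD)]
        ring
      simp_rw [h1]
      rw [Finset.sum_add_distrib, ← Finset.mul_sum, piola hD hg j hzD, rdet_update_sum, Finset.sum_mul]
      simp [cof]
    · have h0 : V =ᶠ[𝓝 z] 0 := notMem_tsupport_iff_eventuallyEq.1 hz
      have h0' : ∀ k, X k =ᶠ[𝓝 z] 0 := fun k => by
        filter_upwards [h0] with w hw
        simp only [hXdef, hw, Pi.zero_apply, zero_mul]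
      have e1 : wirt V z = 0 := by
        funext k; simp only [wirt, h0.fderiv_eq]; simp
      have e2 : ∀ k, wirt (X k) z k = 0 := fun k => by
        simp only [wirt, (h0' k).fderiv_eq]; simp
      simp only [e2, e1, Finset.sum_const_zero]
      rw [rdet_eq, AlternatingMap.map_update_zero, zero_mul]
  simp_rw [hpt]
  rw [integral_finsetSum _ fun k _ => (integral_wirt_zero (hXc k) (hXs k) k).1]
  exact Finset.sum_eq_zero fun k _ => (integral_wirt_zero (hXc k) (hXs k) k).2
end

section
open MeasureTheory Metric Filter Topology
open Finset

noncomputable def rho (p : ℝ) {n : ℕ} (z : Fin n → ℂ) : ℝ := ∑ j, ‖z j‖ ^ (2 * p)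

noncomputable def dil {n : ℕ} (c : ℂ) (w : Fin n → ℂ) : Fin n → ℂ := fun k => c ^ (k.1 + 1) * w k

lemma dil_dil {n : ℕ} (c d : ℂ) (w : Fin n → ℂ) : dil c (dil d w) = dil (c * d) w := by
  funext k; simp only [dil]; rw [mul_pow]; ring

lemma dil_one {n : ℕ} (w : Fin n → ℂ) : dil 1 w = w := by
  funext k; simp [dil]

lemma dil_zero {n : ℕ} (w : Fin n → ℂ) : dil 0 w = 0 := by
  funext k; simp [dil]

lemma dil_apply_zero {n : ℕ} (c : ℂ) : dil c (0 : Fin n → ℂ) = 0 := by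
  funext k; simp [dil]

lemma continuous_dil {n : ℕ} : Continuous (fun q : ℂ × (Fin n → ℂ) => dil q.1 q.2) := by
  unfold dil; fun_prop

lemma diff_dil {n : ℕ} (c : ℂ) : Differentiable ℂ (fun w : Fin n → ℂ => dil c w) := by
  unfold dil; fun_prop

lemma piMap_smul {n : ℕ} (c : ℂ) (z : Fin n → ℂ) : piMap n (c • z) = dil c (piMap n z) := by
  funext k
  simp only [piMap, dil, Finset.mul_sum]
  refine Finset.sum_congr rfl fun s hs => ?_
  have := (Finset.mem_powersetCard.1 hs).2
  simp [Finset.prod_mul_distrib, this]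

lemma piMap_prod {n : ℕ} (z : Fin n → ℂ) (t : ℂ) :
    ∏ j, (t + z j) = t ^ n + ∑ k : Fin n, piMap n z k * t ^ (n - 1 - k.1) := by
  have h1 : ∏ j, (t + z j) = ∏ j, (z j + t) := Finset.prod_congr rfl fun j _ => add_comm _ _
  rw [h1, Finset.prod_add, Finset.sum_powerset, Finset.sum_range_succ']
  simp only [Finset.card_univ, Fintype.card_fin]
  rw [add_comm]
  congr 1
  · simp
  · rw [Finset.sum_range]
    refine Finset.sum_congr rfl fun k _ => ?_
    simp only [piMap, Finset.sum_mul]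
    refine Finset.sum_congr rfl fun s hs => ?_
    have := (Finset.mem_powersetCard.1 hs).2
    congr 1
    rw [Finset.prod_const, Finset.card_sdiff_of_subset (Finset.subset_univ _), this]
    simp only [Finset.card_univ, Fintype.card_fin]
    congr 1; omega

lemma continuous_piMap {n : ℕ} : Continuous (piMap n) := by
  unfold piMap; fun_prop

lemma diff_piMap {n : ℕ} : Differentiable ℂ (piMap n) := by
  unfold piMap; fun_prop

lemma piMap_perm {n : ℕ} (z : Fin n → ℂ) (σ : Equiv.Perm (Fin n)) : piMap n (z ∘ σ) = piMap n z := by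
  funext k
  simp only [piMap]
  refine Finset.sum_nbij' (fun s => s.map σ.toEmbedding) (fun s => s.map σ.symm.toEmbedding) ?_ ?_ ?_ ?_ ?_
  · intro s hs; simp_all [Finset.mem_powersetCard]
  · intro s hs; simp_all [Finset.mem_powersetCard]
  · intro s hs; ext x; simp
  · intro s hs; ext x; simp
  · intro s hs; simp

lemma exists_perm_of_map_eq {n : ℕ} {z z' : Fin n → ℂ}
    (h : Multiset.map z' Finset.univ.val = Multiset.map z Finset.univ.val) : ∃ σ : Equiv.Perm (Fin n), z' = z ∘ σ := by
  classical
  have hc : ∀ c, Fintype.card {j // z' j = c} = Fintype.card {j // z j = c} := by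
    intro c
    have := congrArg (Multiset.count c) h
    rw [Multiset.count_map, Multiset.count_map] at this
    rw [Fintype.card_subtype, Fintype.card_subtype]
    simp only [Finset.card_def, Finset.filter_val]
    simpa [eq_comm] using this
  let e : ∀ c, {j // z' j = c} ≃ {j // z j = c} := fun c => Fintype.equivOfCardEq (hc c)
  refine ⟨(Equiv.sigmaFiberEquiv z').symm.trans ((Equiv.sigmaCongrRight e).trans (Equiv.sigmaFiberEquiv z)), ?_⟩
  funext j
  exact ((e (z' j) ⟨j, rfl⟩).2).symm

lemma roots_prod {n : ℕ} (y : Fin n → ℂ) :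
    (∏ j, (Polynomial.X + Polynomial.C (y j))).roots = Multiset.map (fun j => - y j) Finset.univ.val := by
  have : (∏ j, (Polynomial.X + Polynomial.C (y j))) = ∏ j, (Polynomial.X - Polynomial.C (- y j)) := by simp
  rw [this, Finset.prod_eq_multiset_prod]
  have h2 := Multiset.map_map (fun a : ℂ => Polynomial.X - Polynomial.C a) (fun j => - y j) Finset.univ.val
  simp only [Function.comp_def] at h2
  rw [← h2, Polynomial.roots_multiset_prod_X_sub_C]

lemma piMap_fibre {n : ℕ} {z z' : Fin n → ℂ} (h : piMap n z = piMap n z') : ∃ σ : Equiv.Perm (Fin n), z' = z ∘ σ := by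
  have hpoly : (∏ j, (Polynomial.X + Polynomial.C (z j))) = ∏ j, (Polynomial.X + Polynomial.C (z' j)) := by
    apply Polynomial.funext
    intro t
    simp only [Polynomial.eval_prod, Polynomial.eval_add, Polynomial.eval_X, Polynomial.eval_C]
    rw [piMap_prod, piMap_prod, h]
  have h2 : Multiset.map (fun j => - z' j) Finset.univ.val = Multiset.map (fun j => - z j) Finset.univ.val := by
    rw [← roots_prod, ← roots_prod, hpoly]
  have h3 : Multiset.map z' Finset.univ.val = Multiset.map z Finset.univ.val := by
    have := congrArg (Multiset.map (fun x : ℂ => -x)) h2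
    simpa [Multiset.map_map, Function.comp_def] using this
  exact exists_perm_of_map_eq h3

noncomputable def monPoly {n : ℕ} (w : Fin n → ℂ) : Polynomial ℂ :=
  Polynomial.X ^ n + ∑ k : Fin n, Polynomial.C (w k) * Polynomial.X ^ (n - 1 - k.1)

lemma monPoly_coeff {n : ℕ} (w : Fin n → ℂ) (i : Fin n) : (monPoly w).coeff (n - 1 - i.1) = w i := by
  unfold monPoly
  rw [Polynomial.coeff_add, Polynomial.coeff_X_pow, if_neg (by have := i.2; omega), zero_add, Polynomial.finsetSum_coeff,
    Finset.sum_eq_single i]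
  · simp
  · intro b _ hb
    rw [Polynomial.coeff_C_mul_X_pow, if_neg]
    have := i.2; have := b.2
    intro h; apply hb; ext; omega
  · simp

lemma monPoly_degree_aux {n : ℕ} (w : Fin n → ℂ) :
    (∑ k : Fin n, Polynomial.C (w k) * Polynomial.X ^ (n - 1 - k.1)).degree < (n : WithBot ℕ) := by
  refine (Polynomial.degree_sum_le _ _).trans_lt ?_
  rw [Finset.sup_lt_iff (WithBot.bot_lt_coe _)]
  intro k _
  refine (Polynomial.degree_C_mul_X_pow_le _ _).trans_lt ?_
  have := k.2
  exact_mod_cast (by omega : n - 1 - k.1 < n)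

lemma piMap_surj (n : ℕ) : Function.Surjective (piMap n) := by
  intro w
  have hm : (monPoly w).Monic := Polynomial.monic_X_pow_add (monPoly_degree_aux w)
  have hd : (monPoly w).natDegree = n := by
    have : (monPoly w).degree = n := by
      unfold monPoly
      rw [Polynomial.degree_add_eq_left_of_degree_lt]
      · simp
      · simpa using monPoly_degree_aux w
    exact Polynomial.natDegree_eq_of_degree_eq_some this
  have hc : (monPoly w).roots.card = n := by
    exact (Polynomial.splits_iff_card_roots.1 (IsAlgClosed.splits _)).trans hd
  have hl : (monPoly w).roots.toList.length = n := by rw [Multiset.length_toList, hc]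
  set l := (monPoly w).roots.toList with hldef
  let z : Fin n → ℂ := fun j => - l.get (j.cast hl.symm)
  have h1 : Multiset.map (fun j => - z j) Finset.univ.val = (monPoly w).roots := by
    have : (Finset.univ.val : Multiset (Fin n)) = ((List.finRange n : List (Fin n)) : Multiset (Fin n)) := by rfl
    rw [this, Multiset.map_coe, ← Multiset.coe_toList (monPoly w).roots, ← hldef]
    congr 1
    apply List.ext_get
    · simp [hl]
    · intro i h1 h2; simp [z]
  refine ⟨z, ?_⟩
  have h2 : ∏ j, (Polynomial.X + Polynomial.C (z j)) = monPoly w := by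
    rw [← Polynomial.prod_multiset_X_sub_C_of_monic_of_roots_card_eq hm (by rw [hc, hd]), ← h1, Multiset.map_map]
    rw [Finset.prod_eq_multiset_prod]
    simp only [Function.comp_def, Polynomial.C_neg, sub_neg_eq_add]
  have h3 : monPoly (piMap n z) = monPoly w := by
    rw [← h2]
    apply Polynomial.funext
    intro t
    simp only [monPoly, Polynomial.eval_prod, Polynomial.eval_add, Polynomial.eval_X, Polynomial.eval_C, Polynomial.eval_pow,
      Polynomial.eval_finsetSum, Polynomial.eval_mul]
    rw [piMap_prod]
  funext k
  rw [← monPoly_coeff (piMap n z) k, h3, monPoly_coeff]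

lemma root_bound {n : ℕ} (z : Fin n → ℂ) (j : Fin n) : ‖z j‖ ≤ max 1 (n * ‖piMap n z‖) := by
  by_contra hcon
  push Not at hcon
  obtain ⟨h1, h2⟩ := max_lt_iff.1 hcon
  have h := piMap_prod z (- z j)
  rw [Finset.prod_eq_zero (Finset.mem_univ j) (by simp)] at h
  have h3 : ‖(- z j) ^ n‖ = ‖∑ k : Fin n, piMap n z k * (- z j) ^ (n - 1 - k.1)‖ := by
    rw [eq_neg_of_add_eq_zero_left h.symm, norm_neg]
  have h4 : ‖∑ k : Fin n, piMap n z k * (- z j) ^ (n - 1 - k.1)‖ ≤ n * ‖piMap n z‖ * ‖z j‖ ^ (n - 1) := by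
    refine (norm_sum_le _ _).trans ?_
    have : ∀ k ∈ (Finset.univ : Finset (Fin n)), ‖piMap n z k * (- z j) ^ (n - 1 - k.1)‖ ≤ ‖piMap n z‖ * ‖z j‖ ^ (n - 1) := by
      intro k _
      rw [norm_mul, norm_pow, norm_neg]
      exact mul_le_mul (norm_le_pi_norm _ _) (pow_le_pow_right₀ h1.le (by omega)) (by positivity) (by positivity)
    refine (Finset.sum_le_sum this).trans ?_
    simp; linarith
  rw [norm_pow, norm_neg] at h3
  have hn : n = (n - 1) + 1 := by have := j.2; omega
  have h5 : ‖z j‖ ^ n = ‖z j‖ * ‖z j‖ ^ (n-1) := by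
    conv_lhs => rw [hn, pow_succ]
    ring
  have h6 : (n:ℝ) * ‖piMap n z‖ * ‖z j‖ ^ (n - 1) < ‖z j‖ * ‖z j‖ ^ (n-1) := by
    apply mul_lt_mul_of_pos_right h2; apply pow_pos; linarith
  linarith

lemma piMap_proper (n : ℕ) : IsProperMap (piMap n) := by
  rw [isProperMap_iff_isCompact_preimage]
  refine ⟨continuous_piMap, fun K hK => ?_⟩
  apply isCompact_of_isClosed_isBounded (hK.isClosed.preimage continuous_piMap)
  obtain ⟨C, hC⟩ := hK.isBounded.exists_norm_le
  rw [isBounded_iff_forall_norm_le]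
  refine ⟨max 1 (n * C), fun z hz => ?_⟩
  rw [pi_norm_le_iff_of_nonneg (le_trans zero_le_one (le_max_left _ _))]
  intro j
  refine (root_bound z j).trans (max_le_max le_rfl ?_)
  gcongr
  exact hC _ hz

lemma piMap_quot (n : ℕ) : IsQuotientMap (piMap n) :=
  (piMap_proper n).isClosedMap.isQuotientMap continuous_piMap (piMap_surj n)

noncomputable def rts {n : ℕ} (w : Fin n → ℂ) : Fin n → ℂ := Function.surjInv (piMap_surj n) w

lemma piMap_rts {n : ℕ} (w : Fin n → ℂ) : piMap n (rts w) = w := Function.surjInv_eq (piMap_surj n) w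

/-- gauge -/
noncomputable def gR (p : ℝ) {n : ℕ} (w : Fin n → ℂ) : ℝ := rho p (rts w)

lemma rho_perm (p : ℝ) {n : ℕ} (z : Fin n → ℂ) (σ : Equiv.Perm (Fin n)) : rho p (z ∘ σ) = rho p z := by
  simp only [rho]
  exact Equiv.sum_comp σ (fun j => ‖z j‖ ^ (2 * p))

lemma gR_piMap (p : ℝ) {n : ℕ} (z : Fin n → ℂ) : gR p (piMap n z) = rho p z := by
  obtain ⟨σ, hσ⟩ := piMap_fibre (piMap_rts (piMap n z))
  unfold gR
  conv_rhs => rw [hσ, rho_perm]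

section
variable {p : ℝ} {n : ℕ}

lemma continuous_rho (hp : 0 < p) : Continuous (rho p (n := n)) := by
  unfold rho
  refine continuous_finsetSum _ fun j _ => ?_
  exact (continuous_norm.comp (continuous_apply j)).rpow_const (fun _ => Or.inr (by linarith))

lemma rho_smul (hp : 0 < p) (c : ℂ) (z : Fin n → ℂ) : rho p (c • z) = ‖c‖ ^ (2 * p) * rho p z := by
  simp only [rho, Finset.mul_sum]
  refine Finset.sum_congr rfl fun j _ => ?_
  simp [Real.mul_rpow]

lemma gR_continuous (hp : 0 < p) : Continuous (gR p (n := n)) := by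
  rw [(piMap_quot n).continuous_iff]
  have : gR p (n := n) ∘ piMap n = rho p := by funext z; exact gR_piMap p z
  rw [this]; exact continuous_rho hp

lemma gR_dil (hp : 0 < p) (c : ℂ) (w : Fin n → ℂ) : gR p (dil c w) = ‖c‖ ^ (2 * p) * gR p w := by
  obtain ⟨z, rfl⟩ := piMap_surj n w
  rw [← piMap_smul, gR_piMap, gR_piMap, rho_smul hp]

lemma gR_nonneg (hp : 0 < p) (w : Fin n → ℂ) : 0 ≤ gR p w := by
  unfold gR rho; positivity

lemma norm_le_of_rho (hp : 0 < p) {z : Fin n → ℂ} {c : ℝ} (h : rho p z ≤ c) (j : Fin n) : ‖z j‖ ≤ c ^ (1 / (2 * p)) := by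
  have h1 : ‖z j‖ ^ (2 * p) ≤ c := by
    refine le_trans ?_ h
    exact Finset.single_le_sum (f := fun j => ‖z j‖ ^ (2 * p)) (fun i _ => by positivity) (Finset.mem_univ j)
  have h2 := Real.rpow_le_rpow (by positivity) h1 (show 0 ≤ 1 / (2 * p) by positivity)
  rwa [← Real.rpow_mul (by positivity), mul_one_div_cancel (by positivity), Real.rpow_one] at h2

lemma rho_compact (hp : 0 < p) (c : ℝ) : IsCompact {z : Fin n → ℂ | rho p z ≤ c} := by
  apply isCompact_of_isClosed_isBounded (isClosed_le (continuous_rho hp) continuous_const)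
  rw [isBounded_iff_forall_norm_le]
  refine ⟨|c ^ (1 / (2 * p))|, fun z hz => ?_⟩
  rw [pi_norm_le_iff_of_nonneg (abs_nonneg _)]
  intro j
  exact (norm_le_of_rho hp hz j).trans (le_abs_self _)

lemma gR_compact (hp : 0 < p) (c : ℝ) : IsCompact {w : Fin n → ℂ | gR p w ≤ c} := by
  have : {w : Fin n → ℂ | gR p w ≤ c} = piMap n '' {z | rho p z ≤ c} := by
    ext w
    constructor
    · intro h; exact ⟨rts w, h, piMap_rts w⟩
    · rintro ⟨z, hz, rfl⟩; simpa [gR_piMap] using hz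
  rw [this]
  exact (rho_compact hp c).image continuous_piMap

lemma gR_zero (hp : 0 < p) : gR p (0 : Fin n → ℂ) = 0 := by
  have := gR_dil hp 0 (0 : Fin n → ℂ)
  rw [dil_zero] at this
  rw [this, norm_zero, Real.zero_rpow (by positivity), zero_mul]

lemma gR_eq_zero (hp : 0 < p) {w : Fin n → ℂ} (h : gR p w = 0) : w = 0 := by
  have h1 : ∀ j, ‖rts w j‖ ^ (2 * p) = 0 := by
    intro j
    have h0 : ∑ j, ‖rts w j‖ ^ (2 * p) = 0 := h
    exact (Finset.sum_eq_zero_iff_of_nonneg (fun i _ => by positivity)).1 h0 j (Finset.mem_univ j)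
  have h2 : rts w = 0 := by
    funext j
    have := (Real.rpow_eq_zero (norm_nonneg _) (by positivity)).1 (h1 j)
    simpa using this
  rw [← piMap_rts w, h2]
  have := piMap_smul 0 (0 : Fin n → ℂ)
  rwa [zero_smul, dil_zero] at this

lemma symE_eq (hp : 0 < p) : symEllipsoid p n = {w | gR p w < 1} := by
  ext w
  constructor
  · rintro ⟨z, hz, rfl⟩
    simp only [Set.mem_ofPred_eq, gR_piMap]; exact hz
  · intro h; exact ⟨rts w, h, piMap_rts w⟩

lemma gR_open (hp : 0 < p) (t : ℝ) : IsOpen {w : Fin n → ℂ | gR p w < t} := isOpen_lt (gR_continuous hp) continuous_const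

lemma gR_preconn (hp : 0 < p) (t : ℝ) : IsPreconnected {w : Fin n → ℂ | gR p w < t} := by
  apply isPreconnected_of_forall (0 : Fin n → ℂ)
  intro w hw
  refine ⟨(fun s : ℝ => dil (s:ℂ) w) '' Set.Icc 0 1, ?_, ⟨0, by simp, by simp [dil_zero]⟩, ⟨1, by simp, by simp [dil_one]⟩, ?_⟩
  · rintro _ ⟨s, hs, rfl⟩
    simp only [Set.mem_ofPred_eq] at hw ⊢
    rw [gR_dil hp]
    refine lt_of_le_of_lt ?_ hw
    have h1 : ‖(s:ℂ)‖ ^ (2 * p) ≤ 1 := by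
      apply Real.rpow_le_one (norm_nonneg _) _ (by positivity)
      simp [abs_of_nonneg hs.1, hs.2]
    exact mul_le_of_le_one_left (gR_nonneg hp w) h1
  · apply isPreconnected_Icc.image
    have : Continuous (fun s : ℝ => dil (s:ℂ) w) := by unfold dil; fun_prop
    exact this.continuousOn

end
end

section
open MeasureTheory Metric Filter Topology
open Finset

lemma wirt_congr {n : ℕ} {u v : (Fin n → ℂ) → ℂ} {z : Fin n → ℂ} (h : u =ᶠ[𝓝 z] v) : wirt u z = wirt v z := by
  funext k; simp only [wirt, h.fderiv_eq]

lemma wirt_zero_fun {n : ℕ} {z : Fin n → ℂ} : wirt (0 : (Fin n → ℂ) → ℂ) z = 0 := by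
  funext k; simp [wirt]

lemma real_clm_wirt {n : ℕ} (L : (Fin n → ℂ) →L[ℝ] ℂ) (a : Fin n → ℂ) :
    L a - Complex.I * L (Complex.I • a) = ∑ l, a l * (L (Pi.single l 1) - Complex.I * L (Pi.single l Complex.I)) := by
  have h1 : ∀ l, ∀ c : ℂ, L (Pi.single l c) = c.re * L (Pi.single l 1) + c.im * L (Pi.single l Complex.I) := by
    intro l c
    have e : (Pi.single l c : Fin n → ℂ) = c.re • (Pi.single l 1 : Fin n → ℂ) + c.im • (Pi.single l Complex.I : Fin n → ℂ) := by
      rw [← Pi.single_smul, ← Pi.single_smul, ← Pi.single_add]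
      congr 1
      simp [Complex.re_add_im]
    rw [e, map_add, map_smul, map_smul]; simp
  have h2 : ∀ b : Fin n → ℂ, L b = ∑ l, L (Pi.single l (b l)) := by
    intro b
    rw [← map_sum]
    congr 1
    funext i
    simp [Finset.sum_apply, Pi.single_apply]
  rw [h2 a, h2 (Complex.I • a), Finset.mul_sum, ← Finset.sum_sub_distrib]
  refine Finset.sum_congr rfl fun l _ => ?_
  rw [h1 l (a l), h1 l ((Complex.I • a) l)]
  simp only [Pi.smul_apply, smul_eq_mul, Complex.mul_re, Complex.mul_im, Complex.I_re, Complex.I_im]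
  conv_rhs => rw [← Complex.re_add_im (a l)]
  push_cast
  linear_combination ((a l).im * L (Pi.single l Complex.I)) * Complex.I_sq

lemma wirt_comp {n : ℕ} {u : (Fin n → ℂ) → ℂ} {f : (Fin n → ℂ) → (Fin n → ℂ)} {z : Fin n → ℂ}
    (hu : DifferentiableAt ℝ u (f z)) (hf : DifferentiableAt ℂ f z) (k : Fin n) :
    wirt (fun w => u (f w)) z k = ∑ l, wirt u (f z) l * jac f z l k := by
  have h1 : HasFDerivAt (fun w => u (f w)) ((fderiv ℝ u (f z)).comp ((fderiv ℂ f z).restrictScalars ℝ)) z :=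
    hu.hasFDerivAt.comp z (hf.hasFDerivAt.restrictScalars ℝ)
  have h2 : ∀ l, jac f z l k = (fderiv ℂ f z (Pi.single k 1)) l := by
    intro l
    simp only [jac]
    rw [fderiv_pi (fun i => differentiableAt_pi.1 hf i)]
    simp
  simp only [wirt, h1.fderiv, h2]
  simp only [ContinuousLinearMap.comp_apply, ContinuousLinearMap.coe_restrictScalars', single_I, map_smul]
  rw [real_clm_wirt, Finset.sum_div]
  refine Finset.sum_congr rfl fun l _ => ?_
  rw [single_I]; ring

section
variable {n : ℕ} {D : Set (Fin n → ℂ)} {f : (Fin n → ℂ) → (Fin n → ℂ)}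

open Classical in
/-- pull back by `f`, cut to `D` -/
noncomputable def pull (D : Set (Fin n → ℂ)) (f : (Fin n → ℂ) → (Fin n → ℂ)) (u h : (Fin n → ℂ) → ℂ) (z : Fin n → ℂ) : ℂ :=
  if z ∈ D then u (f z) * h z else 0

lemma pull_supp (hD : IsOpen D) (hf : IsProperHolomorphic f D D) {u h : (Fin n → ℂ) → ℂ}
    (hc : HasCompactSupport u) (hs : tsupport u ⊆ D) :
    tsupport (pull D f u h) ⊆ D ∩ f ⁻¹' (tsupport u) := by
  have hK := hf.2.2 _ hs hc
  refine closure_minimal ?_ hK.isClosed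
  intro z hz
  simp only [Function.mem_support, pull, ne_eq, ite_eq_right_iff, not_forall] at hz
  obtain ⟨hzD, hne⟩ := hz
  refine ⟨hzD, subset_tsupport _ ?_⟩
  intro h0; apply hne; rw [h0, zero_mul]

lemma pull_compact (hD : IsOpen D) (hf : IsProperHolomorphic f D D) {u h : (Fin n → ℂ) → ℂ}
    (hc : HasCompactSupport u) (hs : tsupport u ⊆ D) : HasCompactSupport (pull D f u h) :=
  (hf.2.2 _ hs hc).of_isClosed_subset (isClosed_tsupport _) (pull_supp hD hf hc hs)

lemma holo_real (hD : IsOpen D) {m : ℕ} {g : (Fin n → ℂ) → (Fin m → ℂ)} (hg : DifferentiableOn ℂ g D) {z : Fin n → ℂ} (hz : z ∈ D) :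
    ContDiffAt ℝ 1 g z := (holo_contDiffAt hD hg hz 1).restrict_scalars ℝ

lemma pull_eq (hD : IsOpen D) {u h : (Fin n → ℂ) → ℂ} {z : Fin n → ℂ} (hz : z ∈ D) :
    pull D f u h =ᶠ[𝓝 z] fun z => u (f z) * h z := by
  filter_upwards [hD.mem_nhds hz] with w hw
  simp [pull, hw]

lemma pull_contDiff (hD : IsOpen D) (hf : IsProperHolomorphic f D D) {u h : (Fin n → ℂ) → ℂ} (hu : ContDiff ℝ 1 u)
    (hc : HasCompactSupport u) (hs : tsupport u ⊆ D) (hh : ContDiffOn ℝ 1 h D) : ContDiff ℝ 1 (pull D f u h) := by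
  refine contDiff_iff_contDiffAt.2 fun z => ?_
  by_cases hz : z ∈ D
  · refine ContDiffAt.congr_of_eventuallyEq ?_ (pull_eq hD hz)
    exact (hu.contDiffAt.comp z (holo_real hD hf.1 hz)).mul (hh.contDiffAt (hD.mem_nhds hz))
  · have : z ∉ tsupport (pull D f u h) := fun h => hz (pull_supp hD hf hc hs h).1
    exact (contDiffAt_const (c := (0:ℂ))).congr_of_eventuallyEq (notMem_tsupport_iff_eventuallyEq.1 this)

lemma pull_wirt_out (hD : IsOpen D) (hf : IsProperHolomorphic f D D) {u h : (Fin n → ℂ) → ℂ} 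
    (hc : HasCompactSupport u) (hs : tsupport u ⊆ D) {z : Fin n → ℂ} (hz : z ∉ D) : wirt (pull D f u h) z = 0 := by
  have : z ∉ tsupport (pull D f u h) := fun h => hz (pull_supp hD hf hc hs h).1
  rw [wirt_congr (notMem_tsupport_iff_eventuallyEq.1 this), wirt_zero_fun]

/-- mixed rows -/
def mixed (f : (Fin n → ℂ) → (Fin n → ℂ)) (c : Fin n → Fin n ⊕ Fin n) (z : Fin n → ℂ) : Fin n → ℂ :=
  fun i => Sum.elim (fun l => f z l) (fun k => z k) (c i)

lemma mixed_diff (hf : DifferentiableOn ℂ f D) (c : Fin n → Fin n ⊕ Fin n) : DifferentiableOn ℂ (mixed f c) D := by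
  refine differentiableOn_pi.2 fun i => ?_
  unfold mixed
  rcases c i with l | k
  · exact differentiableOn_pi.1 hf l
  · simp only [Sum.elim_inr]; fun_prop

lemma mixed_jac_inl {c : Fin n → Fin n ⊕ Fin n} {i l : Fin n} (h : c i = Sum.inl l) (z : Fin n → ℂ) :
    jac (mixed f c) z i = jac f z l := by
  funext k; simp [jac, mixed, h]

lemma mixed_jac_inr {c : Fin n → Fin n ⊕ Fin n} {i k : Fin n} (h : c i = Sum.inr k) (z : Fin n → ℂ) :
    jac (mixed f c) z i = Pi.single k 1 := by
  funext m; simp only [jac, mixed, h, Sum.elim_inr]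
  have : fderiv ℂ (fun w : Fin n → ℂ => w k) z = ContinuousLinearMap.proj k := (ContinuousLinearMap.proj (R := ℂ) (φ := fun _ : Fin n => ℂ) k).hasFDerivAt.fderiv
  rw [this]
  simp [Pi.single_apply, eq_comm]

lemma rdet_contDiffOn (hD : IsOpen D) {g : (Fin n → ℂ) → (Fin n → ℂ)} (hg : DifferentiableOn ℂ g D) :
    DifferentiableOn ℂ (fun z => rdet (jac g z)) D := rdet_diff fun i => jac_row_diff hD hg i

theorem jac_ne_zero (hD : IsOpen D) (hne : D.Nonempty) (hf : IsProperHolomorphic f D D) :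
    ∃ z ∈ D, rdet (jac f z) ≠ 0 := by
  classical
  let S : Finset (Fin n → Fin n ⊕ Fin n) := Finset.univ.filter fun c => ∃ z ∈ D, rdet (jac (mixed f c) z) ≠ 0
  have hS : S.Nonempty := by
    obtain ⟨z, hz⟩ := hne
    refine ⟨fun i => Sum.inr i, ?_⟩
    simp only [S, Finset.mem_filter, Finset.mem_univ, true_and]
    refine ⟨z, hz, ?_⟩
    have : jac (mixed f (fun i => Sum.inr i)) z = fun i => Pi.single i 1 := by
      funext i; exact mixed_jac_inr rfl z
    rw [this]
    have h1 : Matrix.of (fun i : Fin n => (Pi.single i 1 : Fin n → ℂ)) = 1 := by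
      ext i j; simp [Matrix.one_apply, Pi.single_apply, eq_comm]
    unfold rdet
    rw [h1, Matrix.det_one]; exact one_ne_zero
  obtain ⟨c, hcS, hmax⟩ := Finset.exists_max_image S (fun c => (Finset.univ.filter fun i => (c i).isLeft = true).card) hS
  obtain ⟨z0, hz0, hdet⟩ := (Finset.mem_filter.1 hcS).2
  by_cases hall : ∀ i, (c i).isLeft = true
  · choose l hl using fun i => Sum.isLeft_iff.1 (hall i)
    have hrow : jac (mixed f c) z0 = fun i => jac f z0 (l i) := by
      funext i; exact mixed_jac_inl (hl i) z0
    have hinj : Function.Injective l := by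
      intro i j hij
      by_contra hne
      apply hdet
      rw [rdet_eq]
      exact AlternatingMap.map_eq_zero_of_eq _ _ (by rw [hrow]; simp [hij]) hne
    refine ⟨z0, hz0, fun h0 => hdet ?_⟩
    let σ : Equiv.Perm (Fin n) := Equiv.ofBijective l (Finite.injective_iff_bijective.1 hinj)
    have : jac (mixed f c) z0 = jac f z0 ∘ σ := by rw [hrow]; rfl
    rw [this, rdet_eq, AlternatingMap.map_perm, ← rdet_eq, h0, smul_zero]
  · exfalso
    push Not at hall
    obtain ⟨j, hj⟩ := hall
    obtain ⟨k, hk⟩ : ∃ k, c j = Sum.inr k := Sum.isRight_iff.1 (by simpa using hj)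
    -- maximality
    have hvan : ∀ l, ∀ z ∈ D, rdet (Function.update (jac (mixed f c) z) j (jac f z l)) = 0 := by
      intro l z hz
      by_contra hne0
      have e : jac (mixed f (Function.update c j (Sum.inl l))) z = Function.update (jac (mixed f c) z) j (jac f z l) := by
        funext i
        by_cases hij : i = j
        · subst hij
          rw [mixed_jac_inl (l := l) (by simp)]; simp
        · rw [Function.update_of_ne hij]
          funext m
          simp [jac, mixed, Function.update_of_ne hij]
      have hmem : Function.update c j (Sum.inl l) ∈ S := by
        simp only [S, Finset.mem_filter, Finset.mem_univ, true_and]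
        exact ⟨z, hz, by rw [e]; exact hne0⟩
      have := hmax _ hmem
      apply absurd this
      push Not
      apply Finset.card_lt_card
      rw [Finset.ssubset_iff_of_subset]
      · exact ⟨j, by simp, by simp [hj]⟩
      · intro i hi
        simp only [Finset.mem_filter, Finset.mem_univ, true_and] at hi ⊢
        by_cases hij : i = j
        · subst hij; exact absurd hi hj
        · rw [Function.update_of_ne hij]; exact hi
    obtain ⟨φ, hφs, hφc, hφd, hφr, hφ1⟩ := exists_contDiff_tsupport_subset (E := Fin n → ℂ) (n := 1) (hD.mem_nhds (hf.2.1 hz0))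
    set u : (Fin n → ℂ) → ℂ := fun w => (φ w : ℂ) with hu
    have hud : ContDiff ℝ 1 u := Complex.ofRealCLM.contDiff.comp hφd
    have husupp : tsupport u = tsupport φ := by
      unfold tsupport; congr 1; ext w; simp [u]
    have huc : HasCompactSupport u := by unfold HasCompactSupport; rw [husupp]; exact hφc
    have hus : tsupport u ⊆ D := by rw [husupp]; exact hφs
    set H : (Fin n → ℂ) → ℂ := fun z => rdet (jac (mixed f c) z) with hH
    have hHd : DifferentiableOn ℂ H D := rdet_contDiffOn hD (mixed_diff hf.1 c)
    have hHr : ContDiffOn ℝ 1 H D := (holo_contDiffOn hD 1 hHd).restrict_scalars ℝ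
    have hcoord : ContDiffOn ℝ 1 (fun z : Fin n → ℂ => z k) D := by fun_prop
    have h_integ := piola_integral hD (mixed_diff hf.1 c) (pull_contDiff hD hf hud huc hus hcoord) (pull_compact hD hf huc hus)
      ((pull_supp hD hf huc hus).trans Set.inter_subset_left) hHd j
    set h2 : (Fin n → ℂ) → ℂ := fun z => H z * (starRingEnd ℂ) (H z) with hh2
    have hh2d : ContDiffOn ℝ 1 h2 D := hHr.mul ((Complex.conjCLE : ℂ →L[ℝ] ℂ).contDiff.comp_contDiffOn hHr)
    have hpt : ∀ z, rdet (Function.update (jac (mixed f c) z) j (wirt (pull D f u fun z => z k) z)) * (starRingEnd ℂ) (H z)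
        = pull D f u h2 z := by
      intro z
      by_cases hz : z ∈ D
      · have hfz : DifferentiableAt ℂ f z := (hf.1 z hz).differentiableAt (hD.mem_nhds hz)
        have e1 : wirt (pull D f u fun z => z k) z = z k • ∑ l, wirt u (f z) l • jac f z l + u (f z) • (Pi.single k 1 : Fin n → ℂ) := by
          rw [wirt_congr (pull_eq hD hz)]
          funext m
          rw [wirt_mul (u := fun w => u (f w)) (v := fun w => w k) ((hud.contDiffAt.comp z (holo_real hD hf.1 hz)).differentiableAt (by simp)) (by fun_prop),
            wirt_comp (hud.differentiable (by simp) _) hfz, wirt_holo (by fun_prop)]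
          have : fderiv ℂ (fun w : Fin n → ℂ => w k) z = ContinuousLinearMap.proj k := (ContinuousLinearMap.proj (R := ℂ) (φ := fun _ : Fin n => ℂ) k).hasFDerivAt.fderiv
          rw [this]
          simp [Pi.single_apply, eq_comm, mul_comm, Finset.sum_apply]
        have e2 : rdet (Function.update (jac (mixed f c) z) j (wirt (pull D f u fun z => z k) z)) = u (f z) * H z := by
          rw [e1, rdet_eq, AlternatingMap.map_update_add, AlternatingMap.map_update_smul, AlternatingMap.map_update_smul, AlternatingMap.map_update_sum]
          have : ∀ l ∈ (Finset.univ : Finset (Fin n)), Matrix.detRowAlternating (R := ℂ) (Function.update (jac (mixed f c) z) j (wirt u (f z) l • jac f z l)) = 0 := by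
            intro l _
            rw [AlternatingMap.map_update_smul, ← rdet_eq, hvan l z hz, smul_zero]
          rw [Finset.sum_eq_zero this, smul_zero, zero_add, smul_eq_mul, ← rdet_eq, ← mixed_jac_inr hk z, Function.update_eq_self]
        rw [e2]; simp only [pull, hz, if_true, h2]; ring
      · rw [pull_wirt_out hD hf huc hus hz, rdet_eq, AlternatingMap.map_update_zero, zero_mul]
        simp [pull, hz]
    simp_rw [hpt] at h_integ
    set W : (Fin n → ℂ) → ℝ := fun z => (pull D f u h2 z).re with hW
    have hcont : Continuous (pull D f u h2) := (pull_contDiff hD hf hud huc hus hh2d).continuous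
    have hWeq : ∀ z, pull D f u h2 z = (W z : ℂ) ∧ 0 ≤ W z := by
      intro z
      by_cases hz : z ∈ D
      · have : pull D f u h2 z = ((φ (f z) * Complex.normSq (H z) : ℝ) : ℂ) := by
          simp only [pull, hz, if_true, h2, u, Complex.mul_conj]; push_cast; ring
        have h3 : W z = φ (f z) * Complex.normSq (H z) := by simp only [hW, this, Complex.ofReal_re]
        refine ⟨by rw [h3, this], ?_⟩
        rw [h3]
        exact mul_nonneg (hφr ⟨_, rfl⟩).1 (Complex.normSq_nonneg _)
      · simp [hW, pull, hz]
    have hWc : HasCompactSupport W := (pull_compact hD hf huc hus (h := h2)).comp_left (g := Complex.re) rfl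
    have hWpos : 0 < ∫ z, W z := by
      apply Continuous.integral_pos_of_hasCompactSupport_nonneg_nonzero (Complex.continuous_re.comp hcont) hWc (x := z0)
      · intro z; exact (hWeq z).2
      · intro h0
        have : pull D f u h2 z0 = 0 := by rw [(hWeq z0).1]; exact_mod_cast h0
        simp only [pull, hz0, if_true, u, hφ1, h2, Complex.mul_conj] at this
        simp at this
        exact hdet this
    have : ((∫ z, W z : ℝ) : ℂ) = 0 := by
      have e5 : ∫ z, ((W z : ℝ) : ℂ) = ((∫ z, W z : ℝ) : ℂ) := integral_ofReal
      rw [← e5, ← h_integ]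
      exact integral_congr_ae (Eventually.of_forall fun z => ((hWeq z).1).symm)
    have h0 : ∫ z, W z = 0 := by exact_mod_cast this
    linarith
end
end

section
open MeasureTheory Metric Filter Topology
open Finset
open scoped ContDiff

lemma param_C1 {n : ℕ} {a b : ℝ} {K : ℝ → (Fin n → ℂ) → ℂ}
    (hK : ContDiff ℝ 1 (fun q : ℝ × (Fin n → ℂ) => K q.1 q.2)) :
    ContDiff ℝ 1 (fun w => ∫ t in a..b, K t w) ∧
    ∀ w v, fderiv ℝ (fun w => ∫ t in a..b, K t w) w v = ∫ t in a..b, fderiv ℝ (K t) w v := by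
  set F' : (Fin n → ℂ) → ℝ → ((Fin n → ℂ) →L[ℝ] ℂ) := fun w t =>
    (fderiv ℝ (fun q : ℝ × (Fin n → ℂ) => K q.1 q.2) (t, w)).comp (ContinuousLinearMap.inr ℝ ℝ (Fin n → ℂ)) with hF'
  have hF'c : Continuous (Function.uncurry F') := by
    have h1 : Continuous (fun q : (Fin n → ℂ) × ℝ => fderiv ℝ (fun q : ℝ × (Fin n → ℂ) => K q.1 q.2) (q.2, q.1)) :=
      (hK.continuous_fderiv (by simp)).comp (continuous_snd.prodMk continuous_fst)
    exact h1.clm_comp continuous_const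
  have hder : ∀ t w, HasFDerivAt (K t) (F' w t) w := by
    intro t w
    have h1 : HasFDerivAt (fun w : Fin n → ℂ => ((t, w) : ℝ × (Fin n → ℂ))) (ContinuousLinearMap.inr ℝ ℝ (Fin n → ℂ)) w := by
      exact hasFDerivAt_prodMk_right t w
    exact ((hK.differentiable (by simp) (t, w)).hasFDerivAt).comp w h1
  have hKc : Continuous (fun q : (Fin n → ℂ) × ℝ => K q.2 q.1) := hK.continuous.comp (continuous_snd.prodMk continuous_fst)
  have hmain : ∀ w, HasFDerivAt (fun w => ∫ t in a..b, K t w) (∫ t in a..b, F' w t) w := by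
    intro w
    have hcpt : IsCompact (closedBall w 1 ×ˢ Set.uIcc a b) := (isCompact_closedBall w 1).prod isCompact_uIcc
    obtain ⟨C, hC⟩ := hcpt.exists_bound_of_continuousOn (f := Function.uncurry F') hF'c.continuousOn
    have hcw : ∀ x, Continuous (fun t => K t x) := fun x => hKc.comp (continuous_const.prodMk continuous_id)
    refine hasFDerivAt_integral_of_dominated_of_fderiv_le'' (μ := volume) (s := closedBall w 1) (bound := fun _ => C) (closedBall_mem_nhds w one_pos) ?_ ?_ ?_ ?_ ?_ ?_
    · exact Eventually.of_forall fun x => (hcw x).aestronglyMeasurable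
    · exact (hcw w).intervalIntegrable _ _
    · exact (hF'c.comp (continuous_const.prodMk continuous_id)).aestronglyMeasurable
    · filter_upwards [ae_restrict_mem measurableSet_uIoc] with t ht x hx
      exact hC (x, t) ⟨hx, Set.uIoc_subset_uIcc ht⟩
    · exact intervalIntegrable_const
    · exact Eventually.of_forall fun t x _ => hder t x
  have hf : fderiv ℝ (fun w => ∫ t in a..b, K t w) = fun w => ∫ t in a..b, F' w t := by
    funext w; exact (hmain w).fderiv
  refine ⟨?_, ?_⟩
  · rw [contDiff_one_iff_fderiv]
    refine ⟨fun w => (hmain w).differentiableAt, ?_⟩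
    rw [hf]
    exact intervalIntegral.continuous_parametric_intervalIntegral_of_continuous' hF'c _ _
  · intro w v
    rw [hf]
    have h_integ : IntervalIntegrable (fun t => F' w t) volume a b := (hF'c.comp (continuous_const.prodMk continuous_id)).intervalIntegrable _ _
    show (∫ t in a..b, F' w t) v = _
    rw [ContinuousLinearMap.intervalIntegral_apply h_integ v]
    refine intervalIntegral.integral_congr fun t _ => ?_
    simp only [(hder t w).fderiv]

section
variable {n : ℕ} {D : Set (Fin n → ℂ)} {f : (Fin n → ℂ) → (Fin n → ℂ)}

lemma pull_continuous (hD : IsOpen D) (hf : IsProperHolomorphic f D D) {u h : (Fin n → ℂ) → ℂ} (hu : Continuous u)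
    (hc : HasCompactSupport u) (hs : tsupport u ⊆ D) (hh : ContinuousOn h D) : Continuous (pull D f u h) := by
  refine continuous_iff_continuousAt.2 fun z => ?_
  by_cases hz : z ∈ D
  · refine ContinuousAt.congr ?_ (pull_eq hD hz).symm
    exact (hu.continuousAt.comp (hf.1.continuousOn.continuousAt (hD.mem_nhds hz))).mul (hh.continuousAt (hD.mem_nhds hz))
  · have : z ∉ tsupport (pull D f u h) := fun h => hz (pull_supp hD hf hc hs h).1
    exact (continuousAt_const (y := (0:ℂ))).congr (notMem_tsupport_iff_eventuallyEq.1 this).symm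

lemma wirt_continuous {u : (Fin n → ℂ) → ℂ} (hu : ContDiff ℝ 1 u) (k : Fin n) : Continuous (fun w => wirt u w k) := by
  have : ∀ v, Continuous fun z => fderiv ℝ u z v := fun v => (hu.continuous_fderiv (by simp)).clm_apply continuous_const
  exact ((this _).sub (continuous_const.mul (this _))).div_const _

lemma wirt_tsupport {u : (Fin n → ℂ) → ℂ} (k : Fin n) : tsupport (fun w => wirt u w k) ⊆ tsupport u := by
  refine closure_minimal ?_ (isClosed_tsupport _)
  intro w hw
  by_contra hcon
  apply hw
  simp only [wirt_congr (notMem_tsupport_iff_eventuallyEq.1 hcon), wirt_zero_fun]; rfl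

lemma holo_conj_cont {h : (Fin n → ℂ) → ℂ} (hD : IsOpen D) (hf : DifferentiableOn ℂ f D) (hh : DifferentiableOn ℂ h D) :
    ContinuousOn (fun z => rdet (jac f z) * (starRingEnd ℂ) (h z)) D :=
  (rdet_contDiffOn hD hf).continuousOn.mul (Complex.continuous_conj.comp_continuousOn hh.continuousOn)

lemma div_single (hD : IsOpen D) (hf : IsProperHolomorphic f D D) {u h : (Fin n → ℂ) → ℂ} (hu : ContDiff ℝ 1 u)
    (hc : HasCompactSupport u) (hs : tsupport u ⊆ D) (hh : DifferentiableOn ℂ h D) (j : Fin n) :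
    Integrable (pull D f (fun w => wirt u w j) (fun z => rdet (jac f z) * (starRingEnd ℂ) (h z))) ∧
    ∫ z, pull D f (fun w => wirt u w j) (fun z => rdet (jac f z) * (starRingEnd ℂ) (h z)) z = 0 := by
  have hc' : HasCompactSupport (fun w => wirt u w j) := hc.of_isClosed_subset (isClosed_tsupport _) (wirt_tsupport j)
  have hs' := (wirt_tsupport (u := u) j).trans hs
  constructor
  · exact (pull_continuous hD hf (wirt_continuous hu j) hc' hs' (holo_conj_cont hD hf.1 hh)).integrable_of_hasCompactSupport (pull_compact hD hf hc' hs')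
  · have h1 : ContDiffOn ℝ 1 (fun _ : Fin n → ℂ => (1:ℂ)) D := contDiffOn_const
    have h_integ := piola_integral hD hf.1 (pull_contDiff hD hf hu hc hs h1) (pull_compact hD hf hc hs)
      ((pull_supp hD hf hc hs).trans Set.inter_subset_left) hh j
    rw [← h_integ]
    refine integral_congr_ae (Eventually.of_forall fun z => ?_)
    beta_reduce
    by_cases hz : z ∈ D
    · have hfz : DifferentiableAt ℂ f z := (hf.1 z hz).differentiableAt (hD.mem_nhds hz)
      have e1 : wirt (pull D f u fun _ => 1) z = ∑ l, wirt u (f z) l • jac f z l := by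
        rw [wirt_congr (pull_eq hD hz)]
        funext m
        simp only [mul_one]
        rw [wirt_comp (hu.differentiable (by simp) _) hfz]
        simp [Finset.sum_apply]
      have e2 : rdet (Function.update (jac f z) j (wirt (pull D f u fun _ => 1) z)) = wirt u (f z) j * rdet (jac f z) := by
        rw [e1, rdet_eq, AlternatingMap.map_update_sum, Finset.sum_eq_single j]
        · rw [AlternatingMap.map_update_smul, Function.update_eq_self]; rfl
        · intro l _ hl
          rw [AlternatingMap.map_update_smul, AlternatingMap.map_update_self _ _ hl.symm, smul_zero]
        · simp
      rw [e2]; simp only [pull, hz, if_true]; ring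
    · rw [pull_wirt_out hD hf hc hs hz, rdet_eq, AlternatingMap.map_update_zero, zero_mul]
      simp [pull, hz]

/-- Euler operator (holomorphic part) -/
noncomputable def eul (G : (Fin n → ℂ) → ℂ) (w : Fin n → ℂ) : ℂ := ∑ j : Fin n, ((j.1 + 1 : ℕ) : ℂ) * w j * wirt G w j

noncomputable def wsum (n : ℕ) : ℕ := ∑ j : Fin n, (j.1 + 1)

lemma euler_identity (hD : IsOpen D) (hf : IsProperHolomorphic f D D) {G h m : (Fin n → ℂ) → ℂ} (hG : ContDiff ℝ 1 G)
    (hc : HasCompactSupport G) (hs : tsupport G ⊆ D) (hh : DifferentiableOn ℂ h D) (hm : Differentiable ℂ m) (d : ℕ)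
    (hmd : ∀ w, ∑ j : Fin n, ((j.1 + 1 : ℕ) : ℂ) * w j * fderiv ℂ m w (Pi.single j 1) = d * m w) :
    ∫ z, pull D f (fun w => m w * (((wsum n + d : ℕ) : ℂ) * G w + eul G w)) (fun z => rdet (jac f z) * (starRingEnd ℂ) (h z)) z = 0 := by
  let u : Fin n → (Fin n → ℂ) → ℂ := fun j w => (((j.1 + 1 : ℕ) : ℂ) * w j * m w) * G w
  have hmr : ContDiff ℝ 1 m := by
    have : ContDiffOn ℂ 1 m Set.univ := holo_contDiffOn isOpen_univ 1 hm.differentiableOn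
    exact (contDiffOn_univ.1 this).restrict_scalars ℝ
  have hu : ∀ j, ContDiff ℝ 1 (u j) := fun j => by
    refine ContDiff.mul (ContDiff.mul ?_ hmr) hG
    fun_prop
  have huc : ∀ j, HasCompactSupport (u j) := fun j => hc.mul_left
  have hus : ∀ j, tsupport (u j) ⊆ D := fun j => (tsupport_mul_subset_right).trans hs
  have key := fun j => div_single hD hf (hu j) (huc j) (hus j) hh j
  have : ∀ z, pull D f (fun w => m w * (((wsum n + d : ℕ) : ℂ) * G w + eul G w)) (fun z => rdet (jac f z) * (starRingEnd ℂ) (h z)) z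
      = ∑ j, pull D f (fun w => wirt (u j) w j) (fun z => rdet (jac f z) * (starRingEnd ℂ) (h z)) z := by
    intro z
    by_cases hz : z ∈ D
    · simp only [pull, hz, if_true]
      rw [← Finset.sum_mul]
      congr 1
      set w := f z
      have e : ∀ j, wirt (u j) w j = ((j.1 + 1 : ℕ) : ℂ) * (m w * G w) + (((j.1 + 1 : ℕ) : ℂ) * w j * fderiv ℂ m w (Pi.single j 1)) * G w
          + m w * (((j.1 + 1 : ℕ) : ℂ) * w j * wirt G w j) := by
        intro j
        have hd1 : DifferentiableAt ℂ (fun w : Fin n → ℂ => ((j.1 + 1 : ℕ) : ℂ) * w j) w := by fun_prop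
        have hd2 : DifferentiableAt ℂ (fun w : Fin n → ℂ => ((j.1 + 1 : ℕ) : ℂ) * w j * m w) w := hd1.fun_mul (hm w)
        rw [wirt_mul (u := fun w : Fin n → ℂ => ((j.1 + 1 : ℕ) : ℂ) * w j * m w) (hd2.restrictScalars ℝ) (hG.differentiable (by simp) w), wirt_holo hd2,
          fderiv_fun_mul hd1 (hm w)]
        have : fderiv ℂ (fun w : Fin n → ℂ => ((j.1 + 1 : ℕ) : ℂ) * w j) w = ((j.1 + 1 : ℕ) : ℂ) • ContinuousLinearMap.proj j := by
          exact ((ContinuousLinearMap.proj (R := ℂ) (φ := fun _ : Fin n => ℂ) j).hasFDerivAt.const_mul _).fderiv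
        rw [this]
        simp only [add_apply, smul_apply, smul_eq_mul, ContinuousLinearMap.proj_apply, Pi.single_eq_same]
        ring
      simp_rw [e]
      rw [Finset.sum_add_distrib, Finset.sum_add_distrib, ← Finset.sum_mul, ← Finset.sum_mul, ← Finset.mul_sum, hmd w]
      simp only [wsum, eul]
      push_cast
      ring
    · simp [pull, hz]
  simp_rw [this]
  rw [integral_finsetSum _ fun j _ => (key j).1]
  exact Finset.sum_eq_zero fun j _ => (key j).2

end
end

section
open MeasureTheory Metric Filter Topology
open Finset
open scoped ContDiff

section
variable {n : ℕ}

noncomputable def uexp (θ : ℝ) : ℂ := Complex.exp (θ * Complex.I)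

lemma norm_uexp (θ : ℝ) : ‖uexp θ‖ = 1 := Complex.norm_exp_ofReal_mul_I θ

lemma uexp_add (a b : ℝ) : uexp (a + b) = uexp a * uexp b := by
  unfold uexp; rw [← Complex.exp_add]; push_cast; ring_nf

lemma uexp_zero : uexp 0 = 1 := by simp [uexp]

lemma uexp_periodic : Function.Periodic uexp (2 * Real.pi) := by
  intro θ; rw [uexp_add]
  have : uexp (2 * Real.pi) = 1 := by
    unfold uexp; push_cast; exact Complex.exp_two_pi_mul_I
  rw [this, mul_one]

lemma contDiff_uexp : ContDiff ℝ 1 uexp := by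
  unfold uexp
  exact ((Complex.ofRealCLM.contDiff.mul contDiff_const)).cexp

lemma contDiff_dil : ContDiff ℝ 1 (fun q : ℂ × (Fin n → ℂ) => dil q.1 q.2) := by
  unfold dil
  refine contDiff_pi.2 fun k => ?_
  exact (contDiff_fst.pow _).mul ((contDiff_apply ℝ ℂ k).comp contDiff_snd)

/-- rotation average -/
noncomputable def avg (Ψ : (Fin n → ℂ) → ℂ) (w : Fin n → ℂ) : ℂ :=
  ((2 * Real.pi : ℝ) : ℂ)⁻¹ * ∫ θ in (0:ℝ)..(2 * Real.pi), Ψ (dil (uexp θ) w)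

lemma avg_C1 {Ψ : (Fin n → ℂ) → ℂ} (hΨ : ContDiff ℝ 1 Ψ) : ContDiff ℝ 1 (avg Ψ) := by
  refine contDiff_const.mul (param_C1 (K := fun θ w => Ψ (dil (uexp θ) w)) ?_).1
  exact hΨ.comp (contDiff_dil.comp ((contDiff_uexp.comp contDiff_fst).prodMk contDiff_snd))

lemma avg_rot (Ψ : (Fin n → ℂ) → ℂ) (φ : ℝ) (w : Fin n → ℂ) : avg Ψ (dil (uexp φ) w) = avg Ψ w := by
  unfold avg
  congr 1
  simp_rw [dil_dil, ← uexp_add]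
  rw [intervalIntegral.integral_comp_add_right (fun θ => Ψ (dil (uexp θ) w))]
  have hper : Function.Periodic (fun θ => Ψ (dil (uexp θ) w)) (2 * Real.pi) := by
    intro θ; simp only [uexp_periodic θ]
  have := hper.intervalIntegral_add_eq φ 0
  simp only [zero_add] at this ⊢
  rw [← this, add_comm]

lemma avg_const {Ψ : (Fin n → ℂ) → ℂ} {w : Fin n → ℂ} {c : ℂ} (h : ∀ θ, Ψ (dil (uexp θ) w) = c) : avg Ψ w = c := by
  unfold avg
  simp_rw [h]
  rw [intervalIntegral.integral_const]
  have : ((2 * Real.pi : ℝ) : ℂ) ≠ 0 := by exact_mod_cast Real.two_pi_pos.ne'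
  rw [sub_zero, Complex.real_smul]
  field_simp

lemma avg_real {Ψ : (Fin n → ℂ) → ℝ} (hΨ : Continuous Ψ) (h0 : ∀ w, Ψ w ∈ Set.Icc (0:ℝ) 1) (w : Fin n → ℂ) :
    ∃ r : ℝ, r ∈ Set.Icc (0:ℝ) 1 ∧ avg (fun w => (Ψ w : ℂ)) w = r := by
  have hpi := Real.two_pi_pos
  refine ⟨(2 * Real.pi)⁻¹ * ∫ θ in (0:ℝ)..(2 * Real.pi), Ψ (dil (uexp θ) w), ⟨?_, ?_⟩, ?_⟩
  · exact mul_nonneg (by positivity) (intervalIntegral.integral_nonneg hpi.le fun θ _ => (h0 _).1)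
  · have hc : Continuous fun θ : ℝ => Ψ (dil (uexp θ) w) :=
      hΨ.comp (continuous_dil.comp (contDiff_uexp.continuous.prodMk continuous_const))
    have : ∫ θ in (0:ℝ)..(2 * Real.pi), Ψ (dil (uexp θ) w) ≤ ∫ θ in (0:ℝ)..(2 * Real.pi), 1 :=
      intervalIntegral.integral_mono_on hpi.le (hc.intervalIntegrable _ _) intervalIntegrable_const fun θ _ => (h0 _).2
    rw [intervalIntegral.integral_const, sub_zero, smul_eq_mul, mul_one] at this
    rw [inv_mul_le_iff₀ hpi]; linarith
  · unfold avg
    rw [intervalIntegral.integral_ofReal]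
    push_cast; ring

/-- weighted Euler vector field -/
noncomputable def eulX (w : Fin n → ℂ) : Fin n → ℂ := fun j => ((j.1 + 1 : ℕ) : ℂ) * w j

lemma eul_eq (G : (Fin n → ℂ) → ℂ) (w : Fin n → ℂ) :
    eul G w = (fderiv ℝ G w (eulX w) - Complex.I * fderiv ℝ G w (Complex.I • eulX w)) / 2 := by
  rw [real_clm_wirt, Finset.sum_div]
  unfold eul wirt eulX
  refine Finset.sum_congr rfl fun j _ => ?_
  ring

lemma eul_rot {G : (Fin n → ℂ) → ℂ} (hG : ContDiff ℝ 1 G) (hrot : ∀ φ w, G (dil (uexp φ) w) = G w) (w : Fin n → ℂ) :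
    eul G w = fderiv ℝ G w (eulX w) / 2 := by
  have hu : HasDerivAt uexp Complex.I 0 := by
    have h1 : HasDerivAt (fun θ : ℝ => (θ : ℂ) * Complex.I) Complex.I 0 := by
      simpa using (Complex.ofRealCLM.hasDerivAt (x := (0:ℝ))).mul_const Complex.I
    have h2 := h1.cexp
    simp only [Complex.ofReal_zero, zero_mul, Complex.exp_zero, one_mul] at h2
    exact h2
  have h2 : HasDerivAt (fun φ : ℝ => dil (uexp φ) w) (Complex.I • eulX w) 0 := by
    refine hasDerivAt_pi.2 fun k => ?_
    have := (hu.fun_pow (k.1 + 1)).mul_const (w k)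
    refine HasDerivAt.congr_deriv this ?_
    simp [eulX, uexp_zero]; ring
  have h3 : HasFDerivAt G (fderiv ℝ G w) (dil (uexp 0) w) := by
    rw [uexp_zero, dil_one]; exact (hG.differentiable (by simp) w).hasFDerivAt
  have h4 : HasDerivAt (fun φ : ℝ => G (dil (uexp φ) w)) (fderiv ℝ G w (Complex.I • eulX w)) 0 := h3.comp_hasDerivAt 0 h2
  simp_rw [hrot] at h4
  have h5 := h4.unique (hasDerivAt_const (0:ℝ) (G w))
  rw [eul_eq, h5]; simp

noncomputable def bfun (M : ℕ) (P : (Fin n → ℂ) → ℂ) (w : Fin n → ℂ) : ℂ :=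
  2 * ∫ s in (1:ℝ)..2, (s:ℂ) ^ (2 * M - 1) * P (dil (s:ℂ) w)

lemma bfun_aux (M : ℕ) {P : (Fin n → ℂ) → ℂ} (hP : ContDiff ℝ 1 P) :
    ContDiff ℝ 1 (fun q : ℝ × (Fin n → ℂ) => ((q.1 : ℝ) : ℂ) ^ (2 * M - 1) * P (dil (q.1:ℂ) q.2)) := by
  have h1 : ContDiff ℝ 1 (fun q : ℝ × (Fin n → ℂ) => ((q.1 : ℝ) : ℂ)) := Complex.ofRealCLM.contDiff.comp contDiff_fst
  exact (h1.pow _).mul (hP.comp (contDiff_dil.comp (h1.prodMk contDiff_snd)))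

lemma bfun_C1 (M : ℕ) {P : (Fin n → ℂ) → ℂ} (hP : ContDiff ℝ 1 P) : ContDiff ℝ 1 (bfun M P) :=
  contDiff_const.mul (param_C1 (K := fun s w => (s:ℂ) ^ (2 * M - 1) * P (dil (s:ℂ) w)) (bfun_aux M hP)).1

lemma bfun_eul {M : ℕ} (hM : 1 ≤ M) {P : (Fin n → ℂ) → ℂ} (hP : ContDiff ℝ 1 P) (hrot : ∀ φ w, P (dil (uexp φ) w) = P w)
    (w : Fin n → ℂ) : (M : ℂ) * bfun M P w + eul (bfun M P) w = 2 ^ (2 * M) * P (dil 2 w) - P w := by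
  have hbrot : ∀ φ w, bfun M P (dil (uexp φ) w) = bfun M P w := by
    intro φ w
    unfold bfun
    simp_rw [dil_dil, mul_comm _ (uexp φ), ← dil_dil, hrot]
  rw [eul_rot (bfun_C1 M hP) hbrot]
  obtain ⟨h1, h2⟩ := param_C1 (a := 1) (b := 2) (K := fun s w => (s:ℂ) ^ (2 * M - 1) * P (dil (s:ℂ) w)) (bfun_aux M hP)
  have h3 : fderiv ℝ (bfun M P) w (eulX w) = 2 * ∫ s in (1:ℝ)..2, fderiv ℝ (fun w => (s:ℂ) ^ (2 * M - 1) * P (dil (s:ℂ) w)) w (eulX w) := by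
    unfold bfun
    rw [fderiv_const_mul (h1.differentiable (by simp) w), smul_apply, h2]; rfl
  have h4 : ∀ s : ℝ, fderiv ℝ (fun w => (s:ℂ) ^ (2 * M - 1) * P (dil (s:ℂ) w)) w (eulX w)
      = (s:ℂ) ^ (2 * M - 1) * fderiv ℝ P (dil (s:ℂ) w) (eulX (dil (s:ℂ) w)) := by
    intro s
    have hd : HasFDerivAt (fun w : Fin n → ℂ => dil (s:ℂ) w) (ContinuousLinearMap.pi fun k : Fin n => ((s:ℂ) ^ (k.1+1)) • (ContinuousLinearMap.proj (R := ℝ) (φ := fun _ : Fin n => ℂ) k)) w := by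
      refine hasFDerivAt_pi.2 fun k => ?_
      exact (ContinuousLinearMap.proj (R := ℝ) (φ := fun _ : Fin n => ℂ) k).hasFDerivAt.const_mul _
    have h5 := ((hP.differentiable (by simp) (dil (s:ℂ) w)).hasFDerivAt.comp w hd).const_mul ((s:ℂ) ^ (2 * M - 1))
    have h6 : HasFDerivAt (fun w => (s:ℂ) ^ (2 * M - 1) * P (dil (s:ℂ) w)) _ w := h5
    rw [h6.fderiv]
    simp only [smul_apply, ContinuousLinearMap.comp_apply, smul_eq_mul]
    congr 2
    funext k
    simp [eulX, dil]; ring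
  have hder : ∀ s : ℝ, HasDerivAt (fun s : ℝ => (s:ℂ) ^ (2 * M) * P (dil (s:ℂ) w))
      ((2 * M : ℂ) * ((s:ℂ) ^ (2 * M - 1) * P (dil (s:ℂ) w)) + (s:ℂ) ^ (2 * M - 1) * fderiv ℝ P (dil (s:ℂ) w) (eulX (dil (s:ℂ) w))) s := by
    intro s
    have hs : HasDerivAt (fun s : ℝ => (s:ℂ)) 1 s := Complex.ofRealCLM.hasDerivAt
    have hd : HasDerivAt (fun s : ℝ => dil (s:ℂ) w) (fun k : Fin n => ((k.1 + 1 : ℕ) : ℂ) * (s:ℂ) ^ k.1 * w k) s := by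
      refine hasDerivAt_pi.2 fun k => ?_
      have := (hs.fun_pow (k.1 + 1)).mul_const (w k)
      refine HasDerivAt.congr_deriv this ?_
      simp
    have hc := (hP.differentiable (by simp) (dil (s:ℂ) w)).hasFDerivAt.comp_hasDerivAt s hd
    have hm := (hs.fun_pow (2 * M)).mul hc
    have e : fderiv ℝ P (dil (s:ℂ) w) (eulX (dil (s:ℂ) w)) = (s:ℂ) * fderiv ℝ P (dil (s:ℂ) w) (fun k : Fin n => ((k.1 + 1 : ℕ) : ℂ) * (s:ℂ) ^ k.1 * w k) := by
      have : eulX (dil (s:ℂ) w) = s • (fun k : Fin n => ((k.1 + 1 : ℕ) : ℂ) * (s:ℂ) ^ k.1 * w k) := by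
        funext k; simp [eulX, dil]; ring
      rw [this, map_smul, Complex.real_smul]
    rw [e]
    refine HasDerivAt.congr_deriv hm ?_
    have hp : (s:ℂ) ^ (2 * M) = (s:ℂ) ^ (2 * M - 1) * s := by
      rw [← pow_succ]; congr 1; omega
    simp only [hp, Function.comp_apply]
    push_cast
    ring
  have hc1 : Continuous fun s : ℝ => (s:ℂ) ^ (2 * M - 1) * P (dil (s:ℂ) w) :=
    (bfun_aux M hP).continuous.comp (continuous_id.prodMk continuous_const)
  have hc2 : Continuous fun s : ℝ => (s:ℂ) ^ (2 * M - 1) * fderiv ℝ P (dil (s:ℂ) w) (eulX (dil (s:ℂ) w)) := by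
    have hds : Continuous fun s : ℝ => dil (s:ℂ) w := continuous_dil.comp (Complex.continuous_ofReal.prodMk continuous_const)
    refine (Complex.continuous_ofReal.pow _).mul ?_
    refine ((hP.continuous_fderiv (by simp)).comp hds).clm_apply ?_
    unfold eulX; fun_prop
  have hF := intervalIntegral.integral_eq_sub_of_hasDerivAt (a := 1) (b := 2) (fun s _ => hder s)
    (((hc1.const_mul _).add hc2).intervalIntegrable _ _)
  rw [intervalIntegral.integral_add ((hc1.const_mul _).intervalIntegrable _ _) (hc2.intervalIntegrable _ _), intervalIntegral.integral_const_mul] at hF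
  simp_rw [h4] at h3
  rw [h3]
  simp only [Complex.ofReal_one, one_pow, one_mul, dil_one, Complex.ofReal_ofNat] at hF
  rw [← hF]
  unfold bfun
  ring

end
end

section
open MeasureTheory Metric Filter Topology
open Finset
open scoped ContDiff

section
variable {n : ℕ} {p : ℝ}

/-- the properties of an averaged cutoff -/
structure IsCut (p : ℝ) (c : ℝ) (P : (Fin n → ℂ) → ℝ) : Prop where
  smooth : ContDiff ℝ 1 (fun w => (P w : ℂ))
  mem : ∀ w, P w ∈ Set.Icc (0:ℝ) 1
  one : ∀ w, gR p w ≤ c → P w = 1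
  zero : ∀ w, (1 + c) / 2 ≤ gR p w → P w = 0
  rot : ∀ φ w, P (dil (uexp φ) w) = P w

lemma gR_uexp (hp : 0 < p) (θ : ℝ) (w : Fin n → ℂ) : gR p (dil (uexp θ) w) = gR p w := by
  rw [gR_dil hp, norm_uexp, Real.one_rpow, one_mul]

lemma exists_cut (hp : 0 < p) {c : ℝ} (hc : c < 1) : ∃ P : (Fin n → ℂ) → ℝ, IsCut p c P := by
  have hcl1 : IsClosed {w : Fin n → ℂ | (1 + c) / 2 ≤ gR p w} := isClosed_le continuous_const (gR_continuous hp)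
  have hcl2 : IsClosed {w : Fin n → ℂ | gR p w ≤ c} := isClosed_le (gR_continuous hp) continuous_const
  have hdis : Disjoint {w : Fin n → ℂ | (1 + c) / 2 ≤ gR p w} {w : Fin n → ℂ | gR p w ≤ c} := by
    rw [Set.disjoint_left]
    intro w h1 h2
    simp only [Set.mem_ofPred_eq] at h1 h2
    linarith
  obtain ⟨ψ, h0, h1, h2⟩ := exists_contMDiffMap_zero_one_of_isClosed (n := 1) (modelWithCornersSelf ℝ (Fin n → ℂ)) hcl1 hcl2 hdis
  have hψ : ContDiff ℝ 1 (fun w => ψ w) := ψ.contMDiff.contDiff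
  have hψc : ContDiff ℝ 1 (fun w => (ψ w : ℂ)) := Complex.ofRealCLM.contDiff.comp hψ
  choose P hP using avg_real hψ.continuous h2
  have hfun : (fun w => (P w : ℂ)) = avg (fun w => (ψ w : ℂ)) := by funext w; exact (hP w).2.symm
  refine ⟨P, ?_, fun w => (hP w).1, fun w hw => ?_, fun w hw => ?_, fun φ w => ?_⟩
  · rw [hfun]; exact avg_C1 hψc
  · have := (hP w).2
    rw [avg_const (c := 1)] at this
    · exact_mod_cast this.symm
    · intro θ
      have : ψ (dil (uexp θ) w) = 1 := h1 (by simpa [gR_uexp hp] using hw)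
      rw [this]; simp
  · have := (hP w).2
    rw [avg_const (c := 0)] at this
    · exact_mod_cast this.symm
    · intro θ
      have : ψ (dil (uexp θ) w) = 0 := h0 (by simpa [gR_uexp hp] using hw)
      rw [this]; simp
  · have h3 := avg_rot (fun w => (ψ w : ℂ)) φ w
    rw [(hP w).2, (hP _).2] at h3
    exact_mod_cast h3

lemma supp_of_zero (hp : 0 < p) {u : (Fin n → ℂ) → ℂ} {c : ℝ} (hc : c < 1) (h : ∀ w, c ≤ gR p w → u w = 0) :
    HasCompactSupport u ∧ tsupport u ⊆ {w | gR p w < 1} := by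
  have h1 : tsupport u ⊆ {w | gR p w ≤ c} := by
    refine closure_minimal ?_ (gR_compact hp c).isClosed
    intro w hw
    by_contra h2
    simp only [Set.mem_ofPred_eq, not_le] at h2
    exact hw (h w h2.le)
  exact ⟨(gR_compact hp c).of_isClosed_subset (isClosed_tsupport _) h1, h1.trans fun w hw => lt_of_le_of_lt hw hc⟩

variable {D : Set (Fin n → ℂ)} {f : (Fin n → ℂ) → (Fin n → ℂ)}

lemma gR_dil_ge (hp : 0 < p) {s : ℝ} (hs : 1 ≤ s) (w : Fin n → ℂ) : gR p w ≤ gR p (dil (s:ℂ) w) := by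
  rw [gR_dil hp]
  refine le_mul_of_one_le_left (gR_nonneg hp w) ?_
  refine Real.one_le_rpow ?_ (by linarith)
  rw [Complex.norm_real, Real.norm_eq_abs, abs_of_nonneg (by linarith)]; exact hs

lemma wsum_pos (hn : 1 ≤ n) : 1 ≤ wsum n := by
  unfold wsum
  calc 1 ≤ ((⟨0, hn⟩ : Fin n).1 + 1) := by simp
    _ ≤ _ := Finset.single_le_sum (f := fun j : Fin n => j.1 + 1) (fun _ _ => Nat.zero_le _) (Finset.mem_univ _)

lemma J_cont (hD : IsOpen D) (hf : IsProperHolomorphic f D D) {h : (Fin n → ℂ) → ℂ} (hh : ContinuousOn h D) :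
    ContinuousOn (fun z => rdet (jac f z) * (starRingEnd ℂ) (h z)) D :=
  (rdet_contDiffOn hD hf.1).continuousOn.mul (Complex.continuous_conj.comp_continuousOn hh)

lemma key_identity (hp : 0 < p) (hn : 1 ≤ n) (hDe : D = {w | gR p w < 1}) (hf : IsProperHolomorphic f D D) {c : ℝ} (hc : c < 1)
    {P : (Fin n → ℂ) → ℝ} (hP : IsCut p c P) {h m : (Fin n → ℂ) → ℂ} (hh : DifferentiableOn ℂ h D)
    (hm : Differentiable ℂ m) (d : ℕ)
    (hmd : ∀ w, ∑ j : Fin n, ((j.1 + 1 : ℕ) : ℂ) * w j * fderiv ℂ m w (Pi.single j 1) = d * m w) :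
    ∫ z, pull D f (fun w => m w * P w) (fun z => rdet (jac f z) * (starRingEnd ℂ) (h z)) z
     = 2 ^ (2 * (wsum n + d)) * ∫ z, pull D f (fun w => m w * P (dil 2 w)) (fun z => rdet (jac f z) * (starRingEnd ℂ) (h z)) z := by
  have hD : IsOpen D := by rw [hDe]; exact gR_open hp 1
  set M := wsum n + d with hM
  have hM1 : 1 ≤ M := by have := wsum_pos hn; omega
  have hc' : (1 + c) / 2 < 1 := by linarith
  have hz2 : ∀ s : ℝ, 1 ≤ s → ∀ w, (1 + c) / 2 ≤ gR p w → P (dil (s:ℂ) w) = 0 := fun s hs w hw =>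
    hP.zero _ (hw.trans (gR_dil_ge hp hs w))
  have hrotC : ∀ φ w, ((P (dil (uexp φ) w) : ℝ) : ℂ) = P w := fun φ w => by rw [hP.rot]
  let G := bfun M (fun w => (P w : ℂ))
  have hG0 : ∀ w, (1 + c) / 2 ≤ gR p w → G w = 0 := by
    intro w hw
    simp only [G, bfun]
    rw [intervalIntegral.integral_congr (g := fun _ => 0)]
    · simp
    · intro s hs
      rw [Set.uIcc_of_le (by norm_num)] at hs
      simp [hz2 s hs.1 w hw]
  obtain ⟨hGc, hGs⟩ := supp_of_zero hp hc' hG0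
  rw [← hDe] at hGs
  have hid := euler_identity hD hf (bfun_C1 M hP.smooth) hGc hGs hh hm d hmd
  simp_rw [← hM, bfun_eul hM1 hP.smooth hrotC] at hid
  have hPc : Continuous P := by
    have := Complex.continuous_re.comp hP.smooth.continuous
    exact this
  have i1 : Integrable (pull D f (fun w => m w * P w) (fun z => rdet (jac f z) * (starRingEnd ℂ) (h z))) := by
    obtain ⟨a, b⟩ := supp_of_zero (u := fun w => m w * P w) hp hc' (fun w hw => by simp [hP.zero w hw])
    rw [← hDe] at b
    exact (pull_continuous hD hf (by have := hm.continuous; fun_prop) a b (J_cont hD hf hh.continuousOn)).integrable_of_hasCompactSupport (pull_compact hD hf a b)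
  have i2 : Integrable (pull D f (fun w => m w * P (dil 2 w)) (fun z => rdet (jac f z) * (starRingEnd ℂ) (h z))) := by
    obtain ⟨a, b⟩ := supp_of_zero (u := fun w => m w * P (dil 2 w)) hp hc' (fun w hw => by
      have := hz2 2 (by norm_num) w hw
      push_cast at this
      simp [this])
    rw [← hDe] at b
    have hd2 : Continuous fun w : Fin n → ℂ => dil 2 w := (diff_dil 2).continuous
    exact (pull_continuous hD hf (by have := hm.continuous; fun_prop) a b (J_cont hD hf hh.continuousOn)).integrable_of_hasCompactSupport (pull_compact hD hf a b)
  have e : ∀ z, pull D f (fun w => m w * (2 ^ (2 * M) * (P (dil 2 w) : ℂ) - P w)) (fun z => rdet (jac f z) * (starRingEnd ℂ) (h z)) z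
     = 2 ^ (2 * M) * pull D f (fun w => m w * P (dil 2 w)) (fun z => rdet (jac f z) * (starRingEnd ℂ) (h z)) z
       - pull D f (fun w => m w * P w) (fun z => rdet (jac f z) * (starRingEnd ℂ) (h z)) z := by
    intro z; unfold pull; split_ifs
    · ring
    · simp
  simp_rw [e] at hid
  rw [integral_sub (i2.const_mul _) i1, integral_const_mul] at hid
  exact (sub_eq_zero.1 hid).symm

/-- the inner compact set -/
def K0 (p : ℝ) (D : Set (Fin n → ℂ)) (f : (Fin n → ℂ) → (Fin n → ℂ)) : Set (Fin n → ℂ) := D ∩ f ⁻¹' {w | gR p w ≤ (2:ℝ) ^ (-(2 * p))}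

lemma two_rpow_lt (hp : 0 < p) : (2:ℝ) ^ (-(2 * p)) < 1 := Real.rpow_lt_one_of_one_lt_of_neg (by norm_num) (by linarith)

lemma K0_compact (hp : 0 < p) (hDe : D = {w | gR p w < 1}) (hf : IsProperHolomorphic f D D) : IsCompact (K0 p D f) := by
  refine hf.2.2 _ ?_ (gR_compact hp _)
  rw [hDe]; intro w hw; exact lt_of_le_of_lt hw (two_rpow_lt hp)

lemma key_cut (hp : 0 < p) (hn : 1 ≤ n) (hDe : D = {w | gR p w < 1}) (hf : IsProperHolomorphic f D D) {m : (Fin n → ℂ) → ℂ}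
    (hm : Differentiable ℂ m) (d : ℕ)
    (hmd : ∀ w, ∑ j : Fin n, ((j.1 + 1 : ℕ) : ℂ) * w j * fderiv ℂ m w (Pi.single j 1) = d * m w) :
    ∃ C : ℝ, 0 ≤ C ∧ ∀ h, DifferentiableOn ℂ h D → ∀ B : ℝ, 0 ≤ B → (∀ z ∈ K0 p D f, ‖h z‖ ≤ B) → ∀ c < 1, ∀ P, IsCut p c P →
      ‖∫ z, pull D f (fun w => m w * P w) (fun z => rdet (jac f z) * (starRingEnd ℂ) (h z)) z‖ ≤ C * B := by
  have hD : IsOpen D := by rw [hDe]; exact gR_open hp 1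
  have hK := K0_compact hp hDe hf
  have hKD : K0 p D f ⊆ D := Set.inter_subset_left
  have hcont : ContinuousOn (fun z => ‖m (f z) * rdet (jac f z)‖) D :=
    ((hm.continuous.comp_continuousOn hf.1.continuousOn).mul (rdet_contDiffOn hD hf.1).continuousOn).norm
  have h_integ : IntegrableOn (fun z => ‖m (f z) * rdet (jac f z)‖) (K0 p D f) := (hcont.mono hKD).integrableOn_compact hK
  refine ⟨2 ^ (2 * (wsum n + d)) * ∫ z in K0 p D f, ‖m (f z) * rdet (jac f z)‖, ?_, ?_⟩
  · exact mul_nonneg (by positivity) (integral_nonneg fun _ => norm_nonneg _)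
  intro h hh B hB hhB c hc P hP
  rw [key_identity hp hn hDe hf hc hP hh hm d hmd, norm_mul, mul_assoc]
  have e2 : ‖(2:ℂ) ^ (2 * (wsum n + d))‖ = 2 ^ (2 * (wsum n + d)) := by simp
  rw [e2]
  refine mul_le_mul_of_nonneg_left ?_ (by positivity)
  rw [← integral_mul_const, ← integral_indicator hK.measurableSet]
  refine norm_integral_le_of_norm_le (IntegrableOn.integrable_indicator (Integrable.mul_const h_integ B) hK.measurableSet) (Eventually.of_forall fun z => ?_)
  by_cases hz : z ∈ K0 p D f
  · rw [Set.indicator_of_mem hz]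
    simp only [pull, hKD hz, if_true]
    have h1 : ‖((P (dil 2 (f z)) : ℝ) : ℂ)‖ ≤ 1 := by
      rw [Complex.norm_real, Real.norm_eq_abs, abs_of_nonneg (hP.mem _).1]; exact (hP.mem _).2
    rw [norm_mul, norm_mul, norm_mul, norm_mul, RCLike.norm_conj]
    calc ‖m (f z)‖ * ‖((P (dil 2 (f z)) : ℝ) : ℂ)‖ * (‖rdet (jac f z)‖ * ‖h z‖)
        ≤ ‖m (f z)‖ * 1 * (‖rdet (jac f z)‖ * B) := by gcongr; exact hhB z hz
      _ = _ := by ring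
  · rw [Set.indicator_of_notMem hz]
    simp only [pull]
    split_ifs with hzD
    · have : P (dil 2 (f z)) = 0 := by
        apply hP.zero
        have h3 : ¬ gR p (f z) ≤ (2:ℝ) ^ (-(2 * p)) := fun h3 => hz ⟨hzD, h3⟩
        rw [gR_dil hp, Complex.norm_ofNat]
        push Not at h3
        have h4 : (0:ℝ) < 2 ^ (2 * p) := by positivity
        have : 1 ≤ (2:ℝ) ^ (2 * p) * gR p (f z) := by
          rw [Real.rpow_neg (by norm_num)] at h3
          have := mul_lt_mul_of_pos_left h3 h4
          rw [mul_inv_cancel₀ h4.ne'] at this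
          exact this.le
        linarith
      simp [this]
    · simp

noncomputable def cseq (i : ℕ) : ℝ := 1 - 1 / (i + 2 : ℝ)
lemma cseq_lt (i : ℕ) : cseq i < 1 := by unfold cseq; have : (0:ℝ) < 1 / (i + 2 : ℝ) := by positivity
                                         linarith
lemma cseq_ev {x : ℝ} (hx : x < 1) : ∀ᶠ i in atTop, x ≤ cseq i := by
  have : Tendsto cseq atTop (𝓝 (1 - 0)) := by
    refine tendsto_const_nhds.sub ?_
    have h := tendsto_one_div_add_atTop_nhds_zero_nat (𝕜 := ℝ)
    have h2 := h.comp (tendsto_add_atTop_nat 1)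
    refine h2.congr fun i => ?_
    simp only [Function.comp_apply]; push_cast; ring_nf
  rw [sub_zero] at this
  filter_upwards [this.eventually (lt_mem_nhds hx)] with i hi using hi.le

lemma J_integrable (hp : 0 < p) (hn : 1 ≤ n) (hDe : D = {w | gR p w < 1}) (hf : IsProperHolomorphic f D D) :
    IntegrableOn (fun z => rdet (jac f z)) D := by
  classical
  have hD : IsOpen D := by rw [hDe]; exact gR_open hp 1
  have hJ := rdet_contDiffOn hD hf.1
  have hK := K0_compact hp hDe hf
  have hKD : K0 p D f ⊆ D := Set.inter_subset_left
  obtain ⟨C, hC, hCb⟩ := key_cut hp hn hDe hf (m := fun _ => 1) (differentiable_const _) 0 (by intro w; simp)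
  obtain ⟨B, hB⟩ := hK.exists_bound_of_continuousOn (hJ.continuousOn.mono hKD)
  have hfin : volume D < ⊤ := by
    refine lt_of_le_of_lt (measure_mono ?_) (gR_compact (n := n) hp 1).measure_lt_top
    rw [hDe]; intro w hw; exact le_of_lt (show gR p w < 1 from hw)
  have hsub : ∀ i, {w : Fin n → ℂ | gR p w ≤ cseq i} ⊆ D := by
    intro i; rw [hDe]; exact fun w hw => lt_of_le_of_lt hw (cseq_lt i)
  have hKi : ∀ i, IsCompact (D ∩ f ⁻¹' {w | gR p w ≤ cseq i}) := fun i => hf.2.2 _ (hsub i) (gR_compact hp _)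
  have hcov : AECover (volume.restrict D) atTop (fun i => D ∩ f ⁻¹' {w | gR p w ≤ cseq i}) := by
    refine ⟨?_, fun i => (hKi i).measurableSet⟩
    filter_upwards [ae_restrict_mem hD.measurableSet] with z hz
    have h1 : gR p (f z) < 1 := by have := hf.2.1 hz; rw [hDe] at this; exact this
    filter_upwards [cseq_ev h1] with i hi
    exact ⟨hz, hi⟩
  have hsq : Integrable (fun z => ‖rdet (jac f z)‖ ^ 2) (volume.restrict D) := by
    refine hcov.integrable_of_integral_norm_bounded (C * max B 0) (fun i => ?_) (Eventually.of_forall fun i => ?_)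
    · rw [IntegrableOn, Measure.restrict_restrict (hKi i).measurableSet]
      refine (((hJ.continuousOn.norm.pow 2).mono ?_).integrableOn_compact (hKi i)).mono_set Set.inter_subset_left
      exact Set.inter_subset_left
    · obtain ⟨P, hP⟩ := exists_cut (n := n) hp (cseq_lt i)
      have h1 := hCb _ hJ (max B 0) (le_max_right _ _) (fun z hz => (hB z hz).trans (le_max_left _ _)) _ (cseq_lt i) P hP
      refine le_trans ?_ h1
      have hcc : (1 + cseq i) / 2 < 1 := by have := cseq_lt i; linarith
      have hPc : Continuous P := by
        have := Complex.continuous_re.comp hP.smooth.continuous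
        exact this
      obtain ⟨a, b⟩ := supp_of_zero (u := fun w => (1:ℂ) * P w) hp hcc (fun w hw => by simp [hP.zero w hw])
      rw [← hDe] at b
      have hpi : Integrable (pull D f (fun w => (1:ℂ) * P w) (fun z => rdet (jac f z) * (starRingEnd ℂ) (rdet (jac f z)))) :=
        (pull_continuous hD hf (by fun_prop) a b (J_cont hD hf hJ.continuousOn)).integrable_of_hasCompactSupport (pull_compact hD hf a b)
      let W : (Fin n → ℂ) → ℝ := fun z => if z ∈ D then P (f z) * ‖rdet (jac f z)‖ ^ 2 else 0
      have hW : ∀ z, pull D f (fun w => (1:ℂ) * P w) (fun z => rdet (jac f z) * (starRingEnd ℂ) (rdet (jac f z))) z = (W z : ℂ) := by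
        intro z; simp only [pull, W]; split_ifs
        · rw [Complex.mul_conj, Complex.normSq_eq_norm_sq]; push_cast; ring
        · simp
      have hW0 : ∀ z, 0 ≤ W z := by
        intro z; simp only [W]; split_ifs
        · exact mul_nonneg (hP.mem _).1 (by positivity)
        · exact le_rfl
      have e : ∫ z, ((W z : ℝ) : ℂ) = ((∫ z, W z : ℝ) : ℂ) := integral_ofReal
      have hWi : Integrable W := by
        have := hpi.re
        refine this.congr (Eventually.of_forall fun z => ?_)
        beta_reduce; rw [hW]; exact Complex.ofReal_re _
      simp_rw [hW]
      rw [e, Complex.norm_real, Real.norm_eq_abs, abs_of_nonneg (integral_nonneg hW0),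
        Measure.restrict_restrict (hKi i).measurableSet]
      have hss : D ∩ f ⁻¹' {w | gR p w ≤ cseq i} ∩ D = D ∩ f ⁻¹' {w | gR p w ≤ cseq i} :=
        Set.inter_eq_left.2 Set.inter_subset_left
      rw [hss]
      calc ∫ z in D ∩ f ⁻¹' {w | gR p w ≤ cseq i}, ‖‖rdet (jac f z)‖ ^ 2‖
          = ∫ z in D ∩ f ⁻¹' {w | gR p w ≤ cseq i}, W z := by
            refine setIntegral_congr_fun (hKi i).measurableSet fun z hz => ?_
            have h1 : P (f z) = 1 := hP.one _ hz.2
            simp [W, hz.1, h1]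
        _ ≤ ∫ z, W z := setIntegral_le_integral hWi (Eventually.of_forall hW0)
  refine Integrable.mono' (g := fun z => 1 + ‖rdet (jac f z)‖ ^ 2) ?_ (hJ.continuousOn.aestronglyMeasurable hD.measurableSet) ?_
  · have : IsFiniteMeasure (volume.restrict D) := ⟨by simpa using hfin⟩
    exact (integrable_const 1).add hsq
  · refine Eventually.of_forall fun z => ?_
    nlinarith [sq_nonneg (‖rdet (jac f z)‖ - 1), norm_nonneg (rdet (jac f z))]

lemma key_bound (hp : 0 < p) (hn : 1 ≤ n) (hDe : D = {w | gR p w < 1}) (hf : IsProperHolomorphic f D D) {m : (Fin n → ℂ) → ℂ}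
    (hm : Differentiable ℂ m) (d : ℕ)
    (hmd : ∀ w, ∑ j : Fin n, ((j.1 + 1 : ℕ) : ℂ) * w j * fderiv ℂ m w (Pi.single j 1) = d * m w) :
    IntegrableOn (fun z => rdet (jac f z) * m (f z)) D ∧
    ∃ C : ℝ, 0 ≤ C ∧ ∀ h, DifferentiableOn ℂ h D → (∃ B', ∀ z ∈ D, ‖h z‖ ≤ B') → ∀ B : ℝ, 0 ≤ B → (∀ z ∈ K0 p D f, ‖h z‖ ≤ B) →
      ‖∫ z in D, rdet (jac f z) * m (f z) * (starRingEnd ℂ) (h z)‖ ≤ C * B := by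
  have hD : IsOpen D := by rw [hDe]; exact gR_open hp 1
  have hJ := rdet_contDiffOn hD hf.1
  have hJi := J_integrable hp hn hDe hf
  obtain ⟨Bm, hBm⟩ := (gR_compact (n := n) hp 1).exists_bound_of_continuousOn hm.continuous.continuousOn
  have hmb : ∀ z ∈ D, ‖m (f z)‖ ≤ Bm := by
    intro z hz
    apply hBm
    have := hf.2.1 hz; rw [hDe] at this; exact le_of_lt (show gR p (f z) < 1 from this)
  have hmc : ContinuousOn (fun z => m (f z)) D := hm.continuous.comp_continuousOn hf.1.continuousOn
  refine ⟨?_, ?_⟩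
  · refine Integrable.mono' (hJi.norm.mul_const Bm) ((hJ.continuousOn.mul hmc).aestronglyMeasurable hD.measurableSet) ?_
    filter_upwards [ae_restrict_mem hD.measurableSet] with z hz
    rw [norm_mul]; exact mul_le_mul_of_nonneg_left (hmb z hz) (norm_nonneg _)
  obtain ⟨C, hC, hCb⟩ := key_cut hp hn hDe hf hm d hmd
  refine ⟨C, hC, ?_⟩
  rintro h hh ⟨B', hB'⟩ B hB hhB
  choose P hP using fun i : ℕ => exists_cut (n := n) hp (cseq_lt i)
  have hpull : ∀ i, ∫ z, pull D f (fun w => m w * P i w) (fun z => rdet (jac f z) * (starRingEnd ℂ) (h z)) z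
      = ∫ z in D, (m (f z) * P i (f z)) * (rdet (jac f z) * (starRingEnd ℂ) (h z)) := by
    intro i
    rw [← integral_indicator hD.measurableSet]
    refine integral_congr_ae (Eventually.of_forall fun z => ?_)
    simp only [pull, Set.indicator]
  have hlim : Tendsto (fun i => ∫ z in D, (m (f z) * P i (f z)) * (rdet (jac f z) * (starRingEnd ℂ) (h z))) atTop
      (𝓝 (∫ z in D, rdet (jac f z) * m (f z) * (starRingEnd ℂ) (h z))) := by
    refine tendsto_integral_of_dominated_convergence (fun z => Bm * ‖rdet (jac f z)‖ * B') ?_ ((hJi.norm.const_mul Bm).mul_const B') ?_ ?_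
    · intro i
      have hPc : Continuous (P i) := by
        have := Complex.continuous_re.comp (hP i).smooth.continuous
        exact this
      refine ContinuousOn.aestronglyMeasurable ?_ hD.measurableSet
      exact (hmc.mul (Complex.continuous_ofReal.comp_continuousOn (hPc.comp_continuousOn hf.1.continuousOn))).mul (J_cont hD hf hh.continuousOn)
    · intro i
      filter_upwards [ae_restrict_mem hD.measurableSet] with z hz
      have h1 : ‖((P i (f z) : ℝ) : ℂ)‖ ≤ 1 := by
        rw [Complex.norm_real, Real.norm_eq_abs, abs_of_nonneg ((hP i).mem _).1]; exact ((hP i).mem _).2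
      rw [norm_mul, norm_mul, norm_mul, RCLike.norm_conj]
      have hBm0 : 0 ≤ Bm := (norm_nonneg _).trans (hmb z hz)
      calc ‖m (f z)‖ * ‖((P i (f z) : ℝ) : ℂ)‖ * (‖rdet (jac f z)‖ * ‖h z‖)
          ≤ Bm * 1 * (‖rdet (jac f z)‖ * B') := by gcongr; exact hmb z hz; exact hB' z hz
        _ = _ := by ring
    · filter_upwards [ae_restrict_mem hD.measurableSet] with z hz
      have h1 : gR p (f z) < 1 := by have := hf.2.1 hz; rw [hDe] at this; exact this
      refine tendsto_const_nhds.congr' ?_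
      filter_upwards [cseq_ev h1] with i hi
      rw [(hP i).one _ hi]; push_cast; ring
  refine le_of_tendsto hlim.norm (Eventually.of_forall fun i => ?_)
  rw [← hpull]
  exact hCb h hh B hB hhB _ (cseq_lt i) _ (hP i)

end
end

section
open MeasureTheory Metric Filter Topology
open Finset
open scoped ContDiff

section
variable {n : ℕ} {p : ℝ} {D : Set (Fin n → ℂ)} {H : (Fin n → ℂ) → ℂ}

lemma iteratedDeriv_mul_left (g : ℂ → ℂ) (c : ℂ) (k : ℕ) :
    iteratedDeriv k (fun x => g (c * x)) = fun x => c ^ k * iteratedDeriv k g (c * x) := by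
  induction k with
  | zero => funext x; simp [iteratedDeriv_zero]
  | succ k ih =>
    rw [iteratedDeriv_succ, ih]
    funext x
    rw [deriv_const_mul_field, deriv_comp_mul_left c (iteratedDeriv k g) x, iteratedDeriv_succ, smul_eq_mul]
    ring

noncomputable def hcoef (H : (Fin n → ℂ) → ℂ) (k : ℕ) (w : Fin n → ℂ) : ℂ :=
  (k.factorial : ℂ)⁻¹ * iteratedDeriv k (fun l => H (dil l w)) 0

lemma hcoef_dil (H : (Fin n → ℂ) → ℂ) (k : ℕ) (c : ℂ) (w : Fin n → ℂ) : hcoef H k (dil c w) = c ^ k * hcoef H k w := by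
  unfold hcoef
  have : (fun l => H (dil l (dil c w))) = fun l => (fun l => H (dil l w)) (c * l) := by
    funext l; rw [dil_dil, mul_comm]
  rw [this, iteratedDeriv_mul_left (fun l => H (dil l w))]
  simp; ring

lemma diff_dil_l (w : Fin n → ℂ) : Differentiable ℂ (fun l : ℂ => dil l w) := by
  unfold dil
  exact differentiable_pi.2 fun k => (differentiable_id.pow _).mul_const _

lemma dil_mem (hp : 0 < p) {t : ℝ} {w : Fin n → ℂ} (hw : gR p w < t) {l : ℂ} (hl : ‖l‖ ≤ 1) : gR p (dil l w) < t := by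
  rw [gR_dil hp]
  refine lt_of_le_of_lt (mul_le_of_le_one_left (gR_nonneg hp w) ?_) hw
  exact Real.rpow_le_one (norm_nonneg _) hl (by linarith)

/-- for w in D the slice is holomorphic on a disc of radius > 1 -/
lemma slice_diff (hp : 0 < p) (hDe : D = {w | gR p w < 1}) (hH : DifferentiableOn ℂ H D) {w : Fin n → ℂ} (hw : w ∈ D) :
    ∃ R : ℝ, 1 < R ∧ DifferentiableOn ℂ (fun l => H (dil l w)) (ball 0 R) := by
  have hw' : gR p w < 1 := by rw [hDe] at hw; exact hw
  have : ∃ R : ℝ, 1 < R ∧ R ^ (2 * p) * gR p w < 1 := by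
    have hc : ContinuousAt (fun R : ℝ => R ^ (2 * p) * gR p w) 1 :=
      (Real.continuousAt_rpow_const 1 (2 * p) (Or.inl one_ne_zero)).mul continuousAt_const
    have h1 : ∀ᶠ R in 𝓝 (1:ℝ), R ^ (2 * p) * gR p w < 1 := hc.eventually (gt_mem_nhds (by simpa using hw'))
    have h2 : ∀ᶠ R in 𝓝[>] (1:ℝ), R ^ (2 * p) * gR p w < 1 := h1.filter_mono nhdsWithin_le_nhds
    obtain ⟨R, hR, hR'⟩ := (h2.and self_mem_nhdsWithin).exists
    exact ⟨R, hR', hR⟩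
  obtain ⟨R, hR, hR'⟩ := this
  refine ⟨R, hR, hH.comp (diff_dil_l w).differentiableOn ?_⟩
  intro l hl
  rw [mem_ball_zero_iff] at hl
  rw [hDe]
  change gR p (dil l w) < 1
  rw [gR_dil hp]
  refine lt_of_le_of_lt (mul_le_mul_of_nonneg_right ?_ (gR_nonneg hp w)) hR'
  exact Real.rpow_le_rpow (norm_nonneg _) hl.le (by linarith)

lemma hcoef_sum (hp : 0 < p) (hDe : D = {w | gR p w < 1}) (hH : DifferentiableOn ℂ H D) {w : Fin n → ℂ} (hw : w ∈ D) :
    HasSum (fun k => hcoef H k w) (H w) := by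
  obtain ⟨R, hR, hd⟩ := slice_diff hp hDe hH hw
  have := Complex.hasSum_taylorSeries_on_ball hd (z := 1) (by simpa using hR)
  simpa [hcoef, dil_one] using this

lemma hcoef_int (hp : 0 < p) (hDe : D = {w | gR p w < 1}) (hH : DifferentiableOn ℂ H D) {w : Fin n → ℂ} (hw : w ∈ D) (k : ℕ) :
    ((2 * Real.pi : ℝ) : ℂ) * hcoef H k w = ∫ θ in (0:ℝ)..(2 * Real.pi), (uexp θ ^ k)⁻¹ * H (dil (uexp θ) w) := by
  obtain ⟨R, hR, hd⟩ := slice_diff hp hDe hH hw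
  have hdc : DiffContOnCl ℂ (fun l => H (dil l w)) (ball 0 1) := by
    refine DifferentiableOn.diffContOnCl (hd.mono ?_)
    rw [closure_ball _ one_ne_zero]
    exact closedBall_subset_ball hR
  have h := hdc.circleIntegral_one_div_sub_center_pow_smul one_pos k
  have e1 : (∮ z in C(0, 1), (1 / (z - 0) ^ (k + 1)) • H (dil z w)) = Complex.I * ∫ θ in (0:ℝ)..(2 * Real.pi), (uexp θ ^ k)⁻¹ * H (dil (uexp θ) w) := by
    rw [circleIntegral, ← intervalIntegral.integral_const_mul]
    refine intervalIntegral.integral_congr fun θ _ => ?_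
    have : circleMap 0 1 θ = uexp θ := by simp [circleMap, uexp]
    simp only [deriv_circleMap, this, smul_eq_mul, sub_zero]
    have h0 : uexp θ ≠ 0 := by rw [← norm_ne_zero_iff, norm_uexp]; exact one_ne_zero
    field_simp
    ring
  rw [e1] at h
  have h3 : Complex.I * ∫ θ in (0:ℝ)..(2 * Real.pi), (uexp θ ^ k)⁻¹ * H (dil (uexp θ) w) = Complex.I * (((2 * Real.pi : ℝ) : ℂ) * hcoef H k w) := by
    rw [h, hcoef, smul_eq_mul]; push_cast; ring
  exact (mul_left_cancel₀ Complex.I_ne_zero h3).symm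

lemma slice_cont (hp : 0 < p) (hDe : D = {w | gR p w < 1}) (hH : ContinuousOn H D) (k : ℕ) :
    ContinuousOn (fun q : (Fin n → ℂ) × ℝ => (uexp q.2 ^ k)⁻¹ * H (dil (uexp q.2) q.1)) (D ×ˢ Set.univ) := by
  have hu := contDiff_uexp.continuous
  have h0 : ∀ θ, uexp θ ≠ 0 := fun θ => by rw [← norm_ne_zero_iff, norm_uexp]; exact one_ne_zero
  refine ContinuousOn.mul ?_ ?_
  · refine Continuous.continuousOn ?_
    exact ((hu.comp continuous_snd).pow k).inv₀ fun q => pow_ne_zero _ (h0 _)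
  · refine hH.comp (continuous_dil.comp ((hu.comp continuous_snd).prodMk continuous_fst)).continuousOn ?_
    rintro ⟨w, θ⟩ ⟨hw, _⟩
    rw [hDe] at hw ⊢
    change gR p (dil (uexp θ) w) < 1
    rw [gR_uexp hp]; exact hw

lemma hcoef_diffD (hp : 0 < p) (hDe : D = {w | gR p w < 1}) (hH : DifferentiableOn ℂ H D) (k : ℕ) :
    DifferentiableOn ℂ (hcoef H k) D := by
  have hD : IsOpen D := by rw [hDe]; exact gR_open hp 1
  have h1 := holo_param hD Real.two_pi_pos.le (G := fun w θ => (uexp θ ^ k)⁻¹ * H (dil (uexp θ) w))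
    (slice_cont hp hDe hH.continuousOn k) (by
      intro θ
      refine DifferentiableOn.const_mul (hH.comp (diff_dil _).differentiableOn ?_) _
      intro w hw
      rw [hDe] at hw ⊢
      change gR p (dil (uexp θ) w) < 1
      rw [gR_uexp hp]; exact hw)
  have h2 : DifferentiableOn ℂ (fun w => ((2 * Real.pi : ℝ) : ℂ)⁻¹ * ∫ θ in (0:ℝ)..(2 * Real.pi), (uexp θ ^ k)⁻¹ * H (dil (uexp θ) w)) D := h1.const_mul _
  refine h2.congr fun w hw => ?_
  rw [← hcoef_int hp hDe hH hw]
  have : ((2 * Real.pi : ℝ) : ℂ) ≠ 0 := by exact_mod_cast Real.two_pi_pos.ne'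
  field_simp

lemma exists_small_dil (hp : 0 < p) (w : Fin n → ℂ) : ∃ c : ℂ, c ≠ 0 ∧ gR p (dil c w) < 1 := by
  have hc : ContinuousAt (fun c : ℂ => gR p (dil c w)) 0 :=
    ((gR_continuous hp).comp (diff_dil_l w).continuous).continuousAt
  have h1 : ∀ᶠ c in 𝓝 (0:ℂ), gR p (dil c w) < 1 := hc.eventually (gt_mem_nhds (by simp [dil_zero, gR_zero hp]))
  have h2 : ∀ᶠ c in 𝓝[≠] (0:ℂ), gR p (dil c w) < 1 := h1.filter_mono nhdsWithin_le_nhds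
  obtain ⟨R, hR, hR'⟩ := (h2.and self_mem_nhdsWithin).exists
  exact ⟨R, hR', hR⟩

lemma hcoef_diff (hp : 0 < p) (hDe : D = {w | gR p w < 1}) (hH : DifferentiableOn ℂ H D) (k : ℕ) :
    Differentiable ℂ (hcoef H k) := by
  have hD : IsOpen D := by rw [hDe]; exact gR_open hp 1
  intro w
  obtain ⟨c, hc, hcw⟩ := exists_small_dil hp w
  have e : hcoef H k = fun w => (c ^ k)⁻¹ * hcoef H k (dil c w) := by
    funext w; rw [hcoef_dil]; field_simp
  rw [e]
  have h1 : DifferentiableAt ℂ (hcoef H k) (dil c w) :=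
    (hcoef_diffD hp hDe hH k).differentiableAt (hD.mem_nhds (by rw [hDe]; exact hcw))
  exact (h1.comp w (diff_dil c w)).const_mul _

lemma rot_D (hp : 0 < p) (hDe : D = {w | gR p w < 1}) {F : Type*} [NormedAddCommGroup F] [NormedSpace ℝ F] (θ : ℝ) (g : (Fin n → ℂ) → F) :
    ∫ w in D, g (dil (uexp θ) w) = ∫ w in D, g w := by
  refine rot_setIntegral (fun k : Fin n => uexp θ ^ (k.1 + 1)) (fun k => by rw [norm_pow, norm_uexp, one_pow]) ?_ g
  rw [hDe]
  ext w
  change gR p (dil (uexp θ) w) < 1 ↔ _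
  rw [gR_uexp hp]; rfl

lemma rot_D_int (hp : 0 < p) (hDe : D = {w | gR p w < 1}) {g : (Fin n → ℂ) → ℂ} (hg : IntegrableOn g D) (hgc : ContinuousOn g D) (θ : ℝ) :
    IntegrableOn (fun w => g (dil (uexp θ) w)) D := by
  have hD : IsOpen D := by rw [hDe]; exact gR_open hp 1
  have hm : Set.MapsTo (fun w => dil (uexp θ) w) D D := by
    intro w hw; rw [hDe] at hw ⊢; change gR p (dil (uexp θ) w) < 1; rw [gR_uexp hp]; exact hw
  have hc : ∀ k : Fin n, ‖(fun k : Fin n => uexp θ ^ (k.1 + 1)) k‖ = 1 := fun k => by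
    simp only [norm_pow, norm_uexp, one_pow]
  have h1 := (volume_rot _ hc).integrableOn_comp_preimage (rot_embedding _ hc) (f := g) (s := D)
  have h2 : (fun w : Fin n → ℂ => fun k : Fin n => uexp θ ^ (k.1 + 1) * w k) ⁻¹' D = D := by
    rw [hDe]
    ext w
    change gR p (dil (uexp θ) w) < 1 ↔ _
    rw [gR_uexp hp]; rfl
  rw [h2] at h1
  exact h1.2 hg

lemma hcoef_ortho (hp : 0 < p) (hDe : D = {w | gR p w < 1}) (hH : DifferentiableOn ℂ H D) (hHi : IntegrableOn H D) (k : ℕ) :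
    ∫ w in D, H w * (starRingEnd ℂ) (hcoef H k w) = ((∫ w in D, ‖hcoef H k w‖ ^ 2 : ℝ) : ℂ) := by
  have hD : IsOpen D := by rw [hDe]; exact gR_open hp 1
  have hhd := hcoef_diff hp hDe hH k
  obtain ⟨B, hB⟩ := (gR_compact (n := n) hp 1).exists_bound_of_continuousOn hhd.continuous.continuousOn
  have hBD : ∀ w ∈ D, ‖hcoef H k w‖ ≤ B := by
    intro w hw; rw [hDe] at hw; exact hB w (le_of_lt (show gR p w < 1 from hw))
  have hpi : ((2 * Real.pi : ℝ) : ℂ) ≠ 0 := by exact_mod_cast Real.two_pi_pos.ne'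
  let Q : (Fin n → ℂ) → ℝ → ℂ := fun w θ => ((uexp θ ^ k)⁻¹ * H (dil (uexp θ) w)) * (starRingEnd ℂ) (hcoef H k w)
  have h1 : ∀ θ : ℝ, ∫ w in D, H w * (starRingEnd ℂ) (hcoef H k w) = ∫ w in D, Q w θ := by
    intro θ
    rw [← rot_D hp hDe θ]
    refine integral_congr_ae (Eventually.of_forall fun w => ?_)
    simp only [Q, hcoef_dil, map_mul]
    have : (starRingEnd ℂ) (uexp θ ^ k) = (uexp θ ^ k)⁻¹ := by
      rw [Complex.inv_def, Complex.normSq_eq_norm_sq, norm_pow, norm_uexp]; simp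
    rw [this]; ring
  have hQc : ContinuousOn (Function.uncurry Q) (D ×ˢ Set.univ) := by
    refine (slice_cont hp hDe hH.continuousOn k).mul ?_
    exact (Complex.continuous_conj.comp (hhd.continuous.comp continuous_fst)).continuousOn
  let ν : Measure ℝ := volume.restrict (Set.Ioc 0 (2 * Real.pi))
  have hQi : Integrable (Function.uncurry Q) ((volume.restrict D).prod ν) := by
    have hmeas : AEStronglyMeasurable (Function.uncurry Q) ((volume.restrict D).prod ν) := by
      rw [Measure.prod_restrict]
      refine (hQc.mono (Set.prod_mono le_rfl (Set.subset_univ _))).aestronglyMeasurable (hD.measurableSet.prod measurableSet_Ioc)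
    have hQn : ∀ θ, IntegrableOn (fun w => Q w θ) D := by
      intro θ
      have hr := rot_D_int hp hDe hHi hH.continuousOn θ
      refine Integrable.mono' (hr.norm.mul_const B) ?_ ?_
      · refine ContinuousOn.aestronglyMeasurable ?_ hD.measurableSet
        exact hQc.comp (f := fun w => (w, θ)) (by fun_prop) (fun w hw => ⟨hw, trivial⟩)
      · filter_upwards [ae_restrict_mem hD.measurableSet] with w hw
        simp only [Q, norm_mul, norm_inv, norm_pow, norm_uexp, one_pow, inv_one, one_mul, RCLike.norm_conj]
        exact mul_le_mul_of_nonneg_left (hBD w hw) (norm_nonneg _)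
    rw [integrable_prod_iff' hmeas]
    refine ⟨Eventually.of_forall hQn, ?_⟩
    have : ∀ θ, ∫ w in D, ‖Function.uncurry Q (w, θ)‖ = ∫ w in D, ‖H w‖ * ‖hcoef H k w‖ := by
      intro θ
      rw [← rot_D hp hDe θ (fun w => ‖H w‖ * ‖hcoef H k w‖)]
      refine integral_congr_ae (Eventually.of_forall fun w => ?_)
      simp only [Q, Function.uncurry, hcoef_dil, norm_mul, norm_inv, norm_pow, norm_uexp, one_pow, inv_one, one_mul, RCLike.norm_conj]
    simp_rw [this]
    exact integrable_const _
  have h2 : ((2 * Real.pi : ℝ) : ℂ) * ∫ w in D, H w * (starRingEnd ℂ) (hcoef H k w) = ∫ θ in (0:ℝ)..(2 * Real.pi), ∫ w in D, Q w θ := by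
    simp_rw [← h1]
    rw [intervalIntegral.integral_const, sub_zero, Complex.real_smul]
  rw [intervalIntegral.integral_of_le Real.two_pi_pos.le, ← integral_integral_swap hQi] at h2
  have h3 : ∫ w in D, ∫ θ, Q w θ ∂ν = ∫ w in D, ((2 * Real.pi : ℝ) : ℂ) * ((‖hcoef H k w‖ ^ 2 : ℝ) : ℂ) := by
    refine setIntegral_congr_fun hD.measurableSet fun w hw => ?_
    simp only [Q]
    rw [integral_mul_const]
    have h4 := hcoef_int hp hDe hH hw k
    rw [intervalIntegral.integral_of_le Real.two_pi_pos.le] at h4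
    rw [← h4, mul_assoc, Complex.mul_conj, Complex.normSq_eq_norm_sq]
  rw [h3, integral_const_mul] at h2
  have h5 := mul_left_cancel₀ hpi h2
  rw [h5]
  exact integral_ofReal

end
end

section
open MeasureTheory Metric Filter Topology
open Finset
open scoped ContDiff

section
variable {n : ℕ} {p : ℝ} {D : Set (Fin n → ℂ)} {H : (Fin n → ℂ) → ℂ}

/-- locally uniformly summable series of entire functions -/
lemma holo_tsum {a : ℕ → (Fin n → ℂ) → ℂ} (ha : ∀ k, Differentiable ℂ (a k)) {U : Set (Fin n → ℂ)} (hU : IsOpen U) {u : ℕ → ℝ}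
    (hu : Summable u) (hb : ∀ k, ∀ w ∈ U, ‖a k w‖ ≤ u k) : DifferentiableOn ℂ (fun w => ∑' k, a k w) U := by
  intro w hw
  obtain ⟨e, he, hsub⟩ := Metric.isOpen_iff.1 hU w hw
  have hd : 0 < e / 2 := by linarith
  have hb2 : ∀ x ∈ ball w (e / 2), ball x (e / 2) ⊆ U := by
    intro x hx
    refine Set.Subset.trans (ball_subset_ball' ?_) hsub
    have : dist x w < e / 2 := hx
    linarith
  have := hasFDerivAt_tsum_of_isPreconnected (𝕜 := ℂ) (f := a) (f' := fun k x => fderiv ℂ (a k) x) (s := ball w (e / 2)) (x₀ := w) (x := w)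
    (u := fun k => u k / (e / 2)) (hu.div_const _) isOpen_ball (convex_ball w (e/2)).isPreconnected
    (fun k x _ => (ha k x).hasFDerivAt)
    (fun k x hx => holo_cauchy hd (ha k).differentiableOn fun y hy => hb k y (hb2 x hx hy))
    (mem_ball_self hd) (Summable.of_norm_bounded hu fun k => hb k w hw) (mem_ball_self hd)
  exact this.differentiableAt.differentiableWithinAt

lemma norm_ofReal_pos {q : ℝ} (hq : 0 < q) : ‖(q:ℂ)‖ = q := by
  rw [Complex.norm_real, Real.norm_eq_abs, abs_of_pos hq]

/-- weighted-homogeneous expansion converges beyond the boundary -/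
theorem extend_of_bound (hp : 0 < p) (hDe : D = {w | gR p w < 1}) (hH : DifferentiableOn ℂ H D) (hHi : IntegrableOn H D)
    {K : Set (Fin n → ℂ)} (hK : IsCompact K) (hKD : K ⊆ D) {C : ℝ} (hC : 0 ≤ C)
    (hb : ∀ h, DifferentiableOn ℂ h D → (∃ B', ∀ z ∈ D, ‖h z‖ ≤ B') → ∀ B : ℝ, 0 ≤ B → (∀ z ∈ K, ‖h z‖ ≤ B) →
      ‖∫ z in D, H z * (starRingEnd ℂ) (h z)‖ ≤ C * B) :
    ∃ t > 1, ∃ H' : (Fin n → ℂ) → ℂ, DifferentiableOn ℂ H' {w | gR p w < t} ∧ ∀ z ∈ D, H' z = H z := by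
  have hD : IsOpen D := by rw [hDe]; exact gR_open hp 1
  -- choose q
  obtain ⟨q, hq0, hq1, hKq⟩ : ∃ q : ℝ, 0 < q ∧ q < 1 ∧ ∀ z ∈ K, gR p z ≤ (q ^ 4) ^ (2 * p) := by
    obtain ⟨r, hr1, hr⟩ : ∃ r < 1, ∀ z ∈ K, gR p z ≤ r := by
      rcases K.eq_empty_or_nonempty with h | h
      · exact ⟨0, one_pos, by simp [h]⟩
      · obtain ⟨z, hz, hz'⟩ := hK.exists_isMaxOn h (gR_continuous hp).continuousOn
        refine ⟨gR p z, ?_, fun y hy => hz' hy⟩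
        have := hKD hz; rw [hDe] at this; exact this
    have hcont : ContinuousAt (fun q : ℝ => (q ^ 4) ^ (2 * p)) 1 := by
      have h1 : ContinuousAt (fun x : ℝ => x ^ (2 * p)) ((1:ℝ) ^ 4) := Real.continuousAt_rpow_const _ _ (Or.inl (by norm_num))
      exact ContinuousAt.comp (f := fun q : ℝ => q ^ 4) h1 (by fun_prop)
    have h1 : ∀ᶠ q in 𝓝 (1:ℝ), r < (q ^ 4) ^ (2 * p) := hcont.eventually (lt_mem_nhds (by simpa using hr1))
    have h2 : ∀ᶠ q in 𝓝[<] (1:ℝ), r < (q ^ 4) ^ (2 * p) := h1.filter_mono nhdsWithin_le_nhds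
    have h3 : ∀ᶠ q in 𝓝[<] (1:ℝ), 0 < q := nhdsWithin_le_nhds (lt_mem_nhds one_pos)
    obtain ⟨q, ⟨h4, h5⟩, h6⟩ := ((h2.and h3).and self_mem_nhdsWithin).exists
    exact ⟨q, h5, h6, fun z hz => (hr z hz).trans h4.le⟩
  have hnq : ‖(q:ℂ)‖ = q := norm_ofReal_pos hq0
  have hqc : (q:ℂ) ≠ 0 := by exact_mod_cast hq0.ne'
  have hdilinv : ∀ w : Fin n → ℂ, dil (q:ℂ) (dil ((q:ℂ)⁻¹) w) = w := fun w => by rw [dil_dil, mul_inv_cancel₀ hqc, dil_one]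
  -- ball radius
  obtain ⟨δ, hδ, hball⟩ : ∃ δ > 0, ∀ w : Fin n → ℂ, gR p w ≤ q ^ (2 * p) → closedBall w δ ⊆ D := by
    have hs : {w : Fin n → ℂ | gR p w ≤ q ^ (2 * p)} ⊆ D := by
      rw [hDe]; intro w hw
      exact lt_of_le_of_lt hw (Real.rpow_lt_one hq0.le hq1 (by linarith))
    obtain ⟨δ, hδ, h⟩ := (gR_compact hp _).exists_cthickening_subset_open hD hs
    exact ⟨δ, hδ, fun w hw => (closedBall_subset_cthickening (show w ∈ {w : Fin n → ℂ | gR p w ≤ q ^ (2 * p)} from hw) δ).trans h⟩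
  set V := (volume (ball (0 : Fin n → ℂ) δ)).toReal with hV
  have hVpos : 0 < V := ENNReal.toReal_pos (measure_ball_pos _ _ hδ).ne' measure_ball_lt_top.ne
  have ha := hcoef_diff hp hDe hH
  have hinv : ∀ k w, hcoef H k w = ((q:ℂ)⁻¹) ^ k * hcoef H k (dil (q:ℂ) w) := by
    intro k w; rw [hcoef_dil, ← mul_assoc, ← mul_pow, inv_mul_cancel₀ hqc, one_pow, one_mul]
  have key : ∀ k, ∀ w : Fin n → ℂ, gR p w ≤ 1 → ‖hcoef H k w‖ ≤ C / V * (q ^ 2) ^ k := by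
    intro k
    obtain ⟨w₀, hw₀, hmax⟩ := (gR_compact (n := n) hp 1).exists_isMaxOn ⟨0, by simp [gR_zero hp]⟩ (ha k).continuous.norm.continuousOn
    set S := ‖hcoef H k w₀‖ with hS
    have hmax' : ∀ w : Fin n → ℂ, gR p w ≤ 1 → ‖hcoef H k w‖ ≤ S := fun w hw => hmax hw
    have hDle : ∀ w ∈ D, gR p w ≤ 1 := by intro w hw; rw [hDe] at hw; exact le_of_lt (show gR p w < 1 from hw)
    have hKb : ∀ z ∈ K, ‖hcoef H k z‖ ≤ (q ^ 4) ^ k * S := by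
      intro z hz
      have hq4 : ((q ^ 4 : ℝ) : ℂ) ≠ 0 := by exact_mod_cast (pow_pos hq0 4).ne'
      have e : z = dil ((q ^ 4 : ℝ) : ℂ) (dil (((q ^ 4 : ℝ) : ℂ)⁻¹) z) := by rw [dil_dil, mul_inv_cancel₀ hq4, dil_one]
      rw [e, hcoef_dil, norm_mul, norm_pow, norm_ofReal_pos (pow_pos hq0 4)]
      refine mul_le_mul_of_nonneg_left (hmax' _ ?_) (by positivity)
      rw [gR_dil hp, norm_inv, norm_ofReal_pos (pow_pos hq0 4), Real.inv_rpow (by positivity)]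
      rw [inv_mul_le_iff₀ (by positivity), mul_one]
      exact hKq z hz
    have h1 := hb _ (ha k).differentiableOn ⟨S, fun z hz => hmax' z (hDle z hz)⟩ ((q ^ 4) ^ k * S) (by positivity) hKb
    rw [hcoef_ortho hp hDe hH hHi, Complex.norm_real, Real.norm_eq_abs, abs_of_nonneg (integral_nonneg fun _ => by positivity)] at h1
    -- mean value
    have h2 : V * (q ^ k * S) ^ 2 ≤ ∫ w in D, ‖hcoef H k w‖ ^ 2 := by
      have hg : gR p (dil (q:ℂ) w₀) ≤ q ^ (2 * p) := by
        rw [gR_dil hp, hnq]; exact mul_le_of_le_one_right (by positivity) hw₀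
      have h3 := holo_mean hδ hD (hball _ hg) (f := fun w => hcoef H k w ^ 2) ((ha k).pow 2).differentiableOn
      rw [Measure.addHaar_ball_center] at h3
      simp only [hcoef_dil, norm_pow, norm_mul, hnq] at h3
      refine h3.trans ?_
      refine setIntegral_mono_set ?_ (Eventually.of_forall fun _ => by positivity) ((ball_subset_closedBall.trans (hball _ hg)).eventuallyLE)
      have : IntegrableOn (fun w => ‖hcoef H k w‖ ^ 2) {w | gR p w ≤ 1} :=
        ((ha k).continuous.norm.pow 2).continuousOn.integrableOn_compact (gR_compact hp 1)
      exact this.mono_set fun w hw => hDle w hw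
    have h4 : V * (q ^ k * S) ^ 2 ≤ C * ((q ^ 4) ^ k * S) := h2.trans h1
    have hS0 : 0 ≤ S := norm_nonneg _
    have h5 : S ≤ C / V * (q ^ 2) ^ k := by
      rcases hS0.eq_or_lt with h | h
      · rw [← h]; positivity
      · have hqk : 0 < q ^ k := pow_pos hq0 k
        have e1 : (q ^ 4) ^ k = (q ^ k) ^ 2 * (q ^ 2) ^ k := by rw [← pow_mul, ← pow_mul, ← pow_mul, ← pow_add]; ring_nf
        rw [e1] at h4
        have h6 : ((q ^ k) ^ 2 * S) * (V * S) ≤ ((q ^ k) ^ 2 * S) * (C * (q ^ 2) ^ k) := by nlinarith [h4]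
        have h7 := le_of_mul_le_mul_left h6 (by positivity)
        rw [div_mul_eq_mul_div, le_div_iff₀ hVpos]; linarith
    exact fun w hw => (hmax' w hw).trans h5
  refine ⟨(q⁻¹) ^ (2 * p), Real.one_lt_rpow ((one_lt_inv₀ hq0).2 hq1) (by linarith), fun w => ∑' k, hcoef H k w, ?_, ?_⟩
  · refine holo_tsum ha (gR_open hp _) (u := fun k => C / V * q ^ k) ((summable_geometric_of_lt_one hq0.le hq1).mul_left _) ?_
    intro k w hw
    have hw' : gR p w < q⁻¹ ^ (2 * p) := hw
    have h1 : gR p (dil (q:ℂ) w) ≤ 1 := by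
      rw [gR_dil hp, hnq]
      rw [Real.inv_rpow hq0.le] at hw'
      have h4 : (0:ℝ) < q ^ (2 * p) := by positivity
      have := mul_lt_mul_of_pos_left hw' h4
      rw [mul_inv_cancel₀ h4.ne'] at this
      exact this.le
    rw [hinv, norm_mul, norm_pow, norm_inv, hnq]
    calc q⁻¹ ^ k * ‖hcoef H k (dil (q:ℂ) w)‖ ≤ q⁻¹ ^ k * (C / V * (q ^ 2) ^ k) :=
          mul_le_mul_of_nonneg_left (key k _ h1) (by positivity)
      _ = C / V * q ^ k := by
          rw [← pow_mul, mul_comm 2 k, pow_mul, inv_pow]; field_simp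
  · intro z hz
    exact (hcoef_sum hp hDe hH hz).tsum_eq

theorem exists_extension (hp : 0 < p) (hn : 1 ≤ n) (hDe : D = {w | gR p w < 1}) {f : (Fin n → ℂ) → (Fin n → ℂ)} (hf : IsProperHolomorphic f D D) :
    ∃ t > 1, ∃ J : (Fin n → ℂ) → ℂ, ∃ F : Fin n → (Fin n → ℂ) → ℂ, DifferentiableOn ℂ J {w | gR p w < t} ∧
      (∀ k, DifferentiableOn ℂ (F k) {w | gR p w < t}) ∧ (∀ z ∈ D, J z = rdet (jac f z)) ∧
      (∀ k, ∀ z ∈ D, F k z = rdet (jac f z) * f z k) := by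
  have hD : IsOpen D := by rw [hDe]; exact gR_open hp 1
  have hJ := rdet_contDiffOn hD hf.1
  have hK := K0_compact hp hDe hf
  have hKD : K0 p D f ⊆ D := Set.inter_subset_left
  have h0 : ∃ t > 1, ∃ H' : (Fin n → ℂ) → ℂ, DifferentiableOn ℂ H' {w | gR p w < t} ∧ ∀ z ∈ D, H' z = rdet (jac f z) := by
    obtain ⟨h1, C, hC, h2⟩ := key_bound hp hn hDe hf (m := fun _ => 1) (differentiable_const _) 0 (by intro w; simp)
    simp only [mul_one] at h1 h2
    exact extend_of_bound hp hDe hJ h1 hK hKD hC h2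
  have hk : ∀ k : Fin n, ∃ t > 1, ∃ H' : (Fin n → ℂ) → ℂ, DifferentiableOn ℂ H' {w | gR p w < t} ∧ ∀ z ∈ D, H' z = rdet (jac f z) * f z k := by
    intro k
    have hproj : Differentiable ℂ (fun w : Fin n → ℂ => w k) := differentiable_apply k
    obtain ⟨h1, C, hC, h2⟩ := key_bound hp hn hDe hf (m := fun w => w k) hproj (k.1 + 1) (by
      intro w
      have : fderiv ℂ (fun w : Fin n → ℂ => w k) w = ContinuousLinearMap.proj k :=
        (ContinuousLinearMap.proj (R := ℂ) (φ := fun _ : Fin n => ℂ) k).fderiv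
      rw [this, Finset.sum_eq_single k]
      · simp
      · intro j _ hj; simp [Pi.single_apply, hj.symm]
      · simp)
    exact extend_of_bound hp hDe (hJ.mul (hproj.comp_differentiableOn hf.1)) h1 hK hKD hC h2
  obtain ⟨t0, ht0, J, hJd, hJe⟩ := h0
  choose t ht F hFd hFe using hk
  have hne : Nonempty (Fin n) := ⟨⟨0, hn⟩⟩
  obtain ⟨i, -, hi⟩ := Finset.exists_min_image Finset.univ t ⟨⟨0, hn⟩, Finset.mem_univ _⟩
  refine ⟨min t0 (t i), lt_min ht0 (ht i), J, F, hJd.mono ?_, fun k => (hFd k).mono ?_, hJe, hFe⟩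
  · intro w hw; exact lt_of_lt_of_le (show gR p w < min t0 (t i) from hw) (min_le_left _ _)
  · intro w hw; exact lt_of_lt_of_le (show gR p w < min t0 (t i) from hw) ((min_le_right _ _).trans (hi k (Finset.mem_univ _)))

end
end

section
open MeasureTheory Metric Filter Topology
open Finset
open scoped ContDiff

section
variable {n : ℕ} {p : ℝ} {D : Set (Fin n → ℂ)}

lemma disc_exists (n : ℕ) : ∃ A : (Fin n → ℂ) → ℂ, Differentiable ℂ A ∧
    ∀ z, A (piMap n z) ≠ 0 ↔ ((∀ j, z j ≠ 0) ∧ Function.Injective z) := by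
  classical
  let S : MvPolynomial (Fin n) ℂ := (∏ j, MvPolynomial.X j) *
    ∏ i, ∏ j, (if i = j then 1 else MvPolynomial.X i - MvPolynomial.X j)
  have hS : S.IsSymmetric := by
    intro e
    simp only [S, map_mul, map_prod, MvPolynomial.rename_X]
    congr 1
    · exact Equiv.prod_comp e (fun j => (MvPolynomial.X j : MvPolynomial (Fin n) ℂ))
    · rw [← Equiv.prod_comp e (fun i => ∏ j, (if i = j then (1 : MvPolynomial (Fin n) ℂ) else MvPolynomial.X i - MvPolynomial.X j))]
      refine Finset.prod_congr rfl fun i _ => ?_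
      rw [← Equiv.prod_comp e (fun j => (if e i = j then (1 : MvPolynomial (Fin n) ℂ) else MvPolynomial.X (e i) - MvPolynomial.X j))]
      refine Finset.prod_congr rfl fun j _ => ?_
      by_cases h : i = j
      · simp [h]
      · simp [h]
  obtain ⟨q, hq⟩ := MvPolynomial.esymmAlgHom_fin_surjective (n := n) (m := n) ℂ le_rfl
    ⟨S, (MvPolynomial.mem_symmetricSubalgebra S).2 hS⟩
  have hq2 : MvPolynomial.aeval (fun i : Fin n => MvPolynomial.esymm (Fin n) ℂ (i.1 + 1)) q = S := by
    rw [← MvPolynomial.esymmAlgHom_apply, hq]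
  refine ⟨fun w => MvPolynomial.eval w q, ?_, ?_⟩
  · clear hq hq2
    induction q using MvPolynomial.induction_on with
    | C a => simp
    | add a b ha hb => simp only [map_add]; exact ha.add hb
    | mul_X a i ha => simp only [map_mul, MvPolynomial.eval_X]; exact ha.mul (by fun_prop)
  · intro z
    have e1 : MvPolynomial.eval (piMap n z) q = MvPolynomial.eval z S := by
      rw [← hq2, MvPolynomial.aeval_def, MvPolynomial.eval_eval₂]
      rw [MvPolynomial.eval, MvPolynomial.coe_eval₂Hom]
      congr 1
      · ext x; simp
      · funext i
        simp [piMap, MvPolynomial.esymm]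
    beta_reduce
    rw [e1]
    simp only [S, map_mul, map_prod, MvPolynomial.eval_X, mul_ne_zero_iff, Finset.prod_ne_zero_iff]
    constructor
    · rintro ⟨h1, h2⟩
      refine ⟨fun j => h1 j (mem_univ _), fun i j hij => ?_⟩
      by_contra hne
      apply h2 i (mem_univ _) j (mem_univ _)
      simp [hne, hij]
    · rintro ⟨h1, h2⟩
      refine ⟨fun j _ => h1 j, fun i _ j _ => ?_⟩
      by_cases hij : i = j
      · simp [hij]
      · simpa [hij, sub_eq_zero] using fun h => hij (h2 h)

lemma fderiv_inj_of_rdet {f : (Fin n → ℂ) → (Fin n → ℂ)} {w : Fin n → ℂ} (hf : DifferentiableAt ℂ f w)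
    (h : rdet (jac f w) ≠ 0) : Function.Injective (fderiv ℂ f w) := by
  rw [injective_iff_map_eq_zero]
  intro v hv
  have h1 : Matrix.mulVec (Matrix.of (jac f w)) v = 0 := by
    funext i
    have e : fderiv ℂ f w v i = 0 := by rw [hv]; rfl
    have hc : fderiv ℂ f w v i = fderiv ℂ (fun x => f x i) w v := by
      rw [fderiv_pi (differentiableAt_pi.1 hf)]; rfl
    rw [hc, clm_pi_eq (fderiv ℂ (fun x => f x i) w)] at e
    simp only [FunLike.coe_sum, Finset.sum_apply, smul_apply, ContinuousLinearMap.proj_apply, smul_eq_mul] at e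
    simp only [Matrix.mulVec, dotProduct, Matrix.of_apply, jac, Pi.zero_apply]
    rw [← e]
  exact Matrix.eq_zero_of_mulVec_eq_zero h h1

lemma local_inv {f : (Fin n → ℂ) → (Fin n → ℂ)} {U : Set (Fin n → ℂ)} (hU : IsOpen U) (hf : DifferentiableOn ℂ f U)
    {w : Fin n → ℂ} (hw : w ∈ U) (hi : Function.Injective (fderiv ℂ f w)) :
    ∃ g : (Fin n → ℂ) → (Fin n → ℂ), g (f w) = w ∧ (∀ᶠ y in 𝓝 (f w), DifferentiableAt ℂ g y) ∧
      (∀ᶠ y in 𝓝 (f w), f (g y) = y) ∧ (∀ᶠ x in 𝓝 w, g (f x) = x) ∧ Filter.map f (𝓝 w) = 𝓝 (f w) := by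
  have hbij : Function.Bijective (fderiv ℂ f w : (Fin n → ℂ) →ₗ[ℂ] (Fin n → ℂ)) :=
    ⟨hi, LinearMap.injective_iff_surjective.1 hi⟩
  let e : (Fin n → ℂ) ≃L[ℂ] (Fin n → ℂ) := (LinearEquiv.ofBijective _ hbij).toContinuousLinearEquiv
  have he : (e : (Fin n → ℂ) →L[ℂ] (Fin n → ℂ)) = fderiv ℂ f w := by ext1 x; rfl
  have hc : ContDiffAt ℂ 1 f w := by exact_mod_cast holo_contDiffAt hU hf hw 1
  have hd : HasFDerivAt f (e : (Fin n → ℂ) →L[ℂ] (Fin n → ℂ)) w := by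
    rw [he]; exact (hf.differentiableAt (hU.mem_nhds hw)).hasFDerivAt
  have hs : HasStrictFDerivAt f (e : (Fin n → ℂ) →L[ℂ] (Fin n → ℂ)) w := hc.hasStrictFDerivAt' hd (by norm_num)
  refine ⟨hs.localInverse, hs.localInverse_apply_image, ?_, hs.eventually_right_inverse, hs.eventually_left_inverse, hs.map_nhds_eq_of_equiv⟩
  have := (hc.to_localInverse hd (by norm_num)).eventually (by simp)
  filter_upwards [this] with y hy
  exact hy.differentiableAt (by norm_num)

lemma piMap_fderiv_inj {z : Fin n → ℂ} (hz : Function.Injective z) : Function.Injective (fderiv ℂ (piMap n) z) := by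
  classical
  rw [injective_iff_map_eq_zero]
  intro v hv
  have key : ∀ t : ℂ, ∑ j, (∏ i ∈ univ.erase j, (t + z i)) * v j = 0 := by
    intro t
    have h1 : HasDerivAt (fun s : ℂ => ∏ j, (t + (z j + s * v j))) (∑ j, (∏ i ∈ univ.erase j, (t + z i)) * v j) 0 := by
      have := HasDerivAt.fun_finsetProd (u := univ) (f := fun j (s : ℂ) => t + (z j + s * v j)) (f' := fun j => v j) (x := (0:ℂ))
        (fun j _ => by simpa using (((hasDerivAt_id (0:ℂ)).mul_const (v j)).const_add (z j)).const_add t)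
      simpa using this
    have h2 : HasDerivAt (fun s : ℂ => t ^ n + ∑ k : Fin n, piMap n (z + s • v) k * t ^ (n - 1 - k.1)) 0 0 := by
      have hl : HasDerivAt (fun s : ℂ => z + s • v) v 0 := by
        simpa using ((hasDerivAt_id (0:ℂ)).smul_const v).const_add z
      have hc : HasDerivAt (fun s : ℂ => piMap n (z + s • v)) (fderiv ℂ (piMap n) z v) 0 := by
        have hd := (diff_piMap (n := n) z).hasFDerivAt
        have : z = z + (0:ℂ) • v := by simp
        rw [this] at hd
        have := hd.comp_hasDerivAt (0:ℂ) hl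
        simp only [zero_smul, add_zero] at this
        exact this
      rw [hv] at hc
      have hk : ∀ k : Fin n, HasDerivAt (fun s : ℂ => piMap n (z + s • v) k) 0 0 := fun k => by
        simpa using (hasDerivAt_pi.1 hc) k
      have := (HasDerivAt.fun_sum (u := univ) (fun k _ => (hk k).mul_const (t ^ (n - 1 - k.1)))).const_add (t ^ n)
      simpa using this
    have h3 : (fun s : ℂ => ∏ j, (t + (z j + s * v j))) = (fun s : ℂ => t ^ n + ∑ k : Fin n, piMap n (z + s • v) k * t ^ (n - 1 - k.1)) := by
      funext s
      rw [← piMap_prod]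
      simp
    rw [h3] at h1
    exact h1.unique h2
  funext j
  have h := key (- z j)
  rw [Finset.sum_eq_single j] at h
  · rcases mul_eq_zero.1 h with h | h
    · rw [Finset.prod_eq_zero_iff] at h
      obtain ⟨i, hi, h⟩ := h
      exfalso
      apply (Finset.mem_erase.1 hi).1
      apply hz
      linear_combination h
    · simpa using h
  · intro i _ hij
    rw [Finset.prod_eq_zero (i := j), zero_mul]
    · simp [Ne.symm hij]
    · simp
  · simp

/-- exponential parametrisation -/
noncomputable def Em (p : ℝ) {n : ℕ} (s : Fin n → ℂ) : Fin n → ℂ := piMap n (fun j => Complex.exp (s j / p))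

/-- squared euclidean norm -/
noncomputable def nsq {n : ℕ} (z : Fin n → ℂ) : ℝ := ∑ j, ‖z j‖ ^ 2

/-- coordinatewise exponential -/
noncomputable def cexp {n : ℕ} (z : Fin n → ℂ) : Fin n → ℂ := fun j => Complex.exp (z j)

lemma diff_Em : Differentiable ℂ (Em p (n := n)) := by
  unfold Em
  exact diff_piMap.comp (by fun_prop)

lemma diff_cexp : Differentiable ℂ (cexp (n := n)) := by
  unfold cexp; fun_prop

lemma hasFDerivAt_cexp (s v : Fin n → ℂ) : fderiv ℂ cexp s v = fun j => Complex.exp (s j) * v j := by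
  funext j
  have hc : fderiv ℂ cexp s v j = fderiv ℂ (fun x : Fin n → ℂ => cexp x j) s v := by
    rw [fderiv_pi (differentiableAt_pi.1 (diff_cexp s))]; rfl
  rw [hc]
  have : HasFDerivAt (fun x : Fin n → ℂ => cexp x j) (Complex.exp (s j) • (ContinuousLinearMap.proj (R := ℂ) (φ := fun _ : Fin n => ℂ) j)) s :=
    (ContinuousLinearMap.proj (R := ℂ) (φ := fun _ : Fin n => ℂ) j).hasFDerivAt.cexp
  rw [this.fderiv]
  simp

lemma cexp_fderiv_inj (s : Fin n → ℂ) : Function.Injective (fderiv ℂ cexp s) := by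
  rw [injective_iff_map_eq_zero]
  intro v hv
  rw [hasFDerivAt_cexp] at hv
  funext j
  simpa [Complex.exp_ne_zero] using congrFun hv j

lemma Em_fderiv_inj (hp : 0 < p) {s : Fin n → ℂ} (hs : Function.Injective (fun j => Complex.exp (s j / p))) :
    Function.Injective (fderiv ℂ (Em p) s) := by
  have hpc : (p : ℂ) ≠ 0 := by exact_mod_cast hp.ne'
  have h1 : Em p (n := n) = piMap n ∘ cexp ∘ (fun s => (p:ℂ)⁻¹ • s) := by
    funext s
    simp only [Em, Function.comp_apply]
    congr 1
    funext j
    simp [cexp, div_eq_inv_mul]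
  have h2 : HasFDerivAt (fun s : Fin n → ℂ => (p:ℂ)⁻¹ • s) ((p:ℂ)⁻¹ • ContinuousLinearMap.id ℂ (Fin n → ℂ)) s :=
    HasFDerivAt.fun_const_smul (hasFDerivAt_id s) _
  have h3 : fderiv ℂ (Em p) s = (fderiv ℂ (piMap n) (cexp ((p:ℂ)⁻¹ • s))).comp ((fderiv ℂ cexp ((p:ℂ)⁻¹ • s)).comp ((p:ℂ)⁻¹ • ContinuousLinearMap.id ℂ (Fin n → ℂ))) := by
    rw [h1]
    have h4 := (diff_cexp ((p:ℂ)⁻¹ • s)).hasFDerivAt.comp s h2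
    exact ((diff_piMap (cexp ((p:ℂ)⁻¹ • s))).hasFDerivAt.comp s h4).fderiv
  rw [h3]
  have hc : cexp ((p:ℂ)⁻¹ • s) = fun j => Complex.exp (s j / p) := by
    funext j; simp [cexp, div_eq_inv_mul]
  refine (piMap_fderiv_inj (by rw [hc]; exact hs)).comp ((cexp_fderiv_inj _).comp ?_)
  intro a b hab
  simpa [hpc] using hab

lemma gR_Em (hp : 0 < p) (s : Fin n → ℂ) : gR p (Em p s) = nsq (cexp s) := by
  unfold Em
  rw [gR_piMap]
  unfold rho nsq cexp
  refine Finset.sum_congr rfl fun j _ => ?_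
  rw [Complex.norm_exp, Complex.norm_exp, ← Real.exp_mul, ← Real.exp_nat_mul]
  congr 1
  rw [Complex.div_ofReal_re]
  field_simp
  push_cast; ring

lemma exists_Em (hp : 0 < p) {z : Fin n → ℂ} (hz : ∀ j, z j ≠ 0) : ∃ s : Fin n → ℂ, (fun j => Complex.exp (s j / p)) = z := by
  have hpc : (p : ℂ) ≠ 0 := by exact_mod_cast hp.ne'
  refine ⟨fun j => p * Complex.log (z j), ?_⟩
  funext j
  rw [mul_div_cancel_left₀ _ hpc, Complex.exp_log (hz j)]

lemma bdry_zero (hp : 0 < p) {g : (Fin n → ℂ) → ℂ} {U : Set (Fin n → ℂ)} (hU : IsOpen U) (hg : DifferentiableOn ℂ g U)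
    {w0 : Fin n → ℂ} (hw0 : w0 ∈ U) (h1 : gR p w0 = 1) (h0 : ∀ w ∈ U, gR p w = 1 → g w = 0) : g =ᶠ[𝓝 w0] 0 := by
  have hc : ∀ᶠ q : ℂ × (Fin n → ℂ) in 𝓝 (1, w0), dil q.1 q.2 ∈ U := by
    apply continuous_dil.continuousAt.eventually_mem
    simpa [dil_one] using hU.mem_nhds hw0
  rw [nhds_prod_eq] at hc
  obtain ⟨P, hP, Q, hQ, hPQ⟩ := eventually_prod_iff.1 hc
  obtain ⟨ε, hε, hb⟩ := Metric.eventually_nhds_iff_ball.1 hP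
  have hcont : ContinuousAt (fun w : Fin n → ℂ => (gR p w) ^ (-(1 / (2 * p)))) w0 :=
    (gR_continuous hp).continuousAt.rpow_const (Or.inl (by rw [h1]; norm_num))
  have hε2 : ∀ᶠ w in 𝓝 w0, (gR p w) ^ (-(1 / (2 * p))) ∈ ball (1:ℝ) (ε) := by
    apply hcont
    beta_reduce
    rw [h1, Real.one_rpow]
    exact ball_mem_nhds _ hε
  have hpos : ∀ᶠ w in 𝓝 w0, 0 < gR p w := (gR_continuous hp).continuousAt.eventually_mem (by rw [h1]; exact Ioi_mem_nhds one_pos)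
  filter_upwards [hQ, hε2, hpos] with w hw hwe hwp
  set c : ℝ := (gR p w) ^ (-(1 / (2 * p))) with hcdef
  have hcp : 0 < c := by positivity
  have hcm : (c : ℂ) ∈ ball (1:ℂ) ε := by
    rw [mem_ball, Complex.dist_eq] at *
    rw [Real.dist_eq] at hwe
    rw [← Complex.ofReal_one, ← Complex.ofReal_sub, Complex.norm_real]
    exact hwe
  have hone : c ^ (2 * p) * gR p w = 1 := by
    rw [hcdef, ← Real.rpow_mul hwp.le]
    rw [show -(1 / (2 * p)) * (2 * p) = -1 by field_simp, Real.rpow_neg_one]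
    field_simp
  have hanal : AnalyticOnNhd ℂ (fun l : ℂ => g (dil l w)) (ball (1:ℂ) ε) := by
    apply DifferentiableOn.analyticOnNhd _ isOpen_ball
    refine hg.comp (diff_dil_l w).differentiableOn ?_
    intro l hl
    exact hPQ (hb l hl) hw
  have hz := hanal.eqOn_zero_of_preconnected_of_frequently_eq_zero (convex_ball _ _).isPreconnected hcm ?_
  · have := hz (mem_ball_self hε)
    simpa [dil_one] using this
  · -- on the circle
    have ht : Tendsto (fun θ : ℝ => (c : ℂ) * Complex.exp (θ * Complex.I)) (𝓝[>] 0) (𝓝[≠] (c:ℂ)) := by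
      apply tendsto_nhdsWithin_iff.2
      constructor
      · have : ContinuousAt (fun θ : ℝ => (c : ℂ) * Complex.exp (θ * Complex.I)) 0 := by fun_prop
        have h := this.tendsto
        simp only [Complex.ofReal_zero, zero_mul, Complex.exp_zero, mul_one] at h
        exact h.mono_left nhdsWithin_le_nhds
      · have : ∀ᶠ θ : ℝ in 𝓝[>] 0, θ < 2 * Real.pi := nhdsWithin_le_nhds (Iio_mem_nhds (by positivity))
        filter_upwards [this, self_mem_nhdsWithin] with θ h1 h2 h3
        have h4 : Complex.exp (θ * Complex.I) = 1 := by
          have hc0 : (c:ℂ) ≠ 0 := by exact_mod_cast hcp.ne'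
          have h3' : (c : ℂ) * Complex.exp (θ * Complex.I) = c := h3
          exact mul_left_cancel₀ hc0 (by rw [h3', mul_one])
        rw [Complex.exp_eq_one_iff] at h4
        obtain ⟨k, hk⟩ := h4
        have h5 : θ = k * (2 * Real.pi) := by
          have : (θ : ℂ) = ((k * (2 * Real.pi) : ℝ) : ℂ) := by
            have := mul_right_cancel₀ Complex.I_ne_zero (hk.trans (by ring : (k:ℂ) * (2 * Real.pi * Complex.I) = (k * (2 * Real.pi)) * Complex.I))
            rw [this]; push_cast; ring
          exact_mod_cast this
        have h2' : 0 < θ := h2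
        have hpi := Real.pi_pos
        have hk0 : (0:ℝ) < k := by
          by_contra hn; push Not at hn; nlinarith
        have hk1 : (k:ℝ) < 1 := by
          by_contra hn; push Not at hn; nlinarith
        have a1 : 0 < k := by exact_mod_cast hk0
        have a2 : k < 1 := by exact_mod_cast hk1
        omega
    refine ht.frequently (Eventually.frequently ?_)
    have hin : ∀ᶠ θ : ℝ in 𝓝[>] 0, (c : ℂ) * Complex.exp (θ * Complex.I) ∈ ball (1:ℂ) ε := 
      ht.eventually (nhdsWithin_le_nhds (isOpen_ball.mem_nhds hcm))
    filter_upwards [hin] with θ hθ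
    apply h0 _ (hPQ (hb _ hθ) hw)
    rw [gR_dil hp, norm_mul, Complex.norm_exp_ofReal_mul_I, mul_one, Complex.norm_real, Real.norm_of_nonneg hcp.le, hone]
end
end

section
open MeasureTheory Metric Filter Topology
open Finset
open scoped ContDiff

section
variable {n : ℕ} {p : ℝ} {D : Set (Fin n → ℂ)}

lemma fderiv_inj_right {f g h : (Fin n → ℂ) → (Fin n → ℂ)} {x : Fin n → ℂ} (hg : DifferentiableAt ℂ g x)
    (hf : DifferentiableAt ℂ f (g x)) (he : (fun y => f (g y)) =ᶠ[𝓝 x] h) (hi : Function.Injective (fderiv ℂ h x)) :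
    Function.Injective (fderiv ℂ g x) := by
  have h1 : fderiv ℂ h x = (fderiv ℂ f (g x)).comp (fderiv ℂ g x) := by
    rw [← he.fderiv_eq]
    exact fderiv_comp x hf hg
  rw [h1] at hi
  intro a b hab
  apply hi
  simp [hab]

lemma fderiv_inj_comp {f g : (Fin n → ℂ) → (Fin n → ℂ)} {x : Fin n → ℂ} (hg : DifferentiableAt ℂ g x)
    (hf : DifferentiableAt ℂ f (g x)) (hi : Function.Injective (fderiv ℂ f (g x))) (hi2 : Function.Injective (fderiv ℂ g x)) :
    Function.Injective (fderiv ℂ (fun y => f (g y)) x) := by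
  have h1 : fderiv ℂ (fun y => f (g y)) x = (fderiv ℂ f (g x)).comp (fderiv ℂ g x) := fderiv_comp x hf hg
  rw [h1]
  exact hi.comp hi2

lemma exists_bdry (hp : 0 < p) (hn : 1 ≤ n) : ∃ w : Fin n → ℂ, gR p w = 1 := by
  have h1 : gR p (piMap n (fun _ => (1:ℂ))) = n := by
    rw [gR_piMap]; simp [rho]
  have hn' : (0:ℝ) < n := by exact_mod_cast hn
  refine ⟨dil (((n:ℝ) ^ (-(1 / (2 * p))) : ℝ) : ℂ) (piMap n (fun _ => (1:ℂ))), ?_⟩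
  rw [gR_dil hp, h1, Complex.norm_real, Real.norm_of_nonneg (by positivity), ← Real.rpow_mul hn'.le,
    show -(1 / (2 * p)) * (2 * p) = -1 by field_simp, Real.rpow_neg_one]
  field_simp

lemma exists_distinct (n : ℕ) : ∃ z : Fin n → ℂ, (∀ j, z j ≠ 0) ∧ Function.Injective z := by
  refine ⟨fun j => ((j.1 + 1 : ℕ) : ℂ), fun j => Nat.cast_ne_zero.2 (Nat.succ_ne_zero _), fun i j h => ?_⟩
  beta_reduce at h
  have : i.1 + 1 = j.1 + 1 := by exact_mod_cast h
  ext; omega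

lemma not_ev_zero {A : (Fin n → ℂ) → ℂ} (hA : Differentiable ℂ A)
    (hA2 : ∀ z, A (piMap n z) ≠ 0 ↔ ((∀ j, z j ≠ 0) ∧ Function.Injective z)) (w : Fin n → ℂ) (h : A =ᶠ[𝓝 w] 0) : False := by
  have := holo_identity isOpen_univ isPreconnected_univ hA.differentiableOn (Set.mem_univ w) h
  obtain ⟨z, hz⟩ := exists_distinct n
  exact (hA2 z).2 hz (this _ (Set.mem_univ _))

/-- radial approach -/
lemma dil_tendsto (w : Fin n → ℂ) : Tendsto (fun s : ℝ => dil (s : ℂ) w) (𝓝[<] 1) (𝓝 w) := by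
  have h : ContinuousAt (fun s : ℝ => dil (s : ℂ) w) 1 := by
    have h1 : Continuous (fun s : ℝ => ((s:ℂ), w)) := by fun_prop
    exact (continuous_dil.comp h1).continuousAt
  have h2 := h.tendsto
  simp only [Complex.ofReal_one, dil_one] at h2
  exact h2.mono_left nhdsWithin_le_nhds

lemma dil_in (hp : 0 < p) {w : Fin n → ℂ} (hw : gR p w = 1) : ∀ᶠ s : ℝ in 𝓝[<] 1, gR p (dil (s:ℂ) w) < 1 := by
  have : ∀ᶠ s : ℝ in 𝓝[<] 1, 0 < s := nhdsWithin_le_nhds (Ioi_mem_nhds one_pos)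
  filter_upwards [this, self_mem_nhdsWithin] with s h1 h2
  have h2' : s < 1 := h2
  rw [gR_dil hp, hw, mul_one, Complex.norm_real, Real.norm_of_nonneg h1.le]
  exact Real.rpow_lt_one h1.le h2' (by positivity)

lemma jac_congr {f g : (Fin n → ℂ) → (Fin n → ℂ)} {w : Fin n → ℂ} (h : f =ᶠ[𝓝 w] g) : jac f w = jac g w := by
  funext i k
  unfold jac
  have : (fun x => f x i) =ᶠ[𝓝 w] (fun x => g x i) := by
    filter_upwards [h] with x hx; rw [hx]
  rw [this.fderiv_eq]

/-- a good boundary point -/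
lemma good_point (hp : 0 < p) (hn : 1 ≤ n) {f : (Fin n → ℂ) → (Fin n → ℂ)} (hDe : D = {w | gR p w < 1})
    (hf : IsProperHolomorphic f D D) : ∃ (w2 : Fin n → ℂ) (ft : (Fin n → ℂ) → (Fin n → ℂ)) (U : Set (Fin n → ℂ)),
    IsOpen U ∧ w2 ∈ U ∧ gR p w2 = 1 ∧ DifferentiableOn ℂ ft U ∧ (∀ w ∈ U, gR p w < 1 → ft w = f w) ∧
    (∀ w ∈ U, gR p w = 1 → gR p (ft w) = 1) ∧ (∀ w ∈ U, Function.Injective (fderiv ℂ ft w)) ∧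
    (∀ z, piMap n z ∈ U → (∀ j, z j ≠ 0) ∧ Function.Injective z) ∧
    (∀ z, piMap n z = ft w2 → (∀ j, z j ≠ 0) ∧ Function.Injective z) := by
  obtain ⟨A, hA, hA2⟩ := disc_exists n
  obtain ⟨t, ht, J, F, hJ, hF, hJe, hFe⟩ := exists_extension hp hn hDe hf
  set Ut := {w : Fin n → ℂ | gR p w < t} with hUt
  have hUo : IsOpen Ut := gR_open hp t
  have hDo : IsOpen D := hDe ▸ gR_open hp 1
  have hDU : D ⊆ Ut := by
    intro w hw; rw [hDe] at hw
    exact lt_trans (show gR p w < 1 from hw) ht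
  have hDne : D.Nonempty := ⟨0, by rw [hDe]; change gR p 0 < 1; rw [gR_zero hp]; exact one_pos⟩
  have hbU : ∀ w, gR p w = 1 → w ∈ Ut := fun w hw => by change gR p w < t; rw [hw]; exact ht
  have c1 : ∃ w1, gR p w1 = 1 ∧ J w1 ≠ 0 ∧ A w1 ≠ 0 := by
    by_contra hcon
    push Not at hcon
    obtain ⟨w0, hw0⟩ := exists_bdry (n := n) hp hn
    have hz : (fun w => J w * A w) =ᶠ[𝓝 w0] 0 := by
      refine bdry_zero hp hUo (hJ.mul hA.differentiableOn) (hbU _ hw0) hw0 ?_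
      intro w _ hw1
      by_cases h : J w = 0
      · simp [h]
      · simp [hcon w hw1 h]
    have hall := holo_identity hUo (gR_preconn hp t) (hJ.mul hA.differentiableOn) (hbU _ hw0) hz
    obtain ⟨z, hzD, hz⟩ := jac_ne_zero hDo hDne hf
    rw [← hJe z hzD] at hz
    have hJc : ∀ᶠ w in 𝓝 z, J w ≠ 0 := (hJ.continuousOn.continuousAt (hUo.mem_nhds (hDU hzD))).eventually_ne hz
    refine not_ev_zero hA hA2 z ?_
    filter_upwards [hJc, hUo.mem_nhds (hDU hzD)] with w h1 h2
    have := hall w h2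
    simpa [h1] using this
  obtain ⟨w1, hw1, hJ1, hA1⟩ := c1
  set U2 := {w | w ∈ Ut ∧ J w * A w ≠ 0} with hU2
  have hU2o : IsOpen U2 := by
    have : U2 = Ut ∩ (fun w => J w * A w) ⁻¹' {0}ᶜ := by ext w; rfl
    rw [this]
    exact (hJ.mul hA.differentiableOn).continuousOn.isOpen_inter_preimage hUo isOpen_compl_singleton
  have hU2J : ∀ w ∈ U2, J w ≠ 0 := fun w hw => left_ne_zero_of_mul hw.2
  have hU2A : ∀ w ∈ U2, A w ≠ 0 := fun w hw => right_ne_zero_of_mul hw.2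
  have hU2t : U2 ⊆ Ut := fun w hw => hw.1
  set ft : (Fin n → ℂ) → (Fin n → ℂ) := fun w k => F k w / J w with hft
  have hftd : DifferentiableOn ℂ ft U2 := by
    rw [differentiableOn_pi]
    intro k
    have e : (fun w => ft w k) = fun w => F k w * (J w)⁻¹ := by funext w; simp [hft, div_eq_mul_inv]
    rw [e]
    exact ((hF k).mono hU2t).mul ((hJ.mono hU2t).fun_inv hU2J)
  have hftf : ∀ w ∈ U2, gR p w < 1 → ft w = f w := by
    intro w hw h
    have hwD : w ∈ D := by rw [hDe]; exact h
    funext k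
    simp only [hft]
    rw [hFe k w hwD, ← hJe w hwD, mul_div_cancel_left₀ _ (hU2J w hw)]
  have hftf' : ∀ w ∈ U2, gR p w < 1 → ft =ᶠ[𝓝 w] f := by
    intro w hw h
    filter_upwards [hU2o.mem_nhds hw, (gR_open hp 1).mem_nhds h] with x h1 h2
    exact hftf x h1 h2
  have hb : ∀ w ∈ U2, gR p w = 1 → gR p (ft w) = 1 := by
    intro w hw h1
    have ht1 : Tendsto (fun s : ℝ => ft (dil (s:ℂ) w)) (𝓝[<] 1) (𝓝 (ft w)) :=
      (hftd.continuousOn.continuousAt (hU2o.mem_nhds hw)).tendsto.comp (dil_tendsto w)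
    have hev : ∀ᶠ s : ℝ in 𝓝[<] 1, gR p (dil (s:ℂ) w) < 1 ∧ ft (dil (s:ℂ) w) = f (dil (s:ℂ) w) := by
      filter_upwards [dil_in hp h1, (dil_tendsto w).eventually (hU2o.mem_nhds hw)] with s h2 h3
      exact ⟨h2, hftf _ h3 h2⟩
    have hle : gR p (ft w) ≤ 1 := by
      refine le_of_tendsto (((gR_continuous hp).tendsto _).comp ht1) ?_
      filter_upwards [hev] with s hs
      have hm := hf.2.1 (show dil (s:ℂ) w ∈ D by rw [hDe]; exact hs.1)
      rw [hDe] at hm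
      simp only [Function.comp]
      rw [hs.2]
      exact le_of_lt (show gR p _ < 1 from hm)
    refine le_antisymm hle (not_lt.1 fun hlt => ?_)
    obtain ⟨c, hc1, hc2⟩ := exists_between hlt
    have hK := hf.2.2 {y | gR p y ≤ c} (by
      intro y hy; rw [hDe]; exact lt_of_le_of_lt (show gR p y ≤ c from hy) hc2) (gR_compact hp c)
    have hmem : w ∈ D ∩ f ⁻¹' {y | gR p y ≤ c} := by
      refine hK.isClosed.mem_of_tendsto (dil_tendsto w) ?_
      have : ∀ᶠ s : ℝ in 𝓝[<] 1, gR p (ft (dil (s:ℂ) w)) < c :=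
        (((gR_continuous hp).tendsto _).comp ht1).eventually (Iio_mem_nhds hc1)
      filter_upwards [hev, this] with s hs hs2
      refine ⟨by rw [hDe]; exact hs.1, ?_⟩
      rw [hs.2] at hs2
      exact hs2.le
    have := hmem.1
    rw [hDe] at this
    exact absurd h1 (ne_of_lt (show gR p w < 1 from this))
  have hw1U : w1 ∈ U2 := ⟨hbU _ hw1, mul_ne_zero hJ1 hA1⟩
  have c2 : ∃ w2 ∈ U2, gR p w2 = 1 ∧ A (ft w2) ≠ 0 := by
    by_contra hcon
    push Not at hcon
    have hz : (fun w => A (ft w)) =ᶠ[𝓝 w1] 0 :=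
      bdry_zero hp hU2o (hA.differentiableOn.comp hftd (Set.mapsTo_univ _ _)) hw1U hw1 hcon
    have hev := (dil_tendsto w1).eventually (hz.eventually_nhds)
    obtain ⟨s, hs1, hs2, hs3⟩ := ((hev.and ((dil_in hp hw1).and ((dil_tendsto w1).eventually (hU2o.mem_nhds hw1U)))).exists)
    set w3 := dil (s:ℂ) w1
    have h3D : w3 ∈ D := by rw [hDe]; exact hs2
    have hi : Function.Injective (fderiv ℂ f w3) :=
      fderiv_inj_of_rdet (hf.1.differentiableAt (hDo.mem_nhds h3D)) (by rw [← hJe _ h3D]; exact hU2J _ hs3)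
    obtain ⟨g, -, -, -, -, hmap⟩ := local_inv hDo hf.1 h3D hi
    refine not_ev_zero hA hA2 (f w3) ?_
    change ∀ᶠ y in 𝓝 (f w3), A y = 0
    rw [← hmap, Filter.eventually_map]
    filter_upwards [hs1, hftf' w3 hs3 hs2] with x hx1 hx2
    rw [← hx2]; exact hx1
  obtain ⟨w2, hw2U, hw2, hA3⟩ := c2
  obtain ⟨r, hr, hrU⟩ := Metric.isOpen_iff.1 hU2o w2 hw2U
  have hdet : ∀ w ∈ ball w2 r, rdet (jac ft w) - J w = 0 := by
    obtain ⟨s, hs1, hs2⟩ := ((dil_in hp hw2).and ((dil_tendsto w2).eventually (ball_mem_nhds w2 hr))).exists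
    refine holo_identity (f := fun w => rdet (jac ft w) - J w) isOpen_ball (convex_ball _ _).isPreconnected
      ((rdet_contDiffOn isOpen_ball (hftd.mono hrU)).sub (hJ.mono (hrU.trans hU2t))) hs2 ?_
    filter_upwards [isOpen_ball.mem_nhds hs2, (gR_open hp 1).mem_nhds hs1] with x hx1 hx2
    have hxD : x ∈ D := by rw [hDe]; exact hx2
    change rdet (jac ft x) - J x = 0
    rw [jac_congr (hftf' x (hrU hx1) hx2), hJe x hxD, sub_self]
  refine ⟨w2, ft, ball w2 r, isOpen_ball, mem_ball_self hr, hw2, hftd.mono hrU, fun w hw => hftf w (hrU hw),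
    fun w hw => hb w (hrU hw), ?_, ?_, ?_⟩
  · intro w hw
    refine fderiv_inj_of_rdet ((hftd.mono hrU).differentiableAt (isOpen_ball.mem_nhds hw)) ?_
    rw [sub_eq_zero.1 (hdet w hw)]
    exact hU2J w (hrU hw)
  · intro z hz
    exact (hA2 z).1 (hU2A _ (hrU hz))
  · intro z hz
    exact (hA2 z).1 (by rw [hz]; exact hA3)

theorem loc_exists (hp : 0 < p) (hn : 1 ≤ n) {f : (Fin n → ℂ) → (Fin n → ℂ)} (hDe : D = {w | gR p w < 1})
    (hf : IsProperHolomorphic f D D) : ∃ (ζ2 : Fin n → ℂ) (r : ℝ) (H lg : (Fin n → ℂ) → (Fin n → ℂ)), 0 < r ∧ nsq ζ2 = 1 ∧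
    DifferentiableOn ℂ H (ball ζ2 r) ∧ DifferentiableOn ℂ lg (ball ζ2 r) ∧ ∀ ζ ∈ ball ζ2 r, cexp (lg ζ) = ζ ∧
      Function.Injective (fderiv ℂ (fun y => cexp (H y)) ζ) ∧ (nsq ζ < 1 → f (Em p (lg ζ)) = Em p (H ζ)) ∧
      (nsq ζ = 1 → nsq (cexp (H ζ)) = 1) := by
  obtain ⟨w2, ft, U, hU, hwU, hw2, hftd, hftf, hftb, hfti, hUA, hwA⟩ := good_point hp hn hDe hf
  obtain ⟨s2, hs2⟩ := exists_Em hp (hUA (rts w2) (by rwa [piMap_rts])).1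
  obtain ⟨σ2, hσ2⟩ := exists_Em hp (hwA (rts (ft w2)) (piMap_rts _)).1
  have hs2' : Em p s2 = w2 := by unfold Em; rw [hs2, piMap_rts]
  have hσ2' : Em p σ2 = ft w2 := by unfold Em; rw [hσ2, piMap_rts]
  have hinj : ∀ s, Em p s ∈ U → Function.Injective (fderiv ℂ (Em p) s) := by
    intro s hs
    exact Em_fderiv_inj hp (hUA _ hs).2
  have hinjσ : Function.Injective (fderiv ℂ (Em p) σ2) := Em_fderiv_inj hp (by rw [hσ2]; exact (hwA _ (piMap_rts _)).2)
  obtain ⟨g, hg1, hg2, hg3, -, -⟩ := local_inv isOpen_univ (diff_Em (p := p)).differentiableOn (Set.mem_univ σ2) hinjσ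
  obtain ⟨lg, hl1, hl2, hl3, -, -⟩ := local_inv isOpen_univ (diff_cexp (n := n)).differentiableOn (Set.mem_univ s2) (cexp_fderiv_inj s2)
  set ζ2 := cexp s2 with hζ2
  rw [hσ2'] at hg1 hg2 hg3
  have hlc : ContinuousAt lg ζ2 := hl2.self_of_nhds.continuousAt
  have hEc : ContinuousAt (fun ζ => Em p (lg ζ)) ζ2 := (diff_Em (p := p)).continuous.continuousAt.comp hlc
  have hE2 : Em p (lg ζ2) = w2 := by rw [hl1, hs2']
  have hUev : ∀ᶠ ζ in 𝓝 ζ2, Em p (lg ζ) ∈ U := hEc.eventually_mem (by rw [hE2]; exact hU.mem_nhds hwU)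
  have hfc : ContinuousAt (fun ζ => ft (Em p (lg ζ))) ζ2 := by
    have h := hftd.continuousOn.continuousAt (hU.mem_nhds hwU)
    rw [← hE2] at h
    exact ContinuousAt.comp (g := ft) (f := fun ζ => Em p (lg ζ)) h hEc
  have hf2 : ft (Em p (lg ζ2)) = ft w2 := by rw [hE2]
  have hgd : ∀ᶠ ζ in 𝓝 ζ2, DifferentiableAt ℂ g (ft (Em p (lg ζ))) := hfc.eventually (by beta_reduce; rw [hf2]; exact hg2)
  have hge : ∀ᶠ ζ in 𝓝 ζ2, Em p (g (ft (Em p (lg ζ)))) = ft (Em p (lg ζ)) := hfc.eventually (p := fun y => Em p (g y) = y) (by beta_reduce; rw [hf2]; exact hg3)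
  have hall := hl2.and (hl3.eventually_nhds.and (hUev.and (hgd.and hge.eventually_nhds)))
  obtain ⟨r, hr, hb⟩ := Metric.eventually_nhds_iff_ball.1 hall
  have hH : ∀ ζ ∈ ball ζ2 r, DifferentiableAt ℂ (fun ζ => ft (Em p (lg ζ))) ζ := by
    intro ζ hζ
    obtain ⟨h1, h2, h3, h4, h5⟩ := hb ζ hζ
    exact DifferentiableAt.comp (g := ft) (f := fun ζ => Em p (lg ζ)) ζ (hftd.differentiableAt (hU.mem_nhds h3)) ((diff_Em _).comp ζ h1)
  have hH2 : ∀ ζ ∈ ball ζ2 r, DifferentiableAt ℂ (fun ζ => g (ft (Em p (lg ζ)))) ζ := by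
    intro ζ hζ
    obtain ⟨h1, h2, h3, h4, h5⟩ := hb ζ hζ
    exact DifferentiableAt.comp (g := g) (f := fun ζ => ft (Em p (lg ζ))) ζ h4 (hH ζ hζ)
  have hns : ∀ ζ ∈ ball ζ2 r, gR p (Em p (lg ζ)) = nsq ζ := by
    intro ζ hζ
    obtain ⟨h1, h2, h3, h4, h5⟩ := hb ζ hζ
    rw [gR_Em hp, h2.self_of_nhds]
  refine ⟨ζ2, r, fun ζ => g (ft (Em p (lg ζ))), lg, hr, ?_, fun ζ hζ => (hH2 ζ hζ).differentiableWithinAt, 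
    fun ζ hζ => (hb ζ hζ).1.differentiableWithinAt, ?_⟩
  · rw [hζ2, ← gR_Em hp, hs2', hw2]
  · intro ζ hζ
    obtain ⟨h1, h2, h3, h4, h5⟩ := hb ζ hζ
    refine ⟨h2.self_of_nhds, ?_, ?_, ?_⟩
    · have hli : Function.Injective (fderiv ℂ lg ζ) :=
        fderiv_inj_right (h := fun y => y) h1 (diff_cexp _) h2 (by
          have : fderiv ℂ (fun y : Fin n → ℂ => y) ζ = ContinuousLinearMap.id ℂ _ := fderiv_id
          rw [this]; exact fun a b h => h)
      have hEi : Function.Injective (fderiv ℂ (fun y => Em p (lg y)) ζ) :=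
        fderiv_inj_comp h1 (diff_Em _) (hinj _ h3) hli
      have hfi : Function.Injective (fderiv ℂ (fun y => ft (Em p (lg y))) ζ) :=
        fderiv_inj_comp (f := ft) (g := fun y => Em p (lg y)) ((diff_Em _).comp ζ h1) (hftd.differentiableAt (hU.mem_nhds h3)) (hfti _ h3) hEi
      have hHi : Function.Injective (fderiv ℂ (fun ζ => g (ft (Em p (lg ζ)))) ζ) :=
        fderiv_inj_right (f := Em p) (hH2 ζ hζ) (diff_Em _) h5 hfi
      exact fderiv_inj_comp (hH2 ζ hζ) (diff_cexp _) (cexp_fderiv_inj _) hHi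
    · intro hlt
      have h6 : Em p (g (ft (Em p (lg ζ)))) = ft (Em p (lg ζ)) := h5.self_of_nhds
      rw [h6, hftf _ h3 (by rw [hns ζ hζ]; exact hlt)]
    · intro he
      have h6 : Em p (g (ft (Em p (lg ζ)))) = ft (Em p (lg ζ)) := h5.self_of_nhds
      rw [← gR_Em hp, h6]
      exact hftb _ h3 (by rw [hns ζ hζ]; exact he)
end
end

section
open MeasureTheory Metric Filter Topology
open Finset
open scoped ContDiff ComplexConjugate

section
variable {n : ℕ}

/-- hermitian product -/
noncomputable def ip {n : ℕ} (z w : Fin n → ℂ) : ℂ := ∑ j, z j * conj (w j)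

lemma ip_add_left (a b w : Fin n → ℂ) : ip (a + b) w = ip a w + ip b w := by
  simp [ip, add_mul, Finset.sum_add_distrib]
lemma ip_sub_left (a b w : Fin n → ℂ) : ip (a - b) w = ip a w - ip b w := by
  simp [ip, sub_mul, Finset.sum_sub_distrib]
lemma ip_smul_left (c : ℂ) (a w : Fin n → ℂ) : ip (c • a) w = c * ip a w := by
  simp [ip, mul_assoc, Finset.mul_sum]
lemma ip_conj (a b : Fin n → ℂ) : conj (ip a b) = ip b a := by
  simp [ip, map_sum, mul_comm]
lemma ip_add_right (a b w : Fin n → ℂ) : ip w (a + b) = ip w a + ip w b := by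
  simp [ip, mul_add, Finset.sum_add_distrib]
lemma ip_sub_right (a b w : Fin n → ℂ) : ip w (a - b) = ip w a - ip w b := by
  simp [ip, mul_sub, Finset.sum_sub_distrib]
lemma ip_smul_right (c : ℂ) (a w : Fin n → ℂ) : ip w (c • a) = conj c * ip w a := by
  simp only [ip, Pi.smul_apply, smul_eq_mul, map_mul, Finset.mul_sum]
  exact Finset.sum_congr rfl fun j _ => by ring
lemma ip_self (a : Fin n → ℂ) : ip a a = (nsq a : ℂ) := by
  simp [ip, nsq, Complex.mul_conj, Complex.normSq_eq_norm_sq]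
lemma ip_zero_left (w : Fin n → ℂ) : ip 0 w = 0 := by simp [ip]
lemma ip_zero_right (w : Fin n → ℂ) : ip w 0 = 0 := by simp [ip]
lemma nsq_nonneg (a : Fin n → ℂ) : 0 ≤ nsq a := by unfold nsq; positivity
lemma nsq_eq_zero {a : Fin n → ℂ} (h : nsq a = 0) : a = 0 := by
  unfold nsq at h
  rw [Finset.sum_eq_zero_iff_of_nonneg (fun _ _ => by positivity)] at h
  funext j
  simpa using h j (mem_univ _)
lemma continuous_nsq : Continuous (nsq (n := n)) := by unfold nsq; fun_prop
lemma nsq_smul (c : ℂ) (a : Fin n → ℂ) : nsq (c • a) = ‖c‖ ^ 2 * nsq a := by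
  simp [nsq, mul_pow, Finset.mul_sum]
lemma ip_diff (w : Fin n → ℂ) : Differentiable ℂ (fun z => ip z w) := by unfold ip; fun_prop
lemma ip_single (j : Fin n) (w : Fin n → ℂ) : ip w (Pi.single j 1) = w j := by
  classical
  simp [ip, Pi.single_apply, apply_ite]

/-- accumulation of the circle at a positive real -/
lemma circle_frequently {c : ℝ} (hcp : 0 < c) {P : ℂ → Prop} (h : ∀ᶠ z in 𝓝 (c:ℂ), ‖z‖ = c → P z) : ∃ᶠ z in 𝓝[≠] (c:ℂ), P z := by
  have ht : Tendsto (fun θ : ℝ => (c : ℂ) * Complex.exp (θ * Complex.I)) (𝓝[>] 0) (𝓝[≠] (c:ℂ)) := by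
    apply tendsto_nhdsWithin_iff.2
    constructor
    · have : ContinuousAt (fun θ : ℝ => (c : ℂ) * Complex.exp (θ * Complex.I)) 0 := by fun_prop
      have h := this.tendsto
      simp only [Complex.ofReal_zero, zero_mul, Complex.exp_zero, mul_one] at h
      exact h.mono_left nhdsWithin_le_nhds
    · have : ∀ᶠ θ : ℝ in 𝓝[>] 0, θ < 2 * Real.pi := nhdsWithin_le_nhds (Iio_mem_nhds (by positivity))
      filter_upwards [this, self_mem_nhdsWithin] with θ h1 h2 h3
      have h4 : Complex.exp (θ * Complex.I) = 1 := by
        have hc0 : (c:ℂ) ≠ 0 := by exact_mod_cast hcp.ne'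
        have h3' : (c : ℂ) * Complex.exp (θ * Complex.I) = c := h3
        exact mul_left_cancel₀ hc0 (by rw [h3', mul_one])
      rw [Complex.exp_eq_one_iff] at h4
      obtain ⟨k, hk⟩ := h4
      have h5 : θ = k * (2 * Real.pi) := by
        have : (θ : ℂ) = ((k * (2 * Real.pi) : ℝ) : ℂ) := by
          have := mul_right_cancel₀ Complex.I_ne_zero (hk.trans (by ring : (k:ℂ) * (2 * Real.pi * Complex.I) = (k * (2 * Real.pi)) * Complex.I))
          rw [this]; push_cast; ring
        exact_mod_cast this
      have h2' : 0 < θ := h2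
      have hpi := Real.pi_pos
      have hk0 : (0:ℝ) < k := by
        by_contra hn; push Not at hn; nlinarith
      have hk1 : (k:ℝ) < 1 := by
        by_contra hn; push Not at hn; nlinarith
      have a1 : 0 < k := by exact_mod_cast hk0
      have a2 : k < 1 := by exact_mod_cast hk1
      omega
  refine ht.frequently (Eventually.frequently ?_)
  have := ht.eventually (nhdsWithin_le_nhds h)
  filter_upwards [this] with θ hθ
  apply hθ
  rw [norm_mul, Complex.norm_exp_ofReal_mul_I, mul_one, Complex.norm_real, Real.norm_of_nonneg hcp.le]

lemma line_mem_ball {c a b : Fin n → ℂ} {r x y s : ℝ} (hx : a + (x:ℂ) • b ∈ ball c r) (hy : a + (y:ℂ) • b ∈ ball c r)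
    (h1 : x ≤ s) (h2 : s ≤ y) : a + (s:ℂ) • b ∈ ball c r := by
  have hconv : Convex ℝ {t : ℝ | a + (t:ℂ) • b ∈ ball c r} := by
    have : {t : ℝ | a + (t:ℂ) • b ∈ ball c r} = (AffineMap.lineMap a (a + b) : ℝ →ᵃ[ℝ] (Fin n → ℂ)) ⁻¹' ball c r := by
      ext t
      simp [AffineMap.lineMap_apply, add_comm]
    rw [this]
    exact (convex_ball c r).affine_preimage _
  exact hconv.ordConnected.out hx hy ⟨h1, h2⟩

lemma incidence {F : (Fin n → ℂ) → (Fin n → ℂ)} {c : Fin n → ℂ} {r : ℝ} (hF : DifferentiableOn ℂ F (ball c r))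
    (hS : ∀ ζ ∈ ball c r, nsq ζ = 1 → nsq (F ζ) = 1) {z w : Fin n → ℂ} (hz : z ∈ ball c r) (hw : w ∈ ball c r)
    (hz1 : nsq z < 1) (hzw : ip z w = 1) : ip (F z) (F w) = 1 := by
  have hwz : ip w z = 1 := by rw [← ip_conj, hzw, map_one]
  have hsub : nsq (z - w) = nsq z + nsq w - 2 := by
    have : ((nsq (z - w) : ℝ) : ℂ) = ((nsq z + nsq w - 2 : ℝ) : ℂ) := by
      rw [← ip_self]
      simp only [ip_sub_left, ip_sub_right, hzw, hwz]
      rw [ip_self, ip_self]; push_cast; ring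
    exact_mod_cast this
  have hpos : 0 < nsq (z - w) := by
    refine lt_of_le_of_ne (nsq_nonneg _) fun h => ?_
    have h1 := sub_eq_zero.1 (nsq_eq_zero h.symm)
    rw [← h1, ip_self] at hzw
    have : nsq z = 1 := by exact_mod_cast hzw
    linarith
  set α := 1 - nsq z with hα
  set β := nsq w - 1 with hβ
  have hα0 : 0 < α := by linarith
  have hβα : α < β := by linarith
  have hβ0 : 0 < β := by linarith
  set l := Real.sqrt (α / β) with hl
  have hl0 : 0 < l := Real.sqrt_pos.2 (by positivity)
  have hl2 : l ^ 2 * β = α := by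
    rw [hl, Real.sq_sqrt (by positivity)]; field_simp
  have hl1 : l < 1 := by
    by_contra h; push Not at h
    have : 1 ≤ l ^ 2 := one_le_pow₀ h
    nlinarith
  have hlc : (l:ℂ) ≠ 0 := by exact_mod_cast hl0.ne'
  have hd : (l:ℂ) ^ 2 - 1 ≠ 0 := by
    have : (l ^ 2 - 1 : ℝ) ≠ 0 := by nlinarith
    exact_mod_cast this
  set b : Fin n → ℂ := ((l:ℂ) / (l ^ 2 - 1)) • (z - w) with hb
  set a : Fin n → ℂ := z - (l:ℂ) • b with ha
  have hza : a + (l:ℂ) • b = z := by rw [ha]; abel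
  have hwa : a + ((1 / l : ℝ) : ℂ) • b = w := by
    have : ((1 / l : ℝ) : ℂ) • b - (l:ℂ) • b = w - z := by
      rw [hb, ← sub_smul, smul_smul]
      have : (((1 / l : ℝ) : ℂ) - l) * (l / (l ^ 2 - 1)) = -1 := by
        push_cast; field_simp; ring
      rw [this]; simp
    rw [ha]
    calc z - (l:ℂ) • b + ((1 / l : ℝ) : ℂ) • b = z + (((1 / l : ℝ) : ℂ) • b - (l:ℂ) • b) := by abel
      _ = w := by rw [this]; abel
  have hlβ : (l:ℂ) ^ 2 * ((nsq w : ℂ) - 1) = 1 - (nsq z : ℂ) := by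
    have : ((l ^ 2 * β : ℝ) : ℂ) = ((α : ℝ) : ℂ) := by rw [hl2]
    rw [hβ, hα] at this
    push_cast at this; exact this
  have hconjl : conj (l:ℂ) = l := Complex.conj_ofReal l
  have hcl2 : conj ((l:ℂ) / (l ^ 2 - 1)) = (l:ℂ) / (l ^ 2 - 1) := by simp
  have hab : ip a b = 0 := by
    rw [ha, hb]
    simp only [ip_sub_left, ip_sub_right, ip_smul_left, ip_smul_right, hzw, hwz, hcl2, ip_self]
    field_simp
    linear_combination (-(l:ℂ)) * hlβ
  have hba : ip b a = 0 := by rw [← ip_conj, hab, map_zero]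
  have hone : ip a a + ip b b = 1 := by
    have h1 : ip (a + (l:ℂ) • b) (a + ((1 / l : ℝ) : ℂ) • b) = 1 := by rw [hza, hwa, hzw]
    simp only [ip_add_left, ip_add_right, ip_smul_left, ip_smul_right, hab, hba, Complex.conj_ofReal] at h1
    push_cast at h1
    field_simp at h1
    exact mul_left_cancel₀ hlc (by linear_combination h1)
  have hcirc : ∀ s : ℂ, ‖s‖ = 1 → nsq (a + s • b) = 1 := by
    intro s hs
    have : ((nsq (a + s • b) : ℝ) : ℂ) = 1 := by
      rw [← ip_self]
      simp only [ip_add_left, ip_add_right, ip_smul_left, ip_smul_right, hab, hba]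
      have : s * conj s = 1 := by rw [Complex.mul_conj, Complex.normSq_eq_norm_sq, hs]; simp
      linear_combination hone + this * ip b b
    exact_mod_cast this
  -- domain
  set Ω : Set ℂ := {s | s ≠ 0 ∧ a + s • b ∈ ball c r ∧ a + (conj s)⁻¹ • b ∈ ball c r} with hΩ
  have hline : Continuous (fun s : ℂ => a + s • b) := by fun_prop
  have hcont2 : ContinuousOn (fun s : ℂ => a + (conj s)⁻¹ • b) {0}ᶜ := by
    apply hline.comp_continuousOn
    apply ContinuousOn.inv₀ Complex.continuous_conj.continuousOn
    intro s hs; simpa using hs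
  have hΩo : IsOpen Ω := by
    have : Ω = ((fun s : ℂ => a + s • b) ⁻¹' ball c r) ∩ ({0}ᶜ ∩ (fun s : ℂ => a + (conj s)⁻¹ • b) ⁻¹' ball c r) := by
      ext s
      simp only [hΩ, Set.mem_ofPred_eq, Set.mem_inter_iff, Set.mem_preimage, Set.mem_compl_iff, Set.mem_singleton_iff]
      tauto
    rw [this]
    exact (isOpen_ball.preimage hline).inter (hcont2.isOpen_inter_preimage isOpen_compl_singleton isOpen_ball)
  have hll : l < 1 / l := by rw [lt_div_iff₀ hl0]; nlinarith
  have h1l : 1 < 1 / l := by rw [lt_div_iff₀ hl0]; linarith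
  have hK : (fun x : ℝ => (x:ℂ)) '' Set.Icc l 1 ⊆ Ω := by
    rintro _ ⟨s, hs, rfl⟩
    have hs0 : 0 < s := lt_of_lt_of_le hl0 hs.1
    refine ⟨Complex.ofReal_ne_zero.2 hs0.ne', ?_, ?_⟩
    · exact line_mem_ball (x := l) (y := 1 / l) (by rw [hza]; exact hz) (by rw [hwa]; exact hw) hs.1 (hs.2.trans h1l.le)
    · have : (conj (s:ℂ))⁻¹ = ((1 / s : ℝ) : ℂ) := by rw [Complex.conj_ofReal]; push_cast; simp
      rw [this]
      refine line_mem_ball (x := l) (y := 1 / l) (by rw [hza]; exact hz) (by rw [hwa]; exact hw) ?_ ?_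
      · rw [le_div_iff₀ hs0]; nlinarith [hs.2]
      · exact one_div_le_one_div_of_le hl0 hs.1
  obtain ⟨δ, hδ, hδΩ⟩ := (isCompact_Icc.image Complex.continuous_ofReal).exists_thickening_subset_open hΩo hK
  set T := thickening δ ((fun x : ℝ => (x:ℂ)) '' Set.Icc l 1) with hT
  have hTc : IsPreconnected T := by
    have : Convex ℝ ((fun x : ℝ => (x:ℂ)) '' Set.Icc l 1) := (convex_Icc l 1).linear_image Complex.ofRealLI.toLinearMap
    exact (this.thickening δ).isPreconnected
  have hTsub : (fun x : ℝ => (x:ℂ)) '' Set.Icc l 1 ⊆ T := self_subset_thickening hδ _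
  have hcomp : ∀ j, DifferentiableOn ℂ (fun s : ℂ => F (a + s • b) j) ((fun s : ℂ => a + s • b) ⁻¹' ball c r) := by
    intro j
    exact (differentiableOn_pi.1 hF j).comp (by fun_prop) (fun s hs => hs)
  have hG : DifferentiableOn ℂ (fun s : ℂ => ip (F (a + s • b)) (F (a + (conj s)⁻¹ • b)) - 1) Ω := by
    unfold ip
    refine DifferentiableOn.sub_const (DifferentiableOn.fun_sum fun j _ => ?_) _
    refine DifferentiableOn.mul ((hcomp j).mono fun s hs => hs.2.1) ?_
    intro s hs
    have hd1 : DifferentiableAt ℂ (fun s : ℂ => F (a + s • b) j) (conj (s⁻¹)) := by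
      refine (hcomp j).differentiableAt ((isOpen_ball.preimage hline).mem_nhds ?_)
      simpa using hs.2.2
    have hd2 := hd1.conj_conj
    have hd3 : DifferentiableAt ℂ (fun s : ℂ => s⁻¹) s := differentiableAt_inv hs.1
    rw [Complex.conj_conj] at hd2
    have := DifferentiableAt.comp s hd2 hd3
    refine DifferentiableAt.differentiableWithinAt ?_
    refine this.congr_of_eventuallyEq (Eventually.of_forall fun s' => ?_)
    simp [Function.comp]
  have hA : AnalyticOnNhd ℂ (fun s : ℂ => ip (F (a + s • b)) (F (a + (conj s)⁻¹ • b)) - 1) T :=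
    (hG.mono hδΩ).analyticOnNhd isOpen_thickening
  have h1T : (1:ℂ) ∈ T := hTsub ⟨1, ⟨hl1.le, le_rfl⟩, by simp⟩
  have hzero := hA.eqOn_zero_of_preconnected_of_frequently_eq_zero hTc h1T (by
    have := circle_frequently (c := 1) one_pos (P := fun s => ip (F (a + s • b)) (F (a + (conj s)⁻¹ • b)) - 1 = 0) (by
      have : ∀ᶠ s in 𝓝 ((1:ℝ):ℂ), s ∈ T := isOpen_thickening.mem_nhds (by simpa using h1T)
      filter_upwards [this] with s hs h1
      have hinv : (conj s)⁻¹ = s := by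
        have hss : s * conj s = 1 := by rw [Complex.mul_conj, Complex.normSq_eq_norm_sq, h1]; simp
        exact inv_eq_of_mul_eq_one_left hss
      rw [hinv, ip_self, hS _ (hδΩ hs).2.1 (hcirc s h1)]
      simp)
    simpa using this)
  have hfin := hzero (hTsub ⟨l, ⟨le_rfl, hl1.le⟩, rfl⟩)
  have hinv : (conj (l:ℂ))⁻¹ = ((1 / l : ℝ) : ℂ) := by rw [Complex.conj_ofReal]; push_cast; simp
  simp only [hinv, hza, hwa, Pi.zero_apply] at hfin
  exact sub_eq_zero.1 hfin
end
end

section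
open MeasureTheory Metric Filter Topology
open Finset
open scoped ContDiff ComplexConjugate

section
variable {n : ℕ}

lemma nsq_lt_open : IsOpen {z : Fin n → ℂ | nsq z < 1} := isOpen_lt continuous_nsq continuous_const

lemma line_cont (z x : Fin n → ℂ) : Continuous (fun t : ℂ => z + t • x) := by fun_prop

lemma line_hasDeriv (z x : Fin n → ℂ) (t : ℂ) : HasDerivAt (fun t : ℂ => z + t • x) x t := by
  have := ((hasDerivAt_id t).smul_const x).const_add z
  simpa using this

lemma line_comp {G : Type*} [NormedAddCommGroup G] [NormedSpace ℂ G] {F : (Fin n → ℂ) → G} {z x : Fin n → ℂ} {t : ℂ}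
    (h : DifferentiableAt ℂ F (z + t • x)) :
    HasDerivAt (fun t : ℂ => F (z + t • x)) (fderiv ℂ F (z + t • x) x) t :=
  h.hasFDerivAt.comp_hasDerivAt t (line_hasDeriv z x t)

lemma ip_fun_deriv {φ : ℂ → (Fin n → ℂ)} {φ' : Fin n → ℂ} {t : ℂ} (h : HasDerivAt φ φ' t) (w : Fin n → ℂ) :
    HasDerivAt (fun t => ip (φ t) w) (ip φ' w) t := by
  unfold ip
  exact HasDerivAt.fun_sum fun j _ => (hasDerivAt_pi.1 h j).mul_const _

lemma tangent_ip {F : (Fin n → ℂ) → (Fin n → ℂ)} {c : Fin n → ℂ} {r : ℝ} (hF : DifferentiableOn ℂ F (ball c r))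
    (hS : ∀ ζ ∈ ball c r, nsq ζ = 1 → nsq (F ζ) = 1) {z w : Fin n → ℂ} (hz : z ∈ ball c r) (hw : w ∈ ball c r)
    (hz1 : nsq z < 1) (hzw : ip z w = 1) {x : Fin n → ℂ} (hx : ip x w = 0) : ip (fderiv ℂ F z x) (F w) = 0 := by
  have hd : DifferentiableAt ℂ F (z + (0:ℂ) • x) := by
    rw [zero_smul, add_zero]; exact hF.differentiableAt (isOpen_ball.mem_nhds hz)
  have h1 := ip_fun_deriv (line_comp hd) (F w)
  rw [zero_smul, add_zero] at h1
  have hev : ∀ᶠ t : ℂ in 𝓝 0, z + t • x ∈ ball c r ∧ nsq (z + t • x) < 1 := by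
    have : IsOpen {z : Fin n → ℂ | z ∈ ball c r ∧ nsq z < 1} := isOpen_ball.inter nsq_lt_open
    exact (line_cont z x).continuousAt.eventually_mem (this.mem_nhds (by simpa using ⟨hz, hz1⟩))
  have h2 : HasDerivAt (fun t : ℂ => ip (F (z + t • x)) (F w)) 0 0 := by
    refine (hasDerivAt_const (0:ℂ) (1:ℂ)).congr_of_eventuallyEq ?_
    filter_upwards [hev] with t ht
    exact incidence hF hS ht.1 hw ht.2 (by rw [ip_add_left, ip_smul_left, hx, hzw]; simp)
  exact h1.unique h2

lemma hyperplane_form {F : (Fin n → ℂ) → (Fin n → ℂ)} {c : Fin n → ℂ} {r : ℝ} (hF : DifferentiableOn ℂ F (ball c r))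
    (hS : ∀ ζ ∈ ball c r, nsq ζ = 1 → nsq (F ζ) = 1) {z : Fin n → ℂ} (hz : z ∈ ball c r)
    (hz1 : nsq z < 1) (hi : Function.Injective (fderiv ℂ F z)) :
    ∃ (e : Fin n → ℂ) (g : Fin n → Fin n → ℂ), ∀ w ∈ ball c r, ip z w = 1 → ip w e ≠ 0 ∧ ∀ k, ip w e * F w k = ip w (g k) := by
  have hsurj : Function.Surjective (fderiv ℂ F z) :=
    (LinearMap.injective_iff_surjective (f := (fderiv ℂ F z : (Fin n → ℂ) →ₗ[ℂ] (Fin n → ℂ)))).1 hi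
  obtain ⟨e, he⟩ := hsurj (F z)
  choose g hg using fun k : Fin n => hsurj (Pi.single k 1)
  refine ⟨e, g, fun w hw hzw => ?_⟩
  have h1 : ip (fderiv ℂ F z e) (F w) = 1 := by rw [he]; exact incidence hF hS hz hw hz1 hzw
  have hne : ip e w ≠ 0 := by
    intro h
    rw [tangent_ip hF hS hz hw hz1 hzw h] at h1
    exact zero_ne_one h1
  refine ⟨by rw [← ip_conj]; simpa using hne, fun k => ?_⟩
  have h2 := tangent_ip hF hS hz hw hz1 hzw (x := g k - (ip (g k) w / ip e w) • e)
    (by rw [ip_sub_left, ip_smul_left]; field_simp; ring)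
  rw [map_sub, map_smul, ip_sub_left, ip_smul_left, h1, hg] at h2
  have h3 : ip e w * ip (Pi.single k 1) (F w) = ip (g k) w := by
    field_simp at h2 ⊢
    linear_combination h2
  have h4 := congrArg conj h3
  rw [map_mul, ip_conj, ip_conj, ip_conj, ip_single] at h4
  exact h4

lemma line_form {F : (Fin n → ℂ) → (Fin n → ℂ)} {c : Fin n → ℂ} {r : ℝ} (hF : DifferentiableOn ℂ F (ball c r))
    (hS : ∀ ζ ∈ ball c r, nsq ζ = 1 → nsq (F ζ) = 1) {z w v : Fin n → ℂ} (hz : z ∈ ball c r) (hw : w ∈ ball c r)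
    (hz1 : nsq z < 1) (hi : Function.Injective (fderiv ℂ F z)) (hzw : ip z w = 1) (hv : ip z v = 0) :
    ∃ τ : ℂ, ∀ t : ℂ, w + t • v ∈ ball c r → (1 - t * τ) • (F (w + t • v) - F w) = t • fderiv ℂ F w v := by
  obtain ⟨e, g, h⟩ := hyperplane_form hF hS hz hz1 hi
  have hα := (h w hw hzw).1
  refine ⟨- ip v e / ip w e, fun t ht => ?_⟩
  have hline : ∀ t : ℂ, ip z (w + t • v) = 1 := fun t => by rw [ip_add_right, ip_smul_right, hv, hzw]; simp
  ext k
  have hder : ip w e * fderiv ℂ F w v k + ip v e * F w k = ip v (g k) := by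
    have hd : DifferentiableAt ℂ F (w + (0:ℂ) • v) := by
      rw [zero_smul, add_zero]; exact hF.differentiableAt (isOpen_ball.mem_nhds hw)
    have h1 := hasDerivAt_pi.1 (line_comp hd) k
    have h2 := (ip_fun_deriv (line_hasDeriv w v 0) e).fun_mul h1
    have h3 := ip_fun_deriv (line_hasDeriv w v 0) (g k)
    have h4 : (fun t : ℂ => ip (w + t • v) (g k)) =ᶠ[𝓝 0] fun t => ip (w + t • v) e * F (w + t • v) k := by
      have hev : ∀ᶠ t : ℂ in 𝓝 0, w + t • v ∈ ball c r :=
        (line_cont w v).continuousAt.eventually_mem (isOpen_ball.mem_nhds (by simpa using hw))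
      filter_upwards [hev] with t ht
      exact ((h _ ht (hline t)).2 k).symm
    have h5 := h2.unique (h3.congr_of_eventuallyEq h4.symm)
    rw [zero_smul, add_zero] at h5
    linear_combination h5
  have e1 := (h w hw hzw).2 k
  have e2 := (h _ ht (hline t)).2 k
  rw [ip_add_left, ip_smul_left, ip_add_left, ip_smul_left] at e2
  simp only [Pi.smul_apply, Pi.sub_apply, smul_eq_mul]
  field_simp
  linear_combination e2 - e1 - t * hder

lemma second_deriv {φ : (Fin n → ℂ) → ℂ} {U : Set (Fin n → ℂ)} (hU : IsOpen U) (hφ : DifferentiableOn ℂ φ U)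
    {w v : Fin n → ℂ} (hw : w ∈ U) {τ a : ℂ} (h : ∀ t : ℂ, w + t • v ∈ U → (1 - t * τ) * (φ (w + t • v) - φ w) = t * a) :
    fderiv ℂ (fun z => fderiv ℂ φ z v) w v = 2 * τ * a := by
  have hev : ∀ᶠ t : ℂ in 𝓝 0, w + t • v ∈ U :=
    (line_cont w v).continuousAt.eventually_mem (hU.mem_nhds (by simpa using hw))
  have hd : ∀ t : ℂ, w + t • v ∈ U → HasDerivAt (fun t : ℂ => φ (w + t • v)) (fderiv ℂ φ (w + t • v) v) t :=
    fun t ht => line_comp (hφ.differentiableAt (hU.mem_nhds ht))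
  have hl : ∀ t : ℂ, HasDerivAt (fun t : ℂ => 1 - t * τ) (-τ) t := fun t => by
    have := ((hasDerivAt_id t).mul_const τ).const_sub 1
    simpa using this
  have h1 : ∀ᶠ t : ℂ in 𝓝 0, -τ * (φ (w + t • v) - φ w) + (1 - t * τ) * fderiv ℂ φ (w + t • v) v = a := by
    filter_upwards [hev.eventually_nhds] with t ht
    have h2 := (hl t).fun_mul ((hd t ht.self_of_nhds).sub_const (φ w))
    have h3 : HasDerivAt (fun t : ℂ => t * a) a t := by simpa using (hasDerivAt_id t).mul_const a
    refine h2.unique (h3.congr_of_eventuallyEq ?_)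
    filter_upwards [ht] with s hs
    exact h s hs
  have hd2 : HasDerivAt (fun t : ℂ => fderiv ℂ φ (w + t • v) v) (fderiv ℂ (fun z => fderiv ℂ φ z v) w v) 0 := by
    have := line_comp (F := fun z => fderiv ℂ φ z v) (z := w) (x := v) (t := 0)
      ((holo_fderiv hU hφ v).differentiableAt (hU.mem_nhds (by simpa using hw)))
    rwa [zero_smul, add_zero] at this
  have h4 := (((hd 0 (by simpa using hw)).sub_const (φ w)).const_mul (-τ)).fun_add ((hl 0).fun_mul hd2)
  have h5 : HasDerivAt (fun _ : ℂ => a) 0 0 := hasDerivAt_const _ _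
  have h6 := h4.unique (h5.congr_of_eventuallyEq h1)
  have h7 := h1.self_of_nhds
  rw [zero_smul, add_zero] at h6 h7
  linear_combination h6 + 2 * τ * h7

lemma quad_lemma {c : Fin n → Fin n → Fin n → ℂ} (hc : ∀ k i j, c k i j = c k j i)
    (h : ∀ (v : Fin n → ℂ) (a b : Fin n), (∑ i, ∑ j, c a i j * v i * v j) * v b = (∑ i, ∑ j, c b i j * v i * v j) * v a)
    (v : Fin n → ℂ) (k : Fin n) : ∑ i, ∑ j, c k i j * v i * v j = (∑ i, c i i i * v i) * v k := by
  classical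
  have q1 : ∀ (i j : Fin n), i ≠ j → ∀ (s : ℂ) (k : Fin n), ∑ a, ∑ b, c k a b * ((Pi.single i 1 : Fin n → ℂ) + s • (Pi.single j 1 : Fin n → ℂ)) a *
      ((Pi.single i 1 : Fin n → ℂ) + s • (Pi.single j 1 : Fin n → ℂ)) b = c k i i + 2 * s * c k i j + s ^ 2 * c k j j := by
    intro i j hij s k
    simp only [Pi.add_apply, Pi.smul_apply, smul_eq_mul, mul_add, add_mul, Finset.sum_add_distrib, Pi.single_apply, mul_ite, mul_one, mul_zero,
      ite_mul, zero_mul, Finset.sum_ite_eq', Finset.mem_univ, if_true]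
    rw [hc k j i]; ring
  have z1 : ∀ i k, k ≠ i → c k i i = 0 := by
    intro i k hk
    have := h (Pi.single i 1) k i
    simpa [Pi.single_apply, hk] using this
  have z2 : ∀ i j, i ≠ j → 2 * c i i j = c j j j := by
    intro i j hij
    have h1 := h ((Pi.single i 1 : Fin n → ℂ) + (1:ℂ) • (Pi.single j 1 : Fin n → ℂ)) i j
    have h2 := h ((Pi.single i 1 : Fin n → ℂ) + (-1:ℂ) • (Pi.single j 1 : Fin n → ℂ)) i j
    rw [q1 i j hij, q1 i j hij] at h1 h2
    rw [z1 j i hij, z1 i j hij.symm] at h1 h2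
    simp [Pi.single_apply, hij, hij.symm] at h1 h2
    linear_combination (h1 + h2) / 2
  have z3 : ∀ i j k, k ≠ i → k ≠ j → i ≠ j → c k i j = 0 := by
    intro i j k h1 h2 hij
    have := h ((Pi.single i 1 : Fin n → ℂ) + (1:ℂ) • (Pi.single j 1 : Fin n → ℂ)) k i
    rw [q1 i j hij, q1 i j hij] at this
    simp [Pi.single_apply, hij, h1, h2, z1 i k h1, z1 j k h2] at this
    exact this
  have z4 : ∀ k i j, c k i j = (c i i i * (if j = k then 1 else 0) + c j j j * (if i = k then 1 else 0)) / 2 := by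
    intro k i j
    by_cases h1 : j = k
    · subst h1
      by_cases h2 : i = j
      · subst h2; simp
      · simp only [h2, if_true, if_false]
        rw [hc, ← z2 j i (Ne.symm h2)]; ring
    · by_cases h2 : i = k
      · subst h2
        simp only [h1, if_true, if_false]
        rw [← z2 i j (Ne.symm h1)]; ring
      · simp only [h1, h2, if_false]
        by_cases h3 : i = j
        · subst h3; rw [z1 i k (Ne.symm h1)]; ring
        · rw [z3 i j k (Ne.symm h2) (Ne.symm h1) h3]; ring
  have : ∀ i j, c k i j * v i * v j = (c i i i * v i) * (if j = k then v k else 0) / 2 + (c j j j * v j) * (if i = k then v k else 0) / 2 := by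
    intro i j
    rw [z4 k i j]
    split_ifs with h1 h2 h2
    · subst h1; subst h2; ring
    · subst h1; ring
    · subst h2; ring
    · ring
  simp only [this, Finset.sum_add_distrib]
  rw [Finset.sum_comm (f := fun i j => (c j j j * v j) * (if i = k then v k else 0) / 2)]
  simp only [← Finset.sum_div, ← Finset.mul_sum, Finset.sum_ite_eq', Finset.mem_univ, if_true, ← Finset.sum_mul]
  ring
end
end

section
open MeasureTheory Metric Filter Topology
open Finset
open scoped ContDiff ComplexConjugate

section
variable {n : ℕ}

lemma second_expand {φ : (Fin n → ℂ) → ℂ} {U : Set (Fin n → ℂ)} (hU : IsOpen U) (hφ : DifferentiableOn ℂ φ U)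
    {w : Fin n → ℂ} (hw : w ∈ U) (v : Fin n → ℂ) :
    fderiv ℂ (fun z => fderiv ℂ φ z v) w v =
      ∑ i, ∑ j, fderiv ℂ (fun z => fderiv ℂ φ z (Pi.single i 1)) w (Pi.single j 1) * v i * v j := by
  have h1 : (fun z => fderiv ℂ φ z v) = fun z => ∑ i, v i * fderiv ℂ φ z (Pi.single i 1) := by
    funext z
    conv_lhs => rw [clm_pi_eq (fderiv ℂ φ z)]
    simp [mul_comm]
  rw [h1, fderiv_fun_sum]
  · rw [FunLike.coe_sum, Finset.sum_apply]
    refine Finset.sum_congr rfl fun i _ => ?_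
    rw [fderiv_const_mul ((holo_fderiv hU hφ _).differentiableAt (hU.mem_nhds hw))]
    conv_lhs => rw [clm_pi_eq (fderiv ℂ (fun z => fderiv ℂ φ z (Pi.single i 1)) w)]
    simp only [smul_apply, FunLike.coe_sum, Finset.sum_apply, ContinuousLinearMap.proj_apply, smul_eq_mul, Finset.mul_sum]
    exact Finset.sum_congr rfl fun j _ => by ring
  · intro i _
    exact ((holo_fderiv hU hφ _).differentiableAt (hU.mem_nhds hw)).const_mul _

lemma continuous_ip_right (z : Fin n → ℂ) : Continuous (fun w => ip z w) := by
  unfold ip; fun_prop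

lemma proj_form {F : (Fin n → ℂ) → (Fin n → ℂ)} {c : Fin n → ℂ} {r : ℝ} (hF : DifferentiableOn ℂ F (ball c r))
    (hS : ∀ ζ ∈ ball c r, nsq ζ = 1 → nsq (F ζ) = 1) (hi : ∀ ζ ∈ ball c r, Function.Injective (fderiv ℂ F ζ))
    {z0 w0 v0 : Fin n → ℂ} (hz : z0 ∈ ball c r) (hw : w0 ∈ ball c r) (hz1 : nsq z0 < 1) (hzw : ip z0 w0 = 1)
    (hv0 : v0 ≠ 0) (hzv : ip z0 v0 = 0) (hvw : ip v0 w0 = 0) (hwv : w0 + v0 ∈ ball c r) :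
    ∃ l : Fin n → ℂ, ∀ w ∈ ball c r, (1 - ∑ i, l i * (w - w0) i) • (F w - F w0) = fderiv ℂ F w0 (w - w0) := by
  have hinj := hi w0 hw
  have hbij : Function.Bijective (fderiv ℂ F w0 : (Fin n → ℂ) →ₗ[ℂ] (Fin n → ℂ)) :=
    ⟨hinj, LinearMap.injective_iff_surjective.1 hinj⟩
  set A := (LinearEquiv.ofBijective _ hbij).toContinuousLinearEquiv with hA
  have hAapp : ∀ x, A x = fderiv ℂ F w0 x := fun x => rfl
  set φ : Fin n → (Fin n → ℂ) → ℂ := fun k z => A.symm (F z) k with hφdef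
  have hφ : ∀ k, DifferentiableOn ℂ (φ k) (ball c r) := by
    have : DifferentiableOn ℂ (fun z => A.symm (F z)) (ball c r) :=
      A.symm.differentiable.comp_differentiableOn hF
    exact fun k => differentiableOn_pi.1 this k
  -- near v0
  have hev : ∀ᶠ v in 𝓝 v0, v ≠ 0 ∧ w0 + v ∈ ball c r ∧
      ∃ τ : ℂ, ∀ t : ℂ, w0 + t • v ∈ ball c r → ∀ k, (1 - t * τ) * (φ k (w0 + t • v) - φ k w0) = t * v k := by
    have hvv : ip v0 v0 ≠ 0 := by
      rw [ip_self]; intro h; exact hv0 (nsq_eq_zero (by exact_mod_cast h))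
    have hzc : ContinuousAt (fun v => z0 + (- ip z0 v / ip v0 v) • v0) v0 := by
      have h1 := (continuous_ip_right z0).continuousAt (x := v0)
      have h2 := (continuous_ip_right v0).continuousAt (x := v0)
      exact continuousAt_const.add (((h1.neg).div h2 hvv).smul continuousAt_const)
    have hop : IsOpen {z : Fin n → ℂ | z ∈ ball c r ∧ nsq z < 1} := isOpen_ball.inter nsq_lt_open
    have e1 := hzc.eventually_mem (hop.mem_nhds (by
      beta_reduce; rw [hzv, neg_zero, zero_div, zero_smul, add_zero]; exact ⟨hz, hz1⟩))
    have e2 : ∀ᶠ v in 𝓝 v0, w0 + v ∈ ball c r :=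
      (continuous_const.add continuous_id).continuousAt.eventually_mem (isOpen_ball.mem_nhds hwv)
    filter_upwards [e1, e2, eventually_ne_nhds hv0, (continuous_ip_right v0).continuousAt.eventually_ne hvv] with v h1 h2 h3 h4
    refine ⟨h3, h2, ?_⟩
    obtain ⟨τ, hτ⟩ := line_form hF hS h1.1 hw h1.2 (hi _ h1.1) (v := v)
      (by rw [ip_add_left, ip_smul_left, hvw, hzw]; simp) (by rw [ip_add_left, ip_smul_left]; field_simp; ring)
    refine ⟨τ, fun t ht k => ?_⟩
    have := congrFun (congrArg A.symm (hτ t ht)) k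
    rw [map_smul, map_smul, map_sub, ← hAapp, A.symm_apply_apply] at this
    simpa using this
  set C : Fin n → Fin n → Fin n → ℂ := fun k i j => fderiv ℂ (fun z => fderiv ℂ (φ k) z (Pi.single i 1)) w0 (Pi.single j 1) with hC
  have hCs : ∀ k i j, C k i j = C k j i := fun k i j => holo_symm isOpen_ball (hφ k) hw _ _
  have hq : ∀ v τ, (∀ t : ℂ, w0 + t • v ∈ ball c r → ∀ k, (1 - t * τ) * (φ k (w0 + t • v) - φ k w0) = t * v k) →
      ∀ k, ∑ i, ∑ j, C k i j * v i * v j = 2 * τ * v k := by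
    intro v τ h k
    rw [← second_expand isOpen_ball (hφ k) hw v]
    exact second_deriv isOpen_ball (hφ k) hw (fun t ht => h t ht k)
  have hpoly : ∀ (v : Fin n → ℂ) (a b : Fin n), (∑ i, ∑ j, C a i j * v i * v j) * v b = (∑ i, ∑ j, C b i j * v i * v j) * v a := by
    intro v a b
    have := holo_identity (f := fun v : Fin n → ℂ => (∑ i, ∑ j, C a i j * v i * v j) * v b - (∑ i, ∑ j, C b i j * v i * v j) * v a)
      isOpen_univ isPreconnected_univ (by
        apply Differentiable.differentiableOn
        fun_prop) (Set.mem_univ v0) (by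
        filter_upwards [hev] with v hv
        obtain ⟨-, -, τ, h⟩ := hv
        rw [hq v τ h, hq v τ h]
        simp only [Pi.zero_apply]; ring) v (Set.mem_univ v)
    exact sub_eq_zero.1 this
  refine ⟨fun i => C i i i / 2, ?_⟩
  have key : ∀ k, ∀ w ∈ ball c r, (1 - ∑ i, C i i i / 2 * (w - w0) i) * (φ k w - φ k w0) - (w - w0) k = 0 := by
    intro k
    have hd1 : Differentiable ℂ (fun w : Fin n → ℂ => (1 - ∑ i, C i i i / 2 * (w - w0) i)) := by
      simp only [Pi.sub_apply]; fun_prop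
    have hd2 : Differentiable ℂ (fun w : Fin n → ℂ => (w - w0) k) := by
      simp only [Pi.sub_apply]; fun_prop
    refine holo_identity isOpen_ball (convex_ball c r).isPreconnected
      ((hd1.differentiableOn.fun_mul ((hφ k).sub_const _)).fun_sub hd2.differentiableOn) hwv ?_
    have ht : Tendsto (fun w => w - w0) (𝓝 (w0 + v0)) (𝓝 v0) := by
      have : ContinuousAt (fun w => w - w0) (w0 + v0) := by fun_prop
      have h := this.tendsto
      simpa using h
    filter_upwards [ht.eventually hev] with w hw'
    obtain ⟨hne, hb, τ, h⟩ := hw'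
    have h1 := hq _ τ h
    obtain ⟨j, hj⟩ := Function.ne_iff.1 hne
    have h2 := quad_lemma hCs hpoly (w - w0) j
    rw [h1 j] at h2
    have h3 : ∑ i, C i i i / 2 * (w - w0) i = τ := by
      have h4 := mul_right_cancel₀ hj h2
      have : ∑ i, C i i i / 2 * (w - w0) i = (∑ i, C i i i * (w - w0) i) / 2 := by
        rw [Finset.sum_div]; exact Finset.sum_congr rfl fun i _ => by ring
      rw [this, ← h4]; ring
    have h5 := h 1 (by simpa using hb) k
    rw [h3]
    simp only [one_mul, one_smul, add_sub_cancel] at h5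
    rw [h5]; simp
  intro w hw'
  have : A.symm ((1 - ∑ i, C i i i / 2 * (w - w0) i) • (F w - F w0)) = w - w0 := by
    ext k
    have := key k w hw'
    rw [map_smul, map_sub]
    simp only [Pi.smul_apply, smul_eq_mul, Pi.sub_apply] at this ⊢
    exact sub_eq_zero.1 this
  have h2 := congrArg A this
  rw [A.apply_symm_apply, hAapp] at h2
  exact h2
end
end

section
open MeasureTheory Metric Filter Topology
open Finset
open scoped ContDiff ComplexConjugate

section
variable {n : ℕ}

/-- the Lorentz form -/
noncomputable def qf {n : ℕ} (Z W : (Fin n → ℂ) × ℂ) : ℂ := ip Z.1 W.1 - Z.2 * conj W.2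

lemma qf_add_left (Z Z' W : (Fin n → ℂ) × ℂ) : qf (Z + Z') W = qf Z W + qf Z' W := by
  simp only [qf, Prod.fst_add, Prod.snd_add, ip_add_left]; ring
lemma qf_smul_left (c : ℂ) (Z W : (Fin n → ℂ) × ℂ) : qf (c • Z) W = c * qf Z W := by
  simp only [qf, Prod.smul_fst, Prod.smul_snd, ip_smul_left, smul_eq_mul]; ring
lemma qf_conj (Z W : (Fin n → ℂ) × ℂ) : conj (qf Z W) = qf W Z := by
  simp only [qf, map_sub, map_mul, ip_conj, Complex.conj_conj]; ring
lemma qf_smul_right (c : ℂ) (Z W : (Fin n → ℂ) × ℂ) : qf Z (c • W) = conj c * qf Z W := by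
  rw [← qf_conj, qf_smul_left, map_mul, qf_conj]
lemma qf_sub_left (Z Z' W : (Fin n → ℂ) × ℂ) : qf (Z - Z') W = qf Z W - qf Z' W := by
  simp only [qf, Prod.fst_sub, Prod.snd_sub, ip_sub_left]; ring
lemma qf_zero_left (W : (Fin n → ℂ) × ℂ) : qf 0 W = 0 := by simp [qf, ip_zero_left]

lemma herm_form {F : (Fin n → ℂ) → (Fin n → ℂ)} {c : Fin n → ℂ} {r : ℝ} (hF : DifferentiableOn ℂ F (ball c r))
    (hS : ∀ ζ ∈ ball c r, nsq ζ = 1 → nsq (F ζ) = 1) {L : ((Fin n → ℂ) × ℂ) →ₗ[ℂ] ((Fin n → ℂ) × ℂ)}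
    (hL : ∀ ζ ∈ ball c r, L (ζ, 1) = (L (ζ, 1)).2 • (F ζ, (1:ℂ))) {w0 : Fin n → ℂ} (hw : w0 ∈ ball c r)
    (hw0 : nsq w0 ≠ 0) (hz : ((nsq w0 : ℂ)⁻¹) • w0 ∈ ball c r) (hz1 : nsq (((nsq w0 : ℂ)⁻¹) • w0) < 1) (Z W : (Fin n → ℂ) × ℂ) :
    qf (L Z) (L W) = - qf (L (0, 1)) (L (0, 1)) * qf Z W := by
  have h1 : ∀ z w, z ∈ ball c r → w ∈ ball c r → nsq z < 1 → ip z w = 1 → qf (L (z, 1)) (L (w, 1)) = 0 := by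
    intro z w hz hw h1 h2
    rw [hL z hz, hL w hw, qf_smul_left, qf_smul_right]
    simp [qf, incidence hF hS hz hw h1 h2]
  have hev : ∀ᶠ w in 𝓝 w0, ∀ Z : (Fin n → ℂ) × ℂ, qf (L (w, 1)) (L Z) = - qf (w, 1) Z * qf (L (w, 1)) (L (0, 1)) := by
    have hc : ContinuousAt (fun w : Fin n → ℂ => ((nsq w : ℂ)⁻¹) • w) w0 := by
      have h2 : ContinuousAt (fun w : Fin n → ℂ => (nsq w : ℂ)) w0 := (Complex.continuous_ofReal.comp continuous_nsq).continuousAt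
      exact (h2.inv₀ (by exact_mod_cast hw0)).smul continuousAt_id
    have hop : IsOpen {z : Fin n → ℂ | z ∈ ball c r ∧ nsq z < 1} := isOpen_ball.inter nsq_lt_open
    filter_upwards [hc.eventually_mem (hop.mem_nhds ⟨hz, hz1⟩), isOpen_ball.mem_nhds hw, continuous_nsq.continuousAt.eventually_ne hw0] with w e1 e2 e3
    set z := ((nsq w : ℂ)⁻¹) • w with hzdef
    have e3' : (nsq w : ℂ) ≠ 0 := by exact_mod_cast e3
    have hzw : ip z w = 1 := by rw [hzdef, ip_smul_left, ip_self]; field_simp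
    have k0 : qf (L (z, 1)) (L (w, 1)) = 0 := h1 z w e1.1 e2 e1.2 hzw
    have k1 : ∀ y, ip y w = 0 → qf (L (y, 0)) (L (w, 1)) = 0 := by
      intro y hy
      have hev : ∀ᶠ t : ℂ in 𝓝[≠] 0, z + t • y ∈ {z : Fin n → ℂ | z ∈ ball c r ∧ nsq z < 1} :=
        nhdsWithin_le_nhds ((line_cont z y).continuousAt.eventually_mem (hop.mem_nhds (by simpa using e1)))
      obtain ⟨t, ht, ht0⟩ := (hev.and self_mem_nhdsWithin).exists
      have := h1 (z + t • y) w ht.1 e2 ht.2 (by rw [ip_add_left, hzw, ip_smul_left, hy]; simp)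
      have e : ((z + t • y, 1) : (Fin n → ℂ) × ℂ) = (z, 1) + t • (y, 0) := by ext <;> simp
      rw [e, map_add, map_smul, qf_add_left, qf_smul_left, k0, zero_add] at this
      exact (mul_eq_zero.1 this).resolve_left ht0
    have k2 : ∀ Z : (Fin n → ℂ) × ℂ, qf (L Z) (L (w, 1)) = - qf Z (w, 1) * qf (L (0, 1)) (L (w, 1)) := by
      intro Z
      have e : Z = (ip Z.1 w) • (z, (1:ℂ)) + (Z.1 - ip Z.1 w • z, (0:ℂ)) + (Z.2 - ip Z.1 w) • ((0 : Fin n → ℂ), (1:ℂ)) := by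
        ext <;> simp
      have e' : qf Z (w, 1) = ip Z.1 w - Z.2 := by simp [qf]
      rw [e']
      conv_lhs => rw [e]
      rw [map_add, map_add, map_smul, map_smul, qf_add_left, qf_add_left, qf_smul_left, qf_smul_left, k0, k1 _ (by
        rw [ip_sub_left, ip_smul_left, hzw]; ring)]
      ring
    intro Z
    have := congrArg conj (k2 Z)
    rw [map_mul, map_neg, qf_conj, qf_conj, qf_conj] at this
    exact this
  have hLw : ∀ w : Fin n → ℂ, ∀ Z, qf (L (w, 1)) Z = qf (L (w, 0)) Z + qf (L (0, 1)) Z := fun w Z => by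
    rw [← qf_add_left, ← map_add]; simp
  have hdiff : ∀ Z, Differentiable ℂ (fun w : Fin n → ℂ => qf (L (w, 1)) Z) := by
    intro Z
    have hLd : Differentiable ℂ (fun w : Fin n → ℂ => L (w, 1)) :=
      (LinearMap.toContinuousLinearMap L).differentiable.comp (differentiable_id.prodMk (differentiable_const (1:ℂ)))
    unfold qf
    exact ((ip_diff Z.1).comp hLd.fst).sub (hLd.snd.mul_const _)
  have hall : ∀ (w : Fin n → ℂ) (Z : (Fin n → ℂ) × ℂ), qf (L (w, 1)) (L Z) = - qf (w, 1) Z * qf (L (w, 1)) (L (0, 1)) := by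
    intro w Z
    have hd : Differentiable ℂ (fun w : Fin n → ℂ => qf (w, 1) Z) := by
      unfold qf; exact (ip_diff Z.1).sub_const (1 * conj Z.2)
    have := holo_identity (f := fun w => qf (L (w, 1)) (L Z) - (- qf (w, 1) Z * qf (L (w, 1)) (L (0, 1)))) isOpen_univ isPreconnected_univ
      ((hdiff _).sub (hd.neg.mul (hdiff _))).differentiableOn (Set.mem_univ w0) (by
        filter_upwards [hev] with w h
        rw [h Z]; simp) w (Set.mem_univ w)
    exact sub_eq_zero.1 this
  have a1 : ∀ x : Fin n → ℂ, qf (L (0, 1)) (L (x, 0)) = 0 := by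
    intro x
    have := hall 0 (x, 0)
    rw [this]; simp [qf, ip_zero_left]
  have a2 : ∀ x : Fin n → ℂ, qf (L (x, 0)) (L (0, 1)) = 0 := by
    intro x; rw [← qf_conj, a1, map_zero]
  have a3 : ∀ (w : Fin n → ℂ) Z, qf (L (w, 1)) (L Z) = - qf (L (0, 1)) (L (0, 1)) * qf (w, 1) Z := by
    intro w Z
    rw [hall, hLw w (L (0, 1)), a2]; ring
  generalize - qf (L (0, 1)) (L (0, 1)) = K at a3 ⊢
  have e : Z = ((Z.1, 1) - (0, 1)) + Z.2 • ((0 : Fin n → ℂ), (1:ℂ)) := by ext <;> simp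
  rw [e, map_add, map_sub, map_smul, qf_add_left, qf_sub_left, qf_smul_left, a3, a3, qf_add_left, qf_sub_left, qf_smul_left]
  ring

lemma exists_orth (hn : 2 ≤ n) (c : Fin n → ℂ) : ∃ u : Fin n → ℂ, u ≠ 0 ∧ ip u c = 0 := by
  classical
  let i : Fin n := ⟨0, by omega⟩
  let j : Fin n := ⟨1, by omega⟩
  have hij : i ≠ j := by simp [i, j, Fin.ext_iff]
  by_cases h : c i = 0
  · refine ⟨Pi.single i 1, fun h => by simpa using congrFun h i, ?_⟩
    rw [← ip_conj, ip_single, h, map_zero]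
  · refine ⟨(conj (c j)) • (Pi.single i 1 : Fin n → ℂ) - (conj (c i)) • (Pi.single j 1 : Fin n → ℂ), fun h' => ?_, ?_⟩
    · have := congrFun h' j
      simp [hij.symm] at this
      exact h this
    · rw [ip_sub_left, ip_smul_left, ip_smul_left, ← ip_conj c, ip_single, ← ip_conj c, ip_single]; ring

theorem sphere_thm (hn : 2 ≤ n) {F : (Fin n → ℂ) → (Fin n → ℂ)} {c : Fin n → ℂ} {r : ℝ} (hr : 0 < r) (hc : nsq c = 1)
    (hF : DifferentiableOn ℂ F (ball c r))
    (hS : ∀ ζ ∈ ball c r, nsq ζ = 1 → nsq (F ζ) = 1) (hB : ∀ ζ ∈ ball c r, nsq ζ < 1 → nsq (F ζ) < 1)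
    (hi : ∀ ζ ∈ ball c r, Function.Injective (fderiv ℂ F ζ)) :
    ∃ (L : ((Fin n → ℂ) × ℂ) →ₗ[ℂ] ((Fin n → ℂ) × ℂ)) (κ : ℝ), 0 < κ ∧
      (∀ ζ ∈ ball c r, L (ζ, 1) = (L (ζ, 1)).2 • (F ζ, (1:ℂ))) ∧ ∀ Z W, qf (L Z) (L W) = κ * qf Z W := by
  obtain ⟨u, hu, huc⟩ := exists_orth hn c
  have e1 : ∀ᶠ s : ℝ in 𝓝[<] 1, (s:ℂ) • c ∈ ball c r := by
    have : Continuous (fun s : ℝ => (s:ℂ) • c) := by fun_prop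
    exact nhdsWithin_le_nhds (this.continuousAt.eventually_mem (isOpen_ball.mem_nhds (by simpa using hr)))
  have e2 : ∀ᶠ s : ℝ in 𝓝[<] 1, (s:ℂ)⁻¹ • c ∈ ball c r := by
    have : ContinuousAt (fun s : ℝ => (s:ℂ)⁻¹ • c) 1 := by
      have h2 : ContinuousAt (fun s : ℝ => (s : ℂ)) 1 := Complex.continuous_ofReal.continuousAt
      exact (h2.inv₀ (by simp)).smul continuousAt_const
    exact nhdsWithin_le_nhds (this.eventually_mem (isOpen_ball.mem_nhds (by simpa using hr)))
  have e3 : ∀ᶠ s : ℝ in 𝓝[<] 1, 0 < s := nhdsWithin_le_nhds (Ioi_mem_nhds one_pos)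
  obtain ⟨s, hs1, hs2, hs0, hs⟩ := (e1.and (e2.and (e3.and self_mem_nhdsWithin))).exists
  have hs' : s < 1 := hs
  have hsc : (s:ℂ) ≠ 0 := by exact_mod_cast hs0.ne'
  set z0 := (s:ℂ) • c with hz0
  set w0 := (s:ℂ)⁻¹ • c with hw0
  have hz1 : nsq z0 < 1 := by
    rw [hz0, nsq_smul, hc, mul_one, Complex.norm_real, Real.norm_eq_abs, sq_abs]; nlinarith
  have hcc : ip c c = 1 := by rw [ip_self, hc]; simp
  have hzw : ip z0 w0 = 1 := by
    rw [hz0, hw0, ip_smul_left, ip_smul_right, hcc, map_inv₀, Complex.conj_ofReal]; field_simp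
  have hnw : (nsq w0 : ℂ) = (s:ℂ)⁻¹ ^ 2 := by
    rw [← ip_self, hw0, ip_smul_left, ip_smul_right, hcc, map_inv₀, Complex.conj_ofReal]; ring
  have hnw0 : nsq w0 ≠ 0 := by
    intro h; rw [h] at hnw; exact pow_ne_zero 2 (inv_ne_zero hsc) (by rw [← hnw]; simp)
  have hzz : ((nsq w0 : ℂ)⁻¹) • w0 = z0 := by
    rw [hnw, hw0, hz0, smul_smul]; congr 1; field_simp
  have e4 : ∀ᶠ t : ℂ in 𝓝[≠] 0, w0 + t • u ∈ ball c r :=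
    nhdsWithin_le_nhds ((line_cont w0 u).continuousAt.eventually_mem (isOpen_ball.mem_nhds (by simpa using hs2)))
  obtain ⟨t, ht, ht0⟩ := (e4.and self_mem_nhdsWithin).exists
  have ht0' : t ≠ 0 := ht0
  have hcu : ip c u = 0 := by rw [← ip_conj, huc, map_zero]
  obtain ⟨l, hl⟩ := proj_form hF hS hi hs1 hs2 hz1 hzw (smul_ne_zero ht0' hu)
    (by rw [hz0, ip_smul_left, ip_smul_right, hcu]; simp) (by rw [hw0, ip_smul_left, ip_smul_right, huc]; simp) ht
  let d : ((Fin n → ℂ) × ℂ) → ℂ := fun Z => Z.2 - ∑ i, l i * (Z.1 - Z.2 • w0) i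
  let L : ((Fin n → ℂ) × ℂ) →ₗ[ℂ] ((Fin n → ℂ) × ℂ) :=
    { toFun := fun Z => (d Z • F w0 + fderiv ℂ F w0 (Z.1 - Z.2 • w0), d Z)
      map_add' := fun Z W => by
        have hd : d (Z + W) = d Z + d W := by
          simp only [d, Prod.fst_add, Prod.snd_add, add_smul, Pi.sub_apply, Pi.add_apply]
          rw [show ∀ a b x y : ℂ, a - x + (b - y) = a + b - (x + y) from fun _ _ _ _ => by ring, ← Finset.sum_add_distrib]
          congr 1
          exact Finset.sum_congr rfl fun i _ => by ring
        have h2 : (Z + W).1 - (Z + W).2 • w0 = (Z.1 - Z.2 • w0) + (W.1 - W.2 • w0) := by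
          simp only [Prod.fst_add, Prod.snd_add, add_smul]; abel
        rw [hd, h2, map_add, add_smul]
        ext <;> simp <;> ring
      map_smul' := fun a Z => by
        have hd : d (a • Z) = a * d Z := by
          simp only [d, Prod.smul_fst, Prod.smul_snd, smul_eq_mul, Pi.sub_apply, Pi.smul_apply, mul_sub, Finset.mul_sum]
          congr 1
          exact Finset.sum_congr rfl fun i _ => by ring
        have h2 : (a • Z).1 - (a • Z).2 • w0 = a • (Z.1 - Z.2 • w0) := by
          simp only [Prod.smul_fst, Prod.smul_snd, smul_eq_mul, smul_sub, mul_smul]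
        rw [hd, h2, map_smul]
        ext <;> simp <;> ring }
  have hLapp : ∀ Z, L Z = (d Z • F w0 + fderiv ℂ F w0 (Z.1 - Z.2 • w0), d Z) := fun Z => rfl
  have hL : ∀ ζ ∈ ball c r, L (ζ, 1) = (L (ζ, 1)).2 • (F ζ, (1:ℂ)) := by
    intro ζ hζ
    have := hl ζ hζ
    rw [hLapp]
    have hd1 : d (ζ, 1) = 1 - ∑ i, l i * (ζ - w0) i := by simp [d]
    simp only [one_smul, Prod.smul_mk, smul_eq_mul, mul_one]
    congr 1
    rw [← this, hd1, ← smul_add]; congr 1; abel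
  have hherm := herm_form hF hS hL hs2 hnw0 (by rw [hzz]; exact hs1) (by rw [hzz]; exact hz1)
  have hreal : ∃ κ : ℝ, (κ : ℂ) = - qf (L (0, 1)) (L (0, 1)) := by
    refine ⟨(- qf (L (0, 1)) (L (0, 1))).re, ?_⟩
    exact Complex.conj_eq_iff_re.1 (by rw [map_neg, qf_conj])
  obtain ⟨κ, hκ⟩ := hreal
  rw [← hκ] at hherm
  refine ⟨L, κ, ?_, hL, hherm⟩
  have hd0 : (L (z0, 1)).2 ≠ 0 := by
    intro h
    have h1 := hL z0 hs1
    rw [h, zero_smul] at h1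
    have h2 : d (z0, 1) = 0 := h
    rw [hLapp, h2, zero_smul, zero_add] at h1
    have h3 : fderiv ℂ F w0 (z0 - w0) = 0 := by simpa using congrArg Prod.fst h1
    have h4 : z0 - w0 = 0 := hi w0 hs2 (by rw [h3, map_zero])
    have h5 : d (z0, 1) = 1 := by simp only [d, one_smul]; rw [h4]; simp
    rw [h5] at h2; exact one_ne_zero h2
  have h1 := hherm (z0, 1) (z0, 1)
  rw [hL z0 hs1, qf_smul_left, qf_smul_right] at h1
  have h2 : qf (F z0, (1:ℂ)) (F z0, (1:ℂ)) = ((nsq (F z0) - 1 : ℝ) : ℂ) := by simp [qf, ip_self]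
  have h3 : qf (z0, (1:ℂ)) (z0, (1:ℂ)) = ((nsq z0 - 1 : ℝ) : ℂ) := by simp [qf, ip_self]
  rw [h2, h3, ← mul_assoc, Complex.mul_conj, Complex.normSq_eq_norm_sq] at h1
  have h4 : ‖(L (z0, 1)).2‖ ^ 2 * (nsq (F z0) - 1) = κ * (nsq z0 - 1) := by exact_mod_cast h1
  have h5 := hB z0 hs1 hz1
  have h6 : 0 < ‖(L (z0, 1)).2‖ ^ 2 := by positivity
  have h7 : ‖(L (z0, 1)).2‖ ^ 2 * (nsq (F z0) - 1) < 0 := mul_neg_of_pos_of_neg h6 (by linarith)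
  rw [h4] at h7
  by_contra hk
  have := mul_nonneg_of_nonpos_of_nonpos (not_lt.1 hk) (by linarith : nsq z0 - 1 ≤ 0)
  linarith
end
end

section
open MeasureTheory Metric Filter Topology
open Finset
open scoped ContDiff ComplexConjugate

section
variable {n : ℕ} {L : ((Fin n → ℂ) × ℂ) →ₗ[ℂ] ((Fin n → ℂ) × ℂ)} {κ : ℝ}

lemma qf_self (Z : (Fin n → ℂ) × ℂ) : qf Z Z = ((nsq Z.1 - ‖Z.2‖ ^ 2 : ℝ) : ℂ) := by
  rw [qf, ip_self, Complex.mul_conj, Complex.normSq_eq_norm_sq]; push_cast; ring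

lemma L_self (hq : ∀ Z W, qf (L Z) (L W) = κ * qf Z W) (Z : (Fin n → ℂ) × ℂ) :
    nsq (L Z).1 - ‖(L Z).2‖ ^ 2 = κ * (nsq Z.1 - ‖Z.2‖ ^ 2) := by
  have := hq Z Z
  rw [qf_self, qf_self] at this
  exact_mod_cast this

lemma L_ball (hκ : 0 < κ) (hq : ∀ Z W, qf (L Z) (L W) = κ * qf Z W) {ζ : Fin n → ℂ} (h : nsq ζ < 1) :
    nsq (L (ζ, 1)).1 < ‖(L (ζ, 1)).2‖ ^ 2 := by
  have := L_self hq (ζ, 1)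
  have h2 : κ * (nsq ζ - ‖(1:ℂ)‖ ^ 2) < 0 := mul_neg_of_pos_of_neg hκ (by simp; linarith)
  linarith

lemma L_ne (hκ : 0 < κ) (hq : ∀ Z W, qf (L Z) (L W) = κ * qf Z W) {ζ : Fin n → ℂ} (h : nsq ζ < 1) :
    (L (ζ, 1)).2 ≠ 0 := by
  intro h0
  have := L_ball hκ hq h
  rw [h0] at this
  have := nsq_nonneg (L (ζ, 1)).1
  simp at *; linarith

lemma L_inj (hκ : 0 < κ) (hq : ∀ Z W, qf (L Z) (L W) = κ * qf Z W) : Function.Injective L := by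
  rw [injective_iff_map_eq_zero]
  intro Z hZ
  have h1 : ∀ W, qf Z W = 0 := by
    intro W
    have := hq Z W
    rw [hZ, qf_zero_left] at this
    have hk : (κ : ℂ) ≠ 0 := by exact_mod_cast hκ.ne'
    exact (mul_eq_zero.1 this.symm).resolve_left hk
  have h2 : Z.1 = 0 := by
    ext j
    have := h1 (Pi.single j 1, 0)
    simpa [qf, ip_single] using this
  have h3 : Z.2 = 0 := by simpa [qf, ip_zero_right] using h1 (0, 1)
  ext <;> simp [h2, h3]

lemma L_center (hκ : 0 < κ) (hq : ∀ Z W, qf (L Z) (L W) = κ * qf Z W) :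
    ∃ a : Fin n → ℂ, nsq a < 1 ∧ (L (a, 1)).1 = 0 ∧ ∀ b, (L (b, 1)).1 = 0 → b = a := by
  have hs : Function.Surjective L := LinearMap.injective_iff_surjective.1 (L_inj hκ hq)
  obtain ⟨Z, hZ⟩ := hs (0, 1)
  have h1 := L_self hq Z
  rw [hZ] at h1
  have hZ2 : Z.2 ≠ 0 := by
    intro h
    rw [h] at h1
    have := nsq_nonneg Z.1
    have h3 : nsq (0 : Fin n → ℂ) = 0 := by simp [nsq]
    simp [h3] at h1
    nlinarith
  have hZa : ((Z.2⁻¹ • Z.1, 1) : (Fin n → ℂ) × ℂ) = Z.2⁻¹ • Z := by ext <;> simp [hZ2]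
  have hlt : nsq Z.1 < ‖Z.2‖ ^ 2 := by
    have h3 : nsq (0 : Fin n → ℂ) = 0 := by simp [nsq]
    simp [h3] at h1
    by_contra hh
    have := mul_nonneg hκ.le (sub_nonneg.2 (not_lt.1 hh))
    linarith
  refine ⟨Z.2⁻¹ • Z.1, ?_, ?_, ?_⟩
  · rw [nsq_smul, norm_inv, inv_pow, inv_mul_lt_one₀ (by positivity)]; exact hlt
  · rw [hZa, map_smul, hZ]; simp
  · intro b hb
    have h2 : L (b, 1) = L ((L (b, 1)).2 • Z) := by rw [map_smul, hZ]; ext <;> simp [hb]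
    have h3 := L_inj hκ hq h2
    have h4 : b = (L (b, 1)).2 • Z.1 := congrArg Prod.fst h3
    have h5 : 1 = (L (b, 1)).2 * Z.2 := congrArg Prod.snd h3
    have h6 : (L (b, 1)).2 = Z.2⁻¹ := by field_simp; exact h5.symm
    rw [h4, h6]

lemma L_lin (hq : ∀ Z W, qf (L Z) (L W) = κ * qf Z W) (h0 : (L (0, 1)).1 = 0) (hd : (L (0, 1)).2 ≠ 0) (x : Fin n → ℂ) :
    (L (x, 0)).2 = 0 := by
  have := hq (x, 0) (0, 1)
  have h2 : qf (x, (0:ℂ)) ((0 : Fin n → ℂ), (1:ℂ)) = 0 := by simp [qf, ip_zero_right]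
  rw [h2, qf, h0, ip_zero_right, mul_zero, zero_sub, neg_eq_zero] at this
  exact (mul_eq_zero.1 this).resolve_right (by simpa using hd)

/-- local description in exponential coordinates -/
def LocRep (p : ℝ) (f : (Fin n → ℂ) → (Fin n → ℂ)) (s3 : Fin n → ℂ) (K : (Fin n → ℂ) → (Fin n → ℂ))
    (L : ((Fin n → ℂ) × ℂ) →ₗ[ℂ] ((Fin n → ℂ) × ℂ)) (κ : ℝ) : Prop :=
  0 < κ ∧ (∀ Z W, qf (L Z) (L W) = κ * qf Z W) ∧ nsq (cexp s3) < 1 ∧ 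
    ∀ᶠ s in 𝓝 s3, DifferentiableAt ℂ K s ∧ f (Em p s) = Em p (K s) ∧ L (cexp s, 1) = (L (cexp s, 1)).2 • (cexp (K s), (1:ℂ))

lemma locrep_exists {p : ℝ} (hp : 0 < p) (hn : 2 ≤ n) {D : Set (Fin n → ℂ)} {f : (Fin n → ℂ) → (Fin n → ℂ)}
    (hDe : D = {w | gR p w < 1}) (hf : IsProperHolomorphic f D D) : ∃ s3 K L κ, LocRep p f s3 K L κ := by
  obtain ⟨c, r, H, lg, hr, hc, hH, hlg, h⟩ := loc_exists hp (by omega) hDe hf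
  have hd1 : DifferentiableOn ℂ (fun y => cexp (H y)) (ball c r) := diff_cexp.comp_differentiableOn hH
  have hB : ∀ ζ ∈ ball c r, nsq ζ < 1 → nsq (cexp (H ζ)) < 1 := by
    intro ζ hζ h1
    obtain ⟨a1, a2, a3, a4⟩ := h ζ hζ
    have h2 : Em p (lg ζ) ∈ D := by rw [hDe]; change gR p _ < 1; rw [gR_Em hp, a1]; exact h1
    have h3 := hf.2.1 h2
    rw [a3 h1, hDe] at h3
    change gR p _ < 1 at h3
    rwa [gR_Em hp] at h3
  obtain ⟨L, κ, hκ, hL, hq⟩ := sphere_thm hn hr hc hd1 (fun ζ hζ => (h ζ hζ).2.2.2) hB (fun ζ hζ => (h ζ hζ).2.1)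
  have e1 : ∀ᶠ s : ℝ in 𝓝[<] 1, (s:ℂ) • c ∈ ball c r := by
    have : Continuous (fun s : ℝ => (s:ℂ) • c) := by fun_prop
    exact nhdsWithin_le_nhds (this.continuousAt.eventually_mem (isOpen_ball.mem_nhds (by simpa using hr)))
  have e3 : ∀ᶠ s : ℝ in 𝓝[<] 1, 0 < s := nhdsWithin_le_nhds (Ioi_mem_nhds one_pos)
  obtain ⟨t, ht1, ht0, ht⟩ := (e1.and (e3.and self_mem_nhdsWithin)).exists
  have ht' : t < 1 := ht
  set ζ3 := (t:ℂ) • c with hζ3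
  have hz1 : nsq ζ3 < 1 := by
    rw [hζ3, nsq_smul, hc, mul_one, Complex.norm_real, Real.norm_eq_abs, sq_abs]; nlinarith
  set s3 := lg ζ3 with hs3
  have hes : cexp s3 = ζ3 := (h ζ3 ht1).1
  have hcc : ContinuousAt cexp s3 := (diff_cexp (n := n)).continuous.continuousAt
  have hop : IsOpen {z : Fin n → ℂ | z ∈ ball c r ∧ nsq z < 1} := isOpen_ball.inter nsq_lt_open
  have ev1 : ∀ᶠ s in 𝓝 s3, cexp s ∈ {z : Fin n → ℂ | z ∈ ball c r ∧ nsq z < 1} :=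
    hcc.eventually_mem (hop.mem_nhds (by rw [hes]; exact ⟨ht1, hz1⟩))
  obtain ⟨g, -, -, -, hg, -⟩ := local_inv isOpen_univ (diff_cexp (n := n)).differentiableOn (Set.mem_univ s3) (cexp_fderiv_inj s3)
  have hlc : ContinuousAt (fun s => lg (cexp s)) s3 := by
    have h1 : ContinuousAt lg (cexp s3) := by rw [hes]; exact hlg.continuousOn.continuousAt (isOpen_ball.mem_nhds ht1)
    exact ContinuousAt.comp (f := cexp) (g := lg) h1 hcc
  have ev2 : ∀ᶠ s in 𝓝 s3, lg (cexp s) = s := by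
    have : Tendsto (fun s => lg (cexp s)) (𝓝 s3) (𝓝 s3) := by
      have := hlc.tendsto; rw [hes] at this; exact this
    filter_upwards [this.eventually hg, hg, ev1] with s h1 h2 h3
    rw [(h _ h3.1).1, h2] at h1
    exact h1.symm
  refine ⟨s3, fun s => H (cexp s), L, κ, hκ, hq, by rw [hes]; exact hz1, ?_⟩
  filter_upwards [ev1, ev2] with s h1 h2
  refine ⟨?_, ?_, hL _ h1.1⟩
  · exact DifferentiableAt.comp (f := cexp) (g := H) s (hH.differentiableAt (isOpen_ball.mem_nhds h1.1)) (diff_cexp (n := n)).differentiableAt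
  · have := (h _ h1.1).2.2.1 h1.2
    rwa [h2] at this
end
end

section
open MeasureTheory Metric Filter Topology
open Finset
open scoped ContDiff ComplexConjugate

section
variable {n : ℕ} {p : ℝ} {D : Set (Fin n → ℂ)} {f : (Fin n → ℂ) → (Fin n → ℂ)}

lemma dil_pow_tendsto {σ : ℝ} (h0 : 0 < σ) (h1 : σ < 1) (w : Fin n → ℂ) :
    Tendsto (fun m : ℕ => dil ((σ:ℂ) ^ m) w) atTop (𝓝 0) := by
  have h : Tendsto (fun m : ℕ => (σ:ℂ) ^ m) atTop (𝓝 0) :=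
    tendsto_pow_atTop_nhds_zero_of_norm_lt_one (by rw [Complex.norm_real, Real.norm_eq_abs, abs_of_pos h0]; exact h1)
  have h2 := ((diff_dil_l w).continuous.tendsto 0).comp h
  rw [dil_zero] at h2
  exact h2

lemma fderiv_comp_dil {g : (Fin n → ℂ) → ℂ} {c : ℂ} {w : Fin n → ℂ} (h : DifferentiableAt ℂ g (dil c w)) (j : Fin n) :
    fderiv ℂ (fun w => g (dil c w)) w (Pi.single j 1) = c ^ (j.1 + 1) * fderiv ℂ g (dil c w) (Pi.single j 1) := by
  have h1 : HasFDerivAt (fun w : Fin n → ℂ => dil c w) (fderiv ℂ (fun w : Fin n → ℂ => dil c w) w) w := (diff_dil c w).hasFDerivAt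
  have h2 := HasFDerivAt.comp (f := fun w : Fin n → ℂ => dil c w) (g := g) w h.hasFDerivAt h1
  have h3 : fderiv ℂ (fun w : Fin n → ℂ => dil c w) w (Pi.single j 1) = c ^ (j.1 + 1) • (Pi.single j 1 : Fin n → ℂ) := by
    have h4 : HasDerivAt (fun t : ℂ => dil c (w + t • (Pi.single j 1 : Fin n → ℂ))) (c ^ (j.1 + 1) • (Pi.single j 1 : Fin n → ℂ)) 0 := by
      have : (fun t : ℂ => dil c (w + t • (Pi.single j 1 : Fin n → ℂ))) = fun t => dil c w + t • (c ^ (j.1 + 1) • (Pi.single j 1 : Fin n → ℂ)) := by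
        funext t k
        simp only [dil, Pi.add_apply, Pi.smul_apply, smul_eq_mul, Pi.single_apply]
        split_ifs with hk
        · subst hk; ring
        · ring
      rw [this]
      exact line_hasDeriv _ _ _
    have h5 := line_comp (F := fun w : Fin n → ℂ => dil c w) (z := w) (x := (Pi.single j 1 : Fin n → ℂ)) (t := 0) (diff_dil c _)
    rw [zero_smul, add_zero] at h5
    exact h5.unique h4
  have h6 := h2.fderiv
  have h7 : fderiv ℂ (fun w => g (dil c w)) w = _ := h6
  rw [h7, ContinuousLinearMap.comp_apply, h3, map_smul, smul_eq_mul]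

theorem hom_auto (hp : 0 < p) (hDe : D = {w | gR p w < 1}) (hf : IsProperHolomorphic f D D) {σ : ℝ}
    (h0 : 0 < σ) (h1 : σ < 1) (hom : ∀ w ∈ D, f (dil σ w) = dil σ (f w)) : IsAutomorphismOf f D := by
  have hDo : IsOpen D := by rw [hDe]; exact gR_open hp 1
  have hDc : IsPreconnected D := by rw [hDe]; exact gR_preconn hp 1
  have hD0 : (0 : Fin n → ℂ) ∈ D := by rw [hDe]; change gR p _ < 1; rw [gR_zero hp]; exact one_pos
  have hσn : ‖(σ:ℂ)‖ ≤ 1 := by rw [Complex.norm_real, Real.norm_eq_abs, abs_of_pos h0]; exact h1.le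
  have hσ0 : (σ:ℂ) ≠ 0 := by exact_mod_cast h0.ne'
  have hdm : ∀ w ∈ D, dil (σ:ℂ) w ∈ D := by
    intro w hw; rw [hDe] at hw ⊢; exact dil_mem hp hw hσn
  have hdmm : ∀ m : ℕ, ∀ w ∈ D, dil ((σ:ℂ) ^ m) w ∈ D ∧ f (dil ((σ:ℂ) ^ m) w) = dil ((σ:ℂ) ^ m) (f w) := by
    intro m
    induction m with
    | zero => intro w hw; simp [dil_one, hw]
    | succ m ih =>
      intro w hw
      obtain ⟨a, b⟩ := ih w hw
      rw [pow_succ', ← dil_dil, ← dil_dil]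
      exact ⟨hdm _ a, by rw [hom _ a, b]⟩
  have hdc : ∀ i, DifferentiableOn ℂ (fun z => f z i) D := fun i => differentiableOn_pi.1 hf.1 i
  -- Jacobian
  have hJ : ∀ w ∈ D, rdet (jac f (dil σ w)) = rdet (jac f w) := by
    intro w hw
    have e : ∀ i k, jac f (dil σ w) i k * (σ:ℂ) ^ (k.1 + 1) = (σ:ℂ) ^ (i.1 + 1) * jac f w i k := by
      intro i k
      have a1 := fderiv_comp_dil (g := fun w => f w i) (c := σ) (w := w) ((hdc i).differentiableAt (hDo.mem_nhds (hdm w hw))) k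
      have a2 : (fun w => f (dil (σ:ℂ) w) i) =ᶠ[𝓝 w] fun w => (σ:ℂ) ^ (i.1 + 1) * f w i := by
        filter_upwards [hDo.mem_nhds hw] with x hx
        rw [hom x hx]; rfl
      rw [a2.fderiv_eq, fderiv_const_mul ((hdc i).differentiableAt (hDo.mem_nhds hw))] at a1
      simp only [jac]
      rw [mul_comm]; exact a1.symm
    have e1 := Matrix.det_mul_row (fun k : Fin n => (σ:ℂ) ^ (k.1 + 1)) (Matrix.of (jac f (dil σ w)))
    have e2 := Matrix.det_mul_column (fun k : Fin n => (σ:ℂ) ^ (k.1 + 1)) (Matrix.of (jac f w))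
    have e3 : (Matrix.of fun i j => (fun k : Fin n => (σ:ℂ) ^ (k.1 + 1)) j * Matrix.of (jac f (dil σ w)) i j) =
      Matrix.of fun i j => (fun k : Fin n => (σ:ℂ) ^ (k.1 + 1)) i * Matrix.of (jac f w) i j := by
      ext i j
      simp only [Matrix.of_apply]
      rw [mul_comm]; exact e i j
    rw [e3] at e1
    rw [e1] at e2
    exact mul_left_cancel₀ (Finset.prod_ne_zero_iff.2 fun i _ => pow_ne_zero _ hσ0) e2
  have hJc : ContinuousOn (fun w => rdet (jac f w)) D := (rdet_contDiffOn hDo hf.1).continuousOn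
  have hJ0 : ∀ w ∈ D, rdet (jac f w) = rdet (jac f 0) := by
    intro w hw
    have hm : ∀ m : ℕ, rdet (jac f (dil ((σ:ℂ) ^ m) w)) = rdet (jac f w) := by
      intro m
      induction m with
      | zero => simp [dil_one]
      | succ m ih => rw [pow_succ', ← dil_dil, hJ _ (hdmm m w hw).1, ih]
    have ht := ((hJc.continuousAt (hDo.mem_nhds hD0)).tendsto).comp (dil_pow_tendsto h0 h1 w)
    refine tendsto_nhds_unique (tendsto_const_nhds.congr fun m => ?_) ht
    exact (hm m).symm
  obtain ⟨z, hz, hzJ⟩ := jac_ne_zero hDo ⟨0, hD0⟩ hf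
  have hinjd : ∀ w ∈ D, Function.Injective (fderiv ℂ f w) := by
    intro w hw
    refine fderiv_inj_of_rdet (hf.1.differentiableAt (hDo.mem_nhds hw)) ?_
    rw [hJ0 w hw, ← hJ0 z hz]; exact hzJ
  have hinj : Set.InjOn f D := by
    intro x hx y hy hxy
    obtain ⟨g, -, -, -, hg, -⟩ := local_inv hDo hf.1 hD0 (hinjd 0 hD0)
    obtain ⟨m, hm1, hm2⟩ := (((dil_pow_tendsto h0 h1 x).eventually hg).and ((dil_pow_tendsto h0 h1 y).eventually hg)).exists
    have h3 : dil ((σ:ℂ) ^ m) x = dil ((σ:ℂ) ^ m) y := by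
      rw [← hm1, ← hm2, (hdmm m x hx).2, (hdmm m y hy).2, hxy]
    have h4 := congrArg (dil ((σ:ℂ) ^ m)⁻¹) h3
    rw [dil_dil, dil_dil, inv_mul_cancel₀ (pow_ne_zero _ hσ0), dil_one, dil_one] at h4
    exact h4
  have himo : IsOpen (f '' D) := by
    rw [isOpen_iff_mem_nhds]
    rintro _ ⟨x, hx, rfl⟩
    obtain ⟨g, -, -, -, -, hmap⟩ := local_inv hDo hf.1 hx (hinjd x hx)
    rw [← hmap]
    exact Filter.image_mem_map (hDo.mem_nhds hx)
  have hsurj : D ⊆ f '' D := by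
    refine hDc.subset_of_closure_inter_subset himo ⟨f 0, hf.2.1 hD0, Set.mem_image_of_mem f hD0⟩ ?_
    rintro y ⟨hy, hyD⟩
    obtain ⟨K, hK, hyK, hKD⟩ := exists_compact_subset hDo hyD
    have hc := hf.2.2 K hKD hK
    have hc2 : IsCompact (f '' (D ∩ f ⁻¹' K)) := hc.image_of_continuousOn (hf.1.continuousOn.mono Set.inter_subset_left)
    have : y ∈ closure (f '' (D ∩ f ⁻¹' K)) := by
      rw [mem_closure_iff_nhds] at hy ⊢
      intro t ht
      obtain ⟨u, ⟨hu1, hu2⟩, x, hx, rfl⟩ := hy (t ∩ interior K) (inter_mem ht (isOpen_interior.mem_nhds hyK))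
      exact ⟨f x, hu1, x, ⟨hx, (interior_subset hu2 : f x ∈ K)⟩, rfl⟩
    rw [hc2.isClosed.closure_eq] at this
    obtain ⟨x, hx, rfl⟩ := this
    exact ⟨x, hx.1, rfl⟩
  refine ⟨hf.1, ⟨hf.2.1, hinj, hsurj⟩, Function.invFunOn f D, ?_, ?_, ?_⟩
  · intro y hy
    obtain ⟨x, hx, rfl⟩ := hsurj hy
    obtain ⟨g, hgx, hg1, hg2, -, -⟩ := local_inv hDo hf.1 hx (hinjd x hx)
    have hgD : ∀ᶠ y in 𝓝 (f x), g y ∈ D := by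
      refine hg1.self_of_nhds.continuousAt.eventually_mem (hDo.mem_nhds ?_)
      rw [hgx]; exact hx
    have heq : Function.invFunOn f D =ᶠ[𝓝 (f x)] g := by
      filter_upwards [hg2, hgD] with y h1 h2
      have h3 : ∃ a ∈ D, f a = y := ⟨g y, h2, h1⟩
      exact hinj (Function.invFunOn_mem h3) h2 (by rw [Function.invFunOn_eq h3, h1])
    exact (hg1.self_of_nhds.congr_of_eventuallyEq heq).differentiableWithinAt
  · intro x hx
    have h3 : ∃ a ∈ D, f a = f x := ⟨x, hx, rfl⟩
    exact hinj (Function.invFunOn_mem h3) hx (Function.invFunOn_eq h3)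
  · intro y hy
    exact Function.invFunOn_eq (hsurj hy)
end
end

section
open MeasureTheory Metric Filter Topology
open Finset
open scoped ContDiff ComplexConjugate

section
variable {n : ℕ} {p : ℝ} {D : Set (Fin n → ℂ)} {f : (Fin n → ℂ) → (Fin n → ℂ)}

/-- the logarithmic image of the ball -/
def Lam (n : ℕ) : Set (Fin n → ℂ) := {s | nsq (cexp s) < 1}

lemma Lam_open : IsOpen (Lam n) :=
  isOpen_lt (continuous_nsq.comp diff_cexp.continuous) continuous_const

lemma nsq_cexp (s : Fin n → ℂ) : nsq (cexp s) = ∑ j, Real.exp (2 * (s j).re) := by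
  unfold nsq cexp
  refine Finset.sum_congr rfl fun j _ => ?_
  rw [Complex.norm_exp, ← Real.exp_nat_mul]; norm_num

lemma Lam_convex : Convex ℝ (Lam n) := by
  intro x hx y hy a b ha hb hab
  change nsq _ < 1
  have hx' : nsq (cexp x) < 1 := hx
  have hy' : nsq (cexp y) < 1 := hy
  rw [nsq_cexp] at *
  have h1 : ∀ j, Real.exp (2 * ((a • x + b • y) j).re) ≤ a * Real.exp (2 * (x j).re) + b * Real.exp (2 * (y j).re) := by
    intro j
    have := convexOn_exp.2 (Set.mem_univ (2 * (x j).re)) (Set.mem_univ (2 * (y j).re)) ha hb hab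
    simp only [smul_eq_mul] at this
    refine le_trans (le_of_eq ?_) this
    congr 1
    simp; ring
  have h2 := Finset.sum_le_sum fun j (_ : j ∈ Finset.univ) => h1 j
  rw [Finset.sum_add_distrib, ← Finset.mul_sum, ← Finset.mul_sum] at h2
  refine lt_of_le_of_lt h2 ?_
  rcases ha.eq_or_lt with h | h
  · subst h; have : b = 1 := by linarith
    subst this; linarith
  · nlinarith

lemma Lam_preconn : IsPreconnected (Lam n) := Lam_convex.isPreconnected

lemma Em_mem (hp : 0 < p) (hDe : D = {w | gR p w < 1}) {s : Fin n → ℂ} : Em p s ∈ D ↔ s ∈ Lam n := by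
  rw [hDe]; change gR p _ < 1 ↔ nsq _ < 1; rw [gR_Em hp]

lemma piMap_last (hn : 0 < n) (z : Fin n → ℂ) : piMap n z ⟨n - 1, by omega⟩ = ∏ j, z j := by
  unfold piMap
  have : (⟨n - 1, by omega⟩ : Fin n).1 + 1 = (Finset.univ : Finset (Fin n)).card := by simp; omega
  rw [this, Finset.powersetCard_self, Finset.sum_singleton]

lemma Lam_ext {g : (Fin n → ℂ) → ℂ} (hg : DifferentiableOn ℂ g (Lam n)) {s3 : Fin n → ℂ} (hs : s3 ∈ Lam n)
    (h : ∀ᶠ s in 𝓝 s3, g s = 0) : ∀ s ∈ Lam n, g s = 0 :=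
  holo_identity Lam_open Lam_preconn hg hs h

lemma D_ext (hn : 0 < n) (hp : 0 < p) (hDe : D = {w | gR p w < 1}) {g : (Fin n → ℂ) → ℂ} (hg : DifferentiableOn ℂ g D)
    {s3 : Fin n → ℂ} (hs : s3 ∈ Lam n) (h : ∀ s ∈ Lam n, g (Em p s) = 0) : ∀ w ∈ D, g w = 0 := by
  have hDo : IsOpen D := by rw [hDe]; exact gR_open hp 1
  have hDc : IsPreconnected D := by rw [hDe]; exact gR_preconn hp 1
  have hm := (Em_mem hp hDe).2 hs
  refine holo_identity hDo hDc hg hm ?_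
  have h1 : Em p s3 ⟨n - 1, by omega⟩ ≠ 0 := by
    unfold Em; rw [piMap_last hn]
    exact Finset.prod_ne_zero_iff.2 fun j _ => Complex.exp_ne_zero _
  have h2 : ∀ᶠ w in 𝓝 (Em p s3), w ⟨n - 1, by omega⟩ ≠ 0 :=
    (continuous_apply (⟨n - 1, by omega⟩ : Fin n)).continuousAt.eventually_ne h1
  filter_upwards [h2, hDo.mem_nhds hm] with w hw hwD
  rw [← piMap_rts w, piMap_last hn] at hw
  obtain ⟨s, hs⟩ := exists_Em hp (z := rts w) fun j => Finset.prod_ne_zero_iff.1 hw j (Finset.mem_univ j)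
  have h3 : Em p s = w := by unfold Em; rw [hs, piMap_rts]
  rw [← h3] at hwD ⊢
  exact h s ((Em_mem hp hDe).1 hwD)

lemma Em_add (hp : 0 < p) (s : Fin n → ℂ) (u : ℂ) : Em p (fun j => s j + u) = dil (Complex.exp (u / p)) (Em p s) := by
  unfold Em
  rw [← piMap_smul]
  congr 1; funext j
  rw [Pi.smul_apply, smul_eq_mul, ← Complex.exp_add]; congr 1; ring

lemma cexp_add (s : Fin n → ℂ) (u : ℂ) : cexp (fun j => s j + u) = Complex.exp u • cexp s := by
  funext j
  simp only [cexp, Pi.smul_apply, smul_eq_mul]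
  rw [← Complex.exp_add, add_comm]

theorem center_zero_auto (hn : 0 < n) (hp : 0 < p) (hDe : D = {w | gR p w < 1}) (hf : IsProperHolomorphic f D D)
    {s3 : Fin n → ℂ} {K : (Fin n → ℂ) → (Fin n → ℂ)} {L : ((Fin n → ℂ) × ℂ) →ₗ[ℂ] ((Fin n → ℂ) × ℂ)} {κ : ℝ}
    (hL : LocRep p f s3 K L κ) (h0 : (L (0, 1)).1 = 0) : IsAutomorphismOf f D := by
  obtain ⟨hκ, hq, hs3, hev⟩ := hL
  have hd0 : (L (0, 1)).2 ≠ 0 := L_ne hκ hq (by simp [nsq])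
  have hL2 : ∀ x, (L (x, 1)).2 = (L (0, 1)).2 := by
    intro x
    have : (x, (1:ℂ)) = (x, 0) + (0, 1) := by simp
    rw [this, map_add, Prod.snd_add, L_lin hq h0 hd0, zero_add]
  have hL1 : ∀ (c : ℂ) x, (L (c • x, 1)).1 = c • (L (x, 1)).1 := by
    intro c x
    have h1 : ∀ y, (L (y, 1)).1 = (L (y, 0)).1 := by
      intro y
      have : (y, (1:ℂ)) = (y, 0) + (0, 1) := by simp
      rw [this, map_add, Prod.fst_add, h0, add_zero]
    have h2 : (c • x, (0:ℂ)) = c • (x, (0:ℂ)) := by simp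
    rw [h1, h1, h2, map_smul, Prod.smul_fst]
  obtain ⟨g, -, -, -, hg, -⟩ := local_inv isOpen_univ diff_cexp.differentiableOn (Set.mem_univ (K s3)) (cexp_fderiv_inj (K s3))
  have hKc : ContinuousAt K s3 := hev.self_of_nhds.1.continuousAt
  have t1 : Tendsto (fun q : ℂ × (Fin n → ℂ) => q.2) (𝓝 (0:ℂ) ×ˢ 𝓝 s3) (𝓝 s3) := tendsto_snd
  have t2 : Tendsto (fun q : ℂ × (Fin n → ℂ) => (fun j => q.2 j + q.1)) (𝓝 (0:ℂ) ×ˢ 𝓝 s3) (𝓝 s3) := by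
    rw [← nhds_prod_eq]
    have : Continuous (fun q : ℂ × (Fin n → ℂ) => (fun j => q.2 j + q.1)) := by fun_prop
    have h := this.tendsto ((0:ℂ), s3)
    simpa using h
  have t3 : Tendsto (fun q : ℂ × (Fin n → ℂ) => (fun j => K q.2 j + q.1)) (𝓝 (0:ℂ) ×ˢ 𝓝 s3) (𝓝 (K s3)) := by
    have : Continuous (fun q : ℂ × (Fin n → ℂ) => (fun j => q.2 j + q.1)) := by fun_prop
    have h := this.tendsto ((0:ℂ), K s3)
    rw [nhds_prod_eq] at h
    simp only [add_zero] at h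
    exact h.comp (tendsto_fst.prodMk (hKc.tendsto.comp t1))
  have hev2 : ∀ᶠ q : ℂ × (Fin n → ℂ) in 𝓝 (0:ℂ) ×ˢ 𝓝 s3, f (Em p (fun j => q.2 j + q.1)) = dil (Complex.exp (q.1 / p)) (f (Em p q.2)) := by
    filter_upwards [t1.eventually hev, t2.eventually hev, t3.eventually hg, (hKc.tendsto.comp t2).eventually hg] with q a1 a2 a3 a4
    obtain ⟨-, b1, c1⟩ := a1
    obtain ⟨-, b2, c2⟩ := a2
    rw [cexp_add] at c2
    have c1' := congrArg Prod.fst c1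
    have c2' := congrArg Prod.fst c2
    rw [hL1, c1'] at c2'
    simp only [Prod.smul_fst, hL2] at c2'
    have e1 : cexp (K fun j => q.2 j + q.1) = cexp (fun j => K q.2 j + q.1) := by
      rw [cexp_add]
      apply smul_right_injective _ hd0
      simp only
      rw [← c2', smul_comm]
    have e2 : (K fun j => q.2 j + q.1) = (fun j => K q.2 j + q.1) := by
      rw [← a3, ← e1]; exact a4.symm
    rw [b2, e2, Em_add hp, b1]
  have hc := hev2.curry
  have ht : Tendsto (fun r : ℝ => (r : ℂ)) (𝓝[<] (0:ℝ)) (𝓝 (0:ℂ)) := by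
    have : Tendsto (fun r : ℝ => (r : ℂ)) (𝓝 (0:ℝ)) (𝓝 ((0:ℝ):ℂ)) := Complex.continuous_ofReal.tendsto 0
    rw [Complex.ofReal_zero] at this
    exact this.mono_left nhdsWithin_le_nhds
  obtain ⟨u, hu, hu0⟩ := ((ht.eventually hc).and self_mem_nhdsWithin).exists
  have hu0 : u < 0 := hu0
  have hσ : Complex.exp ((u:ℂ) / p) = ((Real.exp (u / p) : ℝ) : ℂ) := by push_cast; rfl
  simp only [hσ] at hu
  have hσ1 : Real.exp (u / p) < 1 := Real.exp_lt_one_iff.2 (div_neg_of_neg_of_pos hu0 hp)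
  have hσn : ‖((Real.exp (u / p) : ℝ) : ℂ)‖ ≤ 1 := by
    rw [Complex.norm_real, Real.norm_eq_abs, abs_of_pos (Real.exp_pos _)]; exact hσ1.le
  have hdm : ∀ w ∈ D, dil ((Real.exp (u / p) : ℝ) : ℂ) w ∈ D := by
    intro w hw; rw [hDe] at hw ⊢; exact dil_mem hp hw hσn
  refine hom_auto hp hDe hf (Real.exp_pos (u / p)) hσ1 ?_
  have key : ∀ k, ∀ w ∈ D, f (dil ((Real.exp (u / p) : ℝ) : ℂ) w) k - dil ((Real.exp (u / p) : ℝ) : ℂ) (f w) k = 0 := by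
    intro k
    have hdf : DifferentiableOn ℂ (fun w => f (dil ((Real.exp (u / p) : ℝ) : ℂ) w) k - dil ((Real.exp (u / p) : ℝ) : ℂ) (f w) k) D := by
      have e1 : DifferentiableOn ℂ (fun w => f (dil ((Real.exp (u / p) : ℝ) : ℂ) w)) D :=
        hf.1.comp (diff_dil _).differentiableOn hdm
      have e2 : DifferentiableOn ℂ (fun w => dil ((Real.exp (u / p) : ℝ) : ℂ) (f w)) D :=
        (diff_dil _).comp_differentiableOn hf.1
      exact (differentiableOn_pi.1 e1 k).sub (differentiableOn_pi.1 e2 k)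
    refine D_ext hn hp hDe hdf (s3 := s3) hs3 ?_
    refine Lam_ext (s3 := s3) ?_ hs3 ?_
    · exact hdf.comp diff_Em.differentiableOn fun s hs => (Em_mem hp hDe).2 hs
    · filter_upwards [hu] with s hs
      rw [← hs, ← hσ, ← Em_add hp, sub_self]
  intro w hw
  funext k
  exact sub_eq_zero.1 (key k w hw)
end
end

section
open MeasureTheory Metric Filter Topology
open Finset
open scoped ContDiff ComplexConjugate

section
variable {n : ℕ} {p : ℝ} {D : Set (Fin n → ℂ)} {f : (Fin n → ℂ) → (Fin n → ℂ)}

lemma ode_order {Y Q : ℂ → ℂ} (hY : AnalyticAt ℂ Y 0) (hQ : AnalyticAt ℂ Q 0) (hQ0 : Q 0 = 0) (hQ1 : deriv Q 0 ≠ 0)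
    (hne : ¬ ∀ᶠ t in 𝓝 (0:ℂ), Y t = 0) (h : ∀ᶠ t in 𝓝 (0:ℂ), (p:ℂ) * deriv Y t * Q t = Y t * deriv Q t) :
    ∃ m : ℕ, p * m = 1 := by
  obtain ⟨m, g, hg, hg0, hgY⟩ := hY.exists_eventuallyEq_pow_smul_nonzero_iff.2 hne
  refine ⟨m, ?_⟩
  simp only [sub_zero, smul_eq_mul] at hgY
  have hY' : ∀ᶠ t in 𝓝 (0:ℂ), t * deriv Y t = t ^ m * (m * g t + t * deriv g t) := by
    filter_upwards [hgY.eventually_nhds, hg.eventually_analyticAt] with t h1 h2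
    have h3 : HasDerivAt Y (m * t ^ (m - 1) * g t + t ^ m * deriv g t) t :=
      ((hasDerivAt_pow m t).fun_mul h2.differentiableAt.hasDerivAt).congr_of_eventuallyEq h1
    rw [h3.deriv]
    rcases m with _ | m
    · simp
    · simp only [Nat.add_sub_cancel]; ring
  have hlim1 : Tendsto (fun t => (p:ℂ) * (m * g t + t * deriv g t) * (Q t / t)) (𝓝[≠] 0) (𝓝 ((p:ℂ) * (m * g 0 + 0 * deriv g 0) * deriv Q 0)) := by
    have c1 : ContinuousAt (fun t => (p:ℂ) * (m * g t + t * deriv g t)) 0 := by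
      have := hg.continuousAt
      have := hg.deriv.continuousAt
      fun_prop
    refine (c1.tendsto.mono_left nhdsWithin_le_nhds).mul ?_
    have := hasDerivAt_iff_tendsto_slope.1 hQ.differentiableAt.hasDerivAt
    refine this.congr fun t => ?_
    rw [slope_def_field, hQ0, sub_zero, sub_zero]
  have hlim2 : Tendsto (fun t => g t * deriv Q t) (𝓝[≠] 0) (𝓝 (g 0 * deriv Q 0)) :=
    (hg.continuousAt.tendsto.mul hQ.deriv.continuousAt.tendsto).mono_left nhdsWithin_le_nhds
  have heq : (fun t => (p:ℂ) * (m * g t + t * deriv g t) * (Q t / t)) =ᶠ[𝓝[≠] 0] (fun t => g t * deriv Q t) := by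
    filter_upwards [nhdsWithin_le_nhds hY', nhdsWithin_le_nhds h, nhdsWithin_le_nhds hgY, self_mem_nhdsWithin] with t h1 h2 h3 h4
    have h4 : t ≠ 0 := h4
    have h5 : t ^ m ≠ 0 := pow_ne_zero _ h4
    apply mul_left_cancel₀ h5
    rw [← mul_assoc (t ^ m) (g t), ← h3, ← h2]
    field_simp
    linear_combination (-(p:ℂ) * Q t) * h1
  have := tendsto_nhds_unique (hlim1.congr' heq) hlim2
  have h6 : ((p * m : ℝ) : ℂ) = ((1:ℝ) : ℂ) := by
    apply mul_right_cancel₀ (mul_ne_zero hg0 hQ1)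
    push_cast
    linear_combination this
  exact_mod_cast h6

lemma alg_center (a : Fin n → ℂ) (M : (Fin n → ℂ) →ₗ[ℂ] (Fin n → ℂ)) (hM : Function.Surjective M)
    (h : ∀ j, ∀ᶠ t in 𝓝[≠] (0:ℂ), ∃ k, (a + M (fun i => if i = j then 0 else t ^ (i.1 + 1))) k = 0) : a = 0 := by
  classical
  have hexp : ∀ x k, M x k = ∑ i, x i * M (Pi.single i 1) k := by
    intro x k
    rw [LinearMap.pi_apply_eq_sum_univ M x, Finset.sum_apply]
    refine Finset.sum_congr rfl fun i _ => ?_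
    rw [Pi.smul_apply, smul_eq_mul]
    have : (fun j => if i = j then (1:ℂ) else 0) = Pi.single i 1 := by
      funext j
      rw [Pi.single_apply]
      simp only [eq_comm]
    rw [this]
  have key : ∀ j, ∃ k, a k = 0 ∧ ∀ i, i ≠ j → M (Pi.single i 1) k = 0 := by
    intro j
    let P : Fin n → Polynomial ℂ := fun k => Polynomial.C (a k) + ∑ i, if i = j then 0 else Polynomial.C (M (Pi.single i 1) k) * Polynomial.X ^ (i.1 + 1)
    have hP : ∀ k t, (P k).eval t = (a + M (fun i => if i = j then 0 else t ^ (i.1 + 1))) k := by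
      intro k t
      simp only [P, Polynomial.eval_add, Polynomial.eval_C, Polynomial.eval_finsetSum, Pi.add_apply]
      rw [hexp]
      congr 1
      refine Finset.sum_congr rfl fun i _ => ?_
      split_ifs
      · simp
      · rw [Polynomial.eval_mul, Polynomial.eval_C, Polynomial.eval_pow, Polynomial.eval_X, mul_comm]
    have h0 : ∏ k, P k = 0 := by
      apply Polynomial.eq_zero_of_infinite_isRoot
      refine Set.Infinite.mono ?_ (?_ : Set.Infinite {t : ℂ | ∃ k, (a + M (fun i => if i = j then 0 else t ^ (i.1 + 1))) k = 0})
      · rintro t ⟨k, hk⟩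
        change Polynomial.eval t _ = 0
        rw [Polynomial.eval_prod]
        exact Finset.prod_eq_zero (Finset.mem_univ k) (by rw [hP, hk])
      intro hfin
      exact infinite_of_mem_nhds (0:ℂ) (insert_mem_nhds_iff.2 (h j)) (hfin.insert 0)
    obtain ⟨k, -, hk⟩ := Finset.prod_eq_zero_iff.1 h0
    refine ⟨k, ?_, ?_⟩
    · have := congrArg (fun q => Polynomial.coeff q 0) hk
      simp only [P, Polynomial.coeff_add, Polynomial.finsetSum_coeff, Polynomial.coeff_zero, Polynomial.coeff_C_zero] at this
      rw [Finset.sum_eq_zero, add_zero] at this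
      · exact this
      · intro i _; split_ifs <;> simp
    · intro i0 hi0
      have := congrArg (fun q => Polynomial.coeff q (i0.1 + 1)) hk
      simp only [P, Polynomial.coeff_add, Polynomial.finsetSum_coeff, Polynomial.coeff_zero, Polynomial.coeff_C_succ, zero_add] at this
      rw [Finset.sum_eq_single i0] at this
      · simpa [hi0] using this
      · intro i _ hi
        split_ifs
        · simp
        · rw [Polynomial.coeff_C_mul_X_pow, if_neg]
          intro h; apply hi; ext; omega
      · simp
  choose k hk1 hk2 using key
  have hinj : Function.Injective k := by
    intro j j' hjj
    by_contra hne
    obtain ⟨x, hx⟩ := hM (Pi.single (k j) 1)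
    have h1 := congrFun hx (k j)
    rw [hexp, Finset.sum_eq_zero] at h1
    · simp at h1
    · intro i _
      by_cases hi : i = j
      · rw [hjj, hk2 j' i (by rw [hi]; exact hne), mul_zero]
      · rw [hk2 j i hi, mul_zero]
  funext i
  obtain ⟨j, rfl⟩ := Finite.injective_iff_surjective.1 hinj i
  exact hk1 j
end
end

section
open MeasureTheory Metric Filter Topology
open Finset
open scoped ContDiff ComplexConjugate

section
variable {n : ℕ} {p : ℝ} {D : Set (Fin n → ℂ)} {f : (Fin n → ℂ) → (Fin n → ℂ)}
  {s3 : Fin n → ℂ} {K : (Fin n → ℂ) → (Fin n → ℂ)} {L : ((Fin n → ℂ) × ℂ) →ₗ[ℂ] ((Fin n → ℂ) × ℂ)} {κ : ℝ}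

lemma L_split (x y : Fin n → ℂ) : L (x + y, 1) = L (x, 1) + L (y, 0) := by
  rw [← map_add]; simp

lemma L_hasFDeriv (j : Fin n) (ζ : Fin n → ℂ) : DifferentiableAt ℂ (fun ζ => (L (ζ, 1)).1 j) ζ ∧
    ∀ x, fderiv ℂ (fun ζ => (L (ζ, 1)).1 j) ζ x = (L (x, 0)).1 j := by
  let A : (Fin n → ℂ) →L[ℂ] ℂ := LinearMap.toContinuousLinearMap
    ((LinearMap.proj j).comp ((LinearMap.fst ℂ _ _).comp (L.comp (LinearMap.inl ℂ (Fin n → ℂ) ℂ))))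
  have hA : ∀ x, A x = (L (x, 0)).1 j := fun x => rfl
  have : (fun ζ => (L (ζ, 1)).1 j) = fun ζ => (L (0, 1)).1 j + A ζ := by
    funext ζ
    have := L_split (L := L) 0 ζ
    rw [zero_add] at this
    rw [this, hA]; rfl
  have h2 : HasFDerivAt (fun ζ => (L (ζ, 1)).1 j) A ζ := by
    rw [this]; exact A.hasFDerivAt.const_add _
  exact ⟨h2.differentiableAt, fun x => by rw [h2.fderiv, hA]⟩

lemma L_diff2 : Differentiable ℂ (fun ζ => (L (ζ, 1)).2) := by
  let A : (Fin n → ℂ) →L[ℂ] ℂ := LinearMap.toContinuousLinearMap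
    ((LinearMap.snd ℂ _ _).comp (L.comp (LinearMap.inl ℂ (Fin n → ℂ) ℂ)))
  have : (fun ζ => (L (ζ, 1)).2) = fun ζ => (L (0, 1)).2 + A ζ := by
    funext ζ
    have := L_split (L := L) 0 ζ
    rw [zero_add] at this
    rw [this]; rfl
  rw [this]; exact A.differentiable.const_add _

/-- the linear part of the numerator is bijective -/
lemma N_bij {a : Fin n → ℂ} (ha : (L (a, 1)).1 = 0) (hu : ∀ b, (L (b, 1)).1 = 0 → b = a) :
    Function.Bijective (((LinearMap.fst ℂ _ _).comp (L.comp (LinearMap.inl ℂ (Fin n → ℂ) ℂ)))) := by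
  have hi : Function.Injective (((LinearMap.fst ℂ _ _).comp (L.comp (LinearMap.inl ℂ (Fin n → ℂ) ℂ)))) := by
    rw [injective_iff_map_eq_zero]
    intro x hx
    have h1 : (L (x, 0)).1 = 0 := hx
    have := hu (a + x) (by rw [L_split, Prod.fst_add, ha, h1, add_zero])
    simpa using this
  exact ⟨hi, LinearMap.injective_iff_surjective.1 hi⟩

lemma diffAt_prod {ι : Type*} (u : Finset ι) {g : ι → (Fin n → ℂ) → ℂ} {s : Fin n → ℂ}
    (h : ∀ i ∈ u, DifferentiableAt ℂ (g i) s) : DifferentiableAt ℂ (fun x => ∏ i ∈ u, g i x) s := by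
  classical
  induction u using Finset.induction_on with
  | empty => simp
  | insert a u ha ih =>
    simp only [Finset.prod_insert ha]
    exact (h a (Finset.mem_insert_self a u)).fun_mul (ih fun i hi => h i (Finset.mem_insert_of_mem hi))

/-- product of the components of the ball map -/
noncomputable def PP (L : ((Fin n → ℂ) × ℂ) →ₗ[ℂ] ((Fin n → ℂ) × ℂ)) (s : Fin n → ℂ) : ℂ :=
  ∏ j, ((L (cexp s, 1)).1 j / (L (cexp s, 1)).2)

lemma PP_diff (hκ : 0 < κ) (hq : ∀ Z W, qf (L Z) (L W) = κ * qf Z W) : DifferentiableOn ℂ (PP L) (Lam n) := by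
  unfold PP
  intro s hs
  apply DifferentiableAt.differentiableWithinAt
  apply diffAt_prod
  intro j _
  have h1 : DifferentiableAt ℂ (fun s => (L (cexp s, 1)).1 j) s :=
    (L_hasFDeriv j (cexp s)).1.comp s (diff_cexp s)
  have h2 : DifferentiableAt ℂ (fun s => (L (cexp s, 1)).2) s := (L_diff2 (cexp s)).comp s (diff_cexp s)
  simp only [div_eq_mul_inv]
  exact h1.fun_mul (h2.inv (L_ne hκ hq hs))

lemma ode_Lam (hn : 0 < n) (hp : 0 < p) (hDe : D = {w | gR p w < 1}) (hf : IsProperHolomorphic f D D)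
    (hL : LocRep p f s3 K L κ) (v : Fin n → ℂ) :
    ∀ s ∈ Lam n, (p:ℂ) * fderiv ℂ (fun s => f (Em p s) ⟨n - 1, by omega⟩) s v * PP L s
      - f (Em p s) ⟨n - 1, by omega⟩ * fderiv ℂ (PP L) s v = 0 := by
  obtain ⟨hκ, hq, hs3, hev⟩ := hL
  have hpc : (p : ℂ) ≠ 0 := by exact_mod_cast hp.ne'
  have hs3' : s3 ∈ Lam n := hs3
  have hy : DifferentiableOn ℂ (fun s => f (Em p s) ⟨n - 1, by omega⟩) (Lam n) :=
    differentiableOn_pi.1 (hf.1.comp diff_Em.differentiableOn fun s hs => (Em_mem hp hDe).2 hs) _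
  have hP := PP_diff hκ hq
  refine Lam_ext (s3 := s3) ?_ hs3 ?_
  · exact (((differentiableOn_const (p:ℂ)).fun_mul (holo_fderiv Lam_open hy v)).fun_mul hP).fun_sub
      (hy.fun_mul (holo_fderiv Lam_open hP v))
  · have e1 : ∀ᶠ s in 𝓝 s3, f (Em p s) ⟨n - 1, by omega⟩ = Complex.exp ((∑ j, K s j) / p) := by
      filter_upwards [hev] with s hs
      rw [hs.2.1, Em, piMap_last hn, ← Complex.exp_sum, Finset.sum_div]
    have e2 : ∀ᶠ s in 𝓝 s3, PP L s = Complex.exp (∑ j, K s j) := by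
      filter_upwards [hev, Lam_open.mem_nhds hs3'] with s hs hsL
      unfold PP
      rw [Complex.exp_sum]
      refine Finset.prod_congr rfl fun j _ => ?_
      have h1 := congrFun (congrArg Prod.fst hs.2.2) j
      rw [h1, Prod.smul_fst, Pi.smul_apply, smul_eq_mul, mul_div_cancel_left₀ _ (L_ne hκ hq hsL)]
      rfl
    filter_upwards [e1.eventually_nhds, e2.eventually_nhds, hev] with s h1 h2 h3
    have hk : DifferentiableAt ℂ (fun s => ∑ j, K s j) s :=
      DifferentiableAt.fun_sum fun j _ => differentiableAt_pi.1 h3.1 j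
    have d1 := (((hk.hasFDerivAt.mul_const' ((p:ℂ)⁻¹)).cexp).congr_of_eventuallyEq
      (f₁ := fun s => f (Em p s) ⟨n - 1, by omega⟩) (by
        filter_upwards [h1] with x hx; rw [hx, div_eq_mul_inv])).fderiv
    have d2 := (hk.hasFDerivAt.cexp.congr_of_eventuallyEq h2).fderiv
    rw [d1, d2, h1.self_of_nhds, h2.self_of_nhds]
    simp [div_eq_mul_inv]
    field_simp
    ring
end
end

section
open MeasureTheory Metric Filter Topology
open Finset
open scoped ContDiff ComplexConjugate

section
variable {n : ℕ} {p : ℝ} {D : Set (Fin n → ℂ)} {f : (Fin n → ℂ) → (Fin n → ℂ)}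
  {s3 : Fin n → ℂ} {K : (Fin n → ℂ) → (Fin n → ℂ)} {L : ((Fin n → ℂ) × ℂ) →ₗ[ℂ] ((Fin n → ℂ) × ℂ)} {κ : ℝ}

lemma no_simple (hn : 0 < n) (hp : 0 < p) (hDe : D = {w | gR p w < 1}) (hf : IsProperHolomorphic f D D)
    (hL : LocRep p f s3 K L κ) (hm : ¬ ∃ m : ℕ, p * m = 1) {s0 : Fin n → ℂ} (hs0 : s0 ∈ Lam n) {j : Fin n}
    (hj : (L (cexp s0, 1)).1 j = 0) (hi : ∀ i, i ≠ j → (L (cexp s0, 1)).1 i ≠ 0)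
    (hrow : ∃ x, (L (x, 0)).1 j ≠ 0) : False := by
  classical
  have hode := ode_Lam hn hp hDe hf hL
  obtain ⟨hκ, hq, hs3, hev⟩ := hL
  have hs3' : s3 ∈ Lam n := hs3
  have hy : DifferentiableOn ℂ (fun s => f (Em p s) ⟨n - 1, by omega⟩) (Lam n) :=
    differentiableOn_pi.1 (hf.1.comp diff_Em.differentiableOn fun s hs => (Em_mem hp hDe).2 hs) _
  have hP := PP_diff hκ hq
  set y := (fun s => f (Em p s) ⟨n - 1, by omega⟩) with hydef
  have hy3 : y s3 ≠ 0 := by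
    rw [hydef]; simp only
    rw [hev.self_of_nhds.2.1, Em, piMap_last hn]
    exact Finset.prod_ne_zero_iff.2 fun j _ => Complex.exp_ne_zero _
  have hyev : ∀ᶠ s in 𝓝 s3, y s ≠ 0 ∧ s ∈ Lam n :=
    ((hy.differentiableAt (Lam_open.mem_nhds hs3')).continuousAt.eventually_ne hy3).and (Lam_open.mem_nhds hs3')
  have hR : ∀ s, DifferentiableAt ℂ (fun s => (L (cexp s, 1)).1 j) s := fun s =>
    (L_hasFDeriv j (cexp s)).1.comp s (diff_cexp s)
  have hRd : ∀ v, fderiv ℂ (fun s => (L (cexp s, 1)).1 j) s0 v = (L (fun i => Complex.exp (s0 i) * v i, 0)).1 j := by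
    intro v
    have h1 := (((L_hasFDeriv (L := L) j (cexp s0)).1.hasFDerivAt).comp s0 (diff_cexp s0).hasFDerivAt).fderiv
    have h2 : ((fun ζ => (L (ζ, 1)).1 j) ∘ cexp) = fun s => (L (cexp s, 1)).1 j := rfl
    rw [h2] at h1
    rw [h1, ContinuousLinearMap.comp_apply, (L_hasFDeriv j (cexp s0)).2, hasFDerivAt_cexp]
  set ℓ := fderiv ℂ (fun s => (L (cexp s, 1)).1 j) s0 with hℓ
  -- choose a direction
  obtain ⟨s1, hs1y, hs1L, hs1ℓ⟩ : ∃ s1, y s1 ≠ 0 ∧ s1 ∈ Lam n ∧ ℓ (s1 - s0) ≠ 0 := by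
    by_contra hcon
    push Not at hcon
    obtain ⟨x, hx⟩ := hrow
    set e : Fin n → ℂ := fun i => (Complex.exp (s0 i))⁻¹ * x i with he
    have hℓe : ℓ e ≠ 0 := by
      rw [hRd]
      have : (fun i => Complex.exp (s0 i) * e i) = x := by
        funext i; rw [he]; simp only; rw [mul_inv_cancel_left₀ (Complex.exp_ne_zero _)]
      rw [this]; exact hx
    have ht : Tendsto (fun t : ℂ => s3 + t • e) (𝓝[≠] 0) (𝓝 s3) := by
      have : Continuous (fun t : ℂ => s3 + t • e) := by fun_prop
      have h := this.tendsto 0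
      simp only [zero_smul, add_zero] at h
      exact h.mono_left nhdsWithin_le_nhds
    obtain ⟨t, ⟨h1, h2⟩, h3⟩ := ((ht.eventually hyev).and self_mem_nhdsWithin).exists
    have h3 : t ≠ 0 := h3
    have a1 := hcon _ h1 h2
    have a2 := hcon _ hy3 hs3'
    have : s3 + t • e - s0 = (s3 - s0) + t • e := by ring
    rw [this, map_add, a2, zero_add, map_smul, smul_eq_mul] at a1
    exact (mul_ne_zero h3 hℓe) a1
  set v := s1 - s0 with hv
  have hlc : Continuous (fun t : ℂ => s0 + t • v) := by fun_prop
  set T := (fun t : ℂ => s0 + t • v) ⁻¹' (Lam n) with hT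
  have hTo : IsOpen T := Lam_open.preimage hlc
  have hTc : IsPreconnected T := by
    apply Convex.isPreconnected
    intro t1 h1 t2 h2 a b ha hb hab
    have := Lam_convex h1 h2 ha hb hab
    change s0 + (a • t1 + b • t2) • v ∈ Lam n
    convert this using 1
    have h4 : s0 = (a + b) • s0 := by rw [hab, one_smul]
    conv_lhs => rw [h4]
    funext i
    simp; ring
  have h0T : (0:ℂ) ∈ T := by change s0 + (0:ℂ) • v ∈ Lam n; simpa using hs0
  have h1T : (1:ℂ) ∈ T := by change s0 + (1:ℂ) • v ∈ Lam n; simpa [hv] using hs1L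
  have dY : ∀ t ∈ T, HasDerivAt (fun t : ℂ => y (s0 + t • v)) (fderiv ℂ y (s0 + t • v) v) t := fun t ht =>
    line_comp (hy.differentiableAt (Lam_open.mem_nhds ht))
  have dQ : ∀ t ∈ T, HasDerivAt (fun t : ℂ => PP L (s0 + t • v)) (fderiv ℂ (PP L) (s0 + t • v) v) t := fun t ht =>
    line_comp (hP.differentiableAt (Lam_open.mem_nhds ht))
  have hYd : DifferentiableOn ℂ (fun t : ℂ => y (s0 + t • v)) T := fun t ht =>
    (dY t ht).differentiableAt.differentiableWithinAt
  have hQd : DifferentiableOn ℂ (fun t : ℂ => PP L (s0 + t • v)) T := fun t ht =>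
    (dQ t ht).differentiableAt.differentiableWithinAt
  have hPP : PP L = fun s => (L (cexp s, 1)).1 j * ((∏ i ∈ univ.erase j, (L (cexp s, 1)).1 i) * ((L (cexp s, 1)).2⁻¹) ^ n) := by
    funext s
    unfold PP
    simp only [div_eq_mul_inv]
    rw [Finset.prod_mul_distrib, ← Finset.mul_prod_erase univ _ (Finset.mem_univ j)]
    simp; ring
  have hd2 : DifferentiableAt ℂ (fun s => (L (cexp s, 1)).2⁻¹) s0 := by
    have h2 : DifferentiableAt ℂ (fun s => (L (cexp s, 1)).2) s0 := (L_diff2 (cexp s0)).comp s0 (diff_cexp s0)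
    exact h2.inv (L_ne hκ hq hs0)
  have hd3 : DifferentiableAt ℂ (fun s => ((∏ i ∈ univ.erase j, (L (cexp s, 1)).1 i) * ((L (cexp s, 1)).2⁻¹) ^ n)) s0 := by
    refine DifferentiableAt.fun_mul (diffAt_prod _ fun i _ => ?_) (hd2.fun_pow n)
    exact (L_hasFDeriv i (cexp s0)).1.comp s0 (diff_cexp s0)
  apply hm
  refine ode_order (p := p) (hYd.analyticAt (hTo.mem_nhds h0T)) (hQd.analyticAt (hTo.mem_nhds h0T)) ?_ ?_ ?_ ?_
  · simp only [zero_smul, add_zero]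
    rw [hPP]; simp only; rw [hj, zero_mul]
  · rw [(dQ 0 h0T).deriv, zero_smul, add_zero, hPP]
    rw [fderiv_fun_mul (hR s0) hd3]
    simp only [add_apply, smul_apply, hj, zero_mul, zero_add, smul_eq_mul]
    refine mul_ne_zero (mul_ne_zero ?_ ?_) hs1ℓ
    · exact Finset.prod_ne_zero_iff.2 fun i hi' => hi i (Finset.ne_of_mem_erase hi')
    · exact pow_ne_zero _ (inv_ne_zero (L_ne hκ hq hs0))
  · intro h
    have := holo_identity hTo hTc hYd h0T h 1 h1T
    simp only [one_smul, hv] at this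
    apply hs1y
    simpa using this
  · filter_upwards [hTo.mem_nhds h0T] with t ht
    rw [(dY t ht).deriv, (dQ t ht).deriv]
    exact sub_eq_zero.1 (hode v _ ht)

theorem caseII (hn : 0 < n) (hp : 0 < p) (hDe : D = {w | gR p w < 1}) (hf : IsProperHolomorphic f D D)
    (hL : LocRep p f s3 K L κ) (hm : ¬ ∃ m : ℕ, p * m = 1) : (L (0, 1)).1 = 0 := by
  classical
  obtain ⟨a, ha1, ha, hu⟩ := L_center hL.1 hL.2.1
  have hb := N_bij ha hu
  let e := LinearEquiv.ofBijective _ hb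
  have he : ∀ x, (L (e.symm x, 0)).1 = x := fun x => e.apply_symm_apply x
  suffices h : a = 0 by rw [h] at ha; exact ha
  refine alg_center a e.symm.toLinearMap e.symm.surjective ?_
  intro j
  have hc : Continuous (fun t : ℂ => a + e.symm.toLinearMap (fun i => if i = j then 0 else t ^ (i.1 + 1))) := by
    refine continuous_const.add ((LinearMap.continuous_of_finiteDimensional e.symm.toLinearMap).comp ?_)
    refine continuous_pi fun i => ?_
    split_ifs <;> fun_prop
  have h0 : ∀ᶠ t : ℂ in 𝓝 0, nsq (a + e.symm.toLinearMap (fun i => if i = j then 0 else t ^ (i.1 + 1))) < 1 := by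
    refine (continuous_nsq.comp hc).continuousAt.eventually_lt continuousAt_const ?_
    have : (fun i : Fin n => if i = j then (0:ℂ) else 0 ^ (i.1 + 1)) = 0 := by funext i; simp
    simp only [Function.comp, this, map_zero, add_zero]
    exact ha1
  filter_upwards [nhdsWithin_le_nhds h0, self_mem_nhdsWithin] with t ht ht0
  have ht0 : t ≠ 0 := ht0
  by_contra hk
  push Not at hk
  set x : Fin n → ℂ := fun i => if i = j then 0 else t ^ (i.1 + 1) with hx
  set ζ := a + e.symm.toLinearMap x with hζ
  have hs : cexp (fun i => Complex.log (ζ i)) = ζ := by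
    funext i; exact Complex.exp_log (hk i)
  have hN : (L (ζ, 1)).1 = x := by
    rw [hζ, L_split, Prod.fst_add, ha, zero_add]; exact he x
  refine no_simple hn hp hDe hf hL hm (s0 := fun i => Complex.log (ζ i)) (j := j) ?_ ?_ ?_ ?_
  · change nsq _ < 1; rw [hs]; exact ht
  · rw [hs, hN, hx]; simp
  · intro i hi; rw [hs, hN, hx]; simp [hi, ht0]
  · exact ⟨e.symm (Pi.single j 1), by rw [he]; simp⟩
end
end

section
open MeasureTheory Metric Filter Topology
open Finset
open scoped ContDiff ComplexConjugate

section
variable {n : ℕ} {p : ℝ} {D : Set (Fin n → ℂ)} {f : (Fin n → ℂ) → (Fin n → ℂ)}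
  {s3 : Fin n → ℂ} {K : (Fin n → ℂ) → (Fin n → ℂ)} {L : ((Fin n → ℂ) × ℂ) →ₗ[ℂ] ((Fin n → ℂ) × ℂ)} {κ : ℝ}

lemma ball_convex : Convex ℝ {z : Fin n → ℂ | nsq z < 1} := by
  intro x hx y hy a b ha hb hab
  have hx' : nsq x < 1 := hx
  have hy' : nsq y < 1 := hy
  change nsq _ < 1
  have h1 : nsq (a • x + b • y) ≤ a * nsq x + b * nsq y := by
    unfold nsq
    rw [Finset.mul_sum, Finset.mul_sum, ← Finset.sum_add_distrib]
    refine Finset.sum_le_sum fun j _ => ?_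
    have h2 : ‖(a • x + b • y) j‖ ≤ a * ‖x j‖ + b * ‖y j‖ := by
      refine (norm_add_le _ _).trans (le_of_eq ?_)
      simp [norm_smul, abs_of_nonneg ha, abs_of_nonneg hb]
    have h3 := pow_le_pow_left₀ (norm_nonneg _) h2 2
    refine h3.trans ?_
    have hb' : b = 1 - a := by linarith
    subst hb'
    nlinarith [mul_nonneg (mul_nonneg ha hb) (sq_nonneg (‖x j‖ - ‖y j‖))]
  refine lt_of_le_of_lt h1 ?_
  rcases ha.eq_or_lt with h | h
  · subst h; have : b = 1 := by linarith
    subst this; linarith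
  · nlinarith

lemma gR_pow {m : ℕ} (hm : p * m = 1) (ζ : Fin n → ℂ) : gR p (piMap n (fun j => ζ j ^ m)) = nsq ζ := by
  rw [gR_piMap]
  unfold rho nsq
  refine Finset.sum_congr rfl fun j _ => ?_
  rw [norm_pow, ← Real.rpow_natCast (‖ζ j‖) m, ← Real.rpow_mul (norm_nonneg _)]
  have : (m:ℝ) * (2 * p) = (2:ℕ) := by push_cast; linarith
  rw [this, Real.rpow_natCast]

lemma Em_pow (hp : 0 < p) {m : ℕ} (hm : p * m = 1) (s : Fin n → ℂ) : Em p s = piMap n (fun j => cexp s j ^ m) := by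
  unfold Em cexp
  congr 1; funext j
  rw [← Complex.exp_nat_mul]
  congr 1
  have hpc : (p : ℂ) ≠ 0 := by exact_mod_cast hp.ne'
  have : (p:ℂ) * m = 1 := by exact_mod_cast hm
  rw [div_eq_iff hpc]
  linear_combination (-s j) * this

lemma caseI_main (hp : 0 < p) (hDe : D = {w | gR p w < 1}) (hf : IsProperHolomorphic f D D)
    (hL : LocRep p f s3 K L κ) {m : ℕ} (hm : p * m = 1) :
    ∀ ζ, nsq ζ < 1 → f (piMap n (fun j => ζ j ^ m)) = piMap n (fun j => ((L (ζ, 1)).1 j * (L (ζ, 1)).2⁻¹) ^ m) := by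
  obtain ⟨hκ, hq, hs3, hev⟩ := hL
  intro ζ hζ
  funext k
  rw [← sub_eq_zero]
  refine holo_identity (f := fun ζ => f (piMap n (fun j => ζ j ^ m)) k - piMap n (fun j => ((L (ζ, 1)).1 j * (L (ζ, 1)).2⁻¹) ^ m) k)
    (U := {z | nsq z < 1}) nsq_lt_open ball_convex.isPreconnected ?_ (w := cexp s3) hs3 ?_ ζ hζ
  · have h1 : DifferentiableOn ℂ (fun ζ : Fin n → ℂ => f (piMap n (fun j => ζ j ^ m))) {z | nsq z < 1} := by
      refine DifferentiableOn.comp (g := f) (f := fun ζ : Fin n → ℂ => piMap n (fun j => ζ j ^ m)) hf.1 ?_ ?_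
      · exact (diff_piMap.comp (by fun_prop)).differentiableOn
      · intro z hz
        rw [hDe]; change gR p _ < 1; rw [gR_pow hm]; exact hz
    have h2 : DifferentiableOn ℂ (fun ζ : Fin n → ℂ => piMap n (fun j => ((L (ζ, 1)).1 j * (L (ζ, 1)).2⁻¹) ^ m)) {z | nsq z < 1} := by
      refine diff_piMap.comp_differentiableOn (f := fun ζ : Fin n → ℂ => (fun j => ((L (ζ, 1)).1 j * (L (ζ, 1)).2⁻¹) ^ m)) ?_
      refine differentiableOn_pi.2 fun j => ?_
      intro z hz
      exact (((L_hasFDeriv j z).1.fun_mul ((L_diff2 z).inv (L_ne hκ hq hz))).fun_pow m).differentiableWithinAt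
    exact (differentiableOn_pi.1 h1 k).sub (differentiableOn_pi.1 h2 k)
  · obtain ⟨g, -, -, -, -, hmap⟩ := local_inv isOpen_univ diff_cexp.differentiableOn (Set.mem_univ s3) (cexp_fderiv_inj s3)
    rw [← hmap]
    change ∀ᶠ s in 𝓝 s3, _
    filter_upwards [hev, Lam_open.mem_nhds hs3] with s hs hsL
    simp only [Pi.zero_apply]
    rw [← Em_pow hp hm, hs.2.1, Em_pow hp hm, sub_eq_zero]
    congr 2
    funext j
    congr 1
    have h1 := congrFun (congrArg Prod.fst hs.2.2) j
    rw [h1, Prod.smul_fst, Pi.smul_apply, smul_eq_mul, mul_comm, inv_mul_cancel_left₀ (L_ne hκ hq hsL)]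

lemma piMap_zero : piMap n (0 : Fin n → ℂ) = 0 := by
  have := piMap_smul 0 (0 : Fin n → ℂ)
  rwa [dil_zero, zero_smul] at this

lemma caseI_stab (hp : 0 < p) (hDe : D = {w | gR p w < 1}) (hf : IsProperHolomorphic f D D)
    (hL : LocRep p f s3 K L κ) {m : ℕ} (hm : p * m = 1) {a : Fin n → ℂ} (ha1 : nsq a < 1) (ha : (L (a, 1)).1 = 0)
    (hu : ∀ b, (L (b, 1)).1 = 0 → b = a) : f (piMap n (fun j => a j ^ m)) = 0 ∧
    ∀ b : Fin n → ℂ, piMap n (fun j => b j ^ m) = piMap n (fun j => a j ^ m) → b = a := by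
  have hmain := caseI_main hp hDe hf hL hm
  have hm0 : m ≠ 0 := by rintro rfl; simp at hm
  have h1 : f (piMap n (fun j => a j ^ m)) = 0 := by
    rw [hmain a ha1, ha]
    have : (fun j : Fin n => ((0 : Fin n → ℂ) j * (L (a, 1)).2⁻¹) ^ m) = 0 := by funext j; simp [hm0]
    rw [this, piMap_zero]
  refine ⟨h1, fun b hb => hu b ?_⟩
  have hb1 : nsq b < 1 := by rw [← gR_pow hm b, hb, gR_pow hm a]; exact ha1
  have h2 := hmain b hb1
  rw [hb, h1, ← piMap_zero] at h2
  obtain ⟨σ, hσ⟩ := piMap_fibre h2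
  funext j
  have h3 := congrFun hσ j
  simp only [Function.comp, Pi.zero_apply] at h3
  have h4 := (pow_eq_zero_iff hm0).1 h3
  exact (mul_eq_zero.1 h4).resolve_right (inv_ne_zero (L_ne hL.1 hL.2.1 hb1))

theorem caseI_ge2 (hp : 0 < p) (hDe : D = {w | gR p w < 1}) (hf : IsProperHolomorphic f D D)
    (hL : LocRep p f s3 K L κ) {m : ℕ} (hm : p * m = 1) (hm2 : 2 ≤ m) : (L (0, 1)).1 = 0 := by
  classical
  obtain ⟨a, ha1, ha, hu⟩ := L_center hL.1 hL.2.1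
  suffices h : a = 0 by rw [h] at ha; exact ha
  obtain ⟨-, hst⟩ := caseI_stab hp hDe hf hL hm ha1 ha hu
  have hpr := Complex.isPrimitiveRoot_exp m (by omega)
  set om := Complex.exp (2 * Real.pi * Complex.I / m) with hom
  funext j
  have h1 := congrFun (hst (Function.update a j (om * a j)) (by
    congr 1; funext i
    by_cases hi : i = j
    · subst hi; rw [Function.update_self, mul_pow, hpr.pow_eq_one, one_mul]
    · rw [Function.update_of_ne hi])) j
  rw [Function.update_self] at h1
  by_contra h0
  exact hpr.ne_one (by omega) (mul_right_cancel₀ h0 (by rw [h1, one_mul]))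

lemma caseI_one (hn : 0 < n) (hp : (0:ℝ) < 1) (hDe : D = {w | gR 1 w < 1}) (hf : IsProperHolomorphic f D D)
    (hL : LocRep 1 f s3 K L κ) : ∃ c : ℂ, n * ‖c‖ ^ 2 < 1 ∧ f (piMap n (fun _ => c)) = 0 ∧ (L (fun _ => c, 1)).1 = 0 ∧ 
      ∀ b, (L (b, 1)).1 = 0 → b = fun _ => c := by
  classical
  obtain ⟨a, ha1, ha, hu⟩ := L_center hL.1 hL.2.1
  obtain ⟨h0, hst⟩ := caseI_stab (m := 1) hp hDe hf hL (by simp) ha1 ha hu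
  simp only [pow_one] at h0 hst
  have hc : a = fun _ => a ⟨0, hn⟩ := by
    funext j
    have := congrFun (hst (a ∘ Equiv.swap j ⟨0, hn⟩) (piMap_perm a _)) j
    simp at this
    exact this.symm
  refine ⟨a ⟨0, hn⟩, ?_, ?_, ?_, ?_⟩
  · rw [hc] at ha1; simpa [nsq] using ha1
  all_goals rw [← hc]
  · exact h0
  · exact ha
  · exact hu
end
end

section
open MeasureTheory Metric Filter Topology
open Finset
open scoped ContDiff ComplexConjugate

section
variable {n : ℕ}

lemma monPoly_eval (w : Fin n → ℂ) (t : ℂ) : (monPoly w).eval t = t ^ n + ∑ k, w k * t ^ (n - 1 - k.1) := by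
  simp [monPoly, Polynomial.eval_finsetSum]

/-- effect of an affine change of the roots on the elementary symmetric functions -/
noncomputable def affT (al be : ℂ) (w : Fin n → ℂ) : Fin n → ℂ := fun k =>
  be ^ (n - (n - 1 - k.1)) * ((n.choose (n - 1 - k.1) : ℕ) : ℂ) +
    ∑ i : Fin n, al ^ (i.1 + 1) * w i * (be ^ ((n - 1 - i.1) - (n - 1 - k.1)) * (((n - 1 - i.1).choose (n - 1 - k.1) : ℕ) : ℂ))

lemma affT_spec (al be : ℂ) (z : Fin n → ℂ) : piMap n (fun j => al * z j + be) = affT al be (piMap n z) := by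
  have h : monPoly (piMap n (fun j => al * z j + be)) =
      (Polynomial.X + Polynomial.C be) ^ n + ∑ i : Fin n, Polynomial.C (dil al (piMap n z) i) * (Polynomial.X + Polynomial.C be) ^ (n - 1 - i.1) := by
    apply Polynomial.funext
    intro t
    rw [monPoly_eval, ← piMap_prod]
    simp only [Polynomial.eval_add, Polynomial.eval_pow, Polynomial.eval_X, Polynomial.eval_C, Polynomial.eval_finsetSum, Polynomial.eval_mul]
    rw [← piMap_smul, ← piMap_prod]
    refine Finset.prod_congr rfl fun j _ => ?_
    simp; ring
  funext k
  rw [← monPoly_coeff (piMap n (fun j => al * z j + be)) k, h]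
  simp only [Polynomial.coeff_add, Polynomial.finsetSum_coeff, Polynomial.coeff_C_mul, Polynomial.coeff_X_add_C_pow]
  rfl

lemma var_lemma (A B : ℂ) {y : Fin n → ℂ} (hy : ∑ j, y j = 0) :
    ∑ j, ‖A + B * y j‖ ^ 2 = n * ‖A‖ ^ 2 + ‖B‖ ^ 2 * ∑ j, ‖y j‖ ^ 2 := by
  have hn : ∀ x : ℂ, ((‖x‖ ^ 2 : ℝ) : ℂ) = x * conj x := by
    intro x; rw [Complex.mul_conj, Complex.normSq_eq_norm_sq]
  have hyc : ∑ j, conj (y j) = 0 := by rw [← map_sum, hy, map_zero]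
  have : ((∑ j, ‖A + B * y j‖ ^ 2 : ℝ) : ℂ) = ((n * ‖A‖ ^ 2 + ‖B‖ ^ 2 * ∑ j, ‖y j‖ ^ 2 : ℝ) : ℂ) := by
    rw [Complex.ofReal_add, Complex.ofReal_mul, Complex.ofReal_mul, Complex.ofReal_sum, Complex.ofReal_sum, hn, hn]
    simp only [hn, map_add, map_mul]
    have : ∀ j, (A + B * y j) * (conj A + conj B * conj (y j)) =
      A * conj A + (B * conj A) * y j + (A * conj B) * conj (y j) + (B * conj B) * (y j * conj (y j)) := fun j => by ring
    simp only [this, Finset.sum_add_distrib, ← Finset.mul_sum, hy, hyc]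
    simp
    ring
  exact_mod_cast this

/-- the root map -/
noncomputable def tau (c : ℂ) (s : ℝ) (z : Fin n → ℂ) : Fin n → ℂ := fun j =>
  (c - (∑ i, z i) / n - s * (z j - (∑ i, z i) / n)) / (1 - conj c * ∑ i, z i)

lemma sum_sub_mean (hn : 0 < n) (z : Fin n → ℂ) : ∑ j, (z j - (∑ i, z i) / n) = 0 := by
  have : (n:ℂ) ≠ 0 := by exact_mod_cast hn.ne'
  rw [Finset.sum_sub_distrib]; simp; field_simp; simp

lemma nsq_var (hn : 0 < n) (z : Fin n → ℂ) : nsq z = n * ‖(∑ i, z i) / n‖ ^ 2 + ∑ j, ‖z j - (∑ i, z i) / n‖ ^ 2 := by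
  have := var_lemma ((∑ i, z i) / n) 1 (sum_sub_mean hn z)
  simp only [one_mul, norm_one, one_pow, add_sub_cancel] at this
  exact this

lemma delta_id (hn : 0 < n) {c : ℂ} {s : ℝ} (hs : s ^ 2 = 1 - n * ‖c‖ ^ 2) (z : Fin n → ℂ) :
    ‖1 - conj c * ∑ i, z i‖ ^ 2 = n * ‖c - (∑ i, z i) / n‖ ^ 2 + s ^ 2 * (1 - n * ‖(∑ i, z i) / n‖ ^ 2) := by
  have hnc : (n:ℂ) ≠ 0 := by exact_mod_cast hn.ne'
  have hn' : ∀ x : ℂ, ((‖x‖ ^ 2 : ℝ) : ℂ) = x * conj x := by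
    intro x; rw [Complex.mul_conj, Complex.normSq_eq_norm_sq]
  set S := ∑ i, z i
  rw [hs]
  have : ((‖1 - conj c * S‖ ^ 2 : ℝ) : ℂ) = ((n * ‖c - S / n‖ ^ 2 + (1 - n * ‖c‖ ^ 2) * (1 - n * ‖S / n‖ ^ 2) : ℝ) : ℂ) := by
    rw [Complex.ofReal_add, Complex.ofReal_mul, Complex.ofReal_mul, Complex.ofReal_sub, Complex.ofReal_sub, Complex.ofReal_mul, Complex.ofReal_mul]
    simp only [hn', map_sub, map_mul, map_div₀, map_one, Complex.conj_conj, map_natCast, Complex.ofReal_natCast, Complex.ofReal_one]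
    field_simp
    ring
  exact_mod_cast this

lemma delta_ne (hn : 0 < n) {c : ℂ} {s : ℝ} (hs0 : 0 < s) (hs : s ^ 2 = 1 - n * ‖c‖ ^ 2) {z : Fin n → ℂ} (hz : nsq z < 1) :
    1 - conj c * ∑ i, z i ≠ 0 := by
  intro h
  have h1 := delta_id hn hs z
  rw [h] at h1
  have h2 := nsq_var hn z
  have h3 : 0 ≤ ∑ j, ‖z j - (∑ i, z i) / n‖ ^ 2 := by positivity
  have h4 : 0 < s ^ 2 * (1 - n * ‖(∑ i, z i) / n‖ ^ 2) := mul_pos (by positivity) (by linarith)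
  have h5 : 0 ≤ n * ‖c - (∑ i, z i) / n‖ ^ 2 := by positivity
  rw [norm_zero] at h1
  linarith

lemma tau_ball (hn : 0 < n) {c : ℂ} {s : ℝ} (hs0 : 0 < s) (hs : s ^ 2 = 1 - n * ‖c‖ ^ 2) {z : Fin n → ℂ} (hz : nsq z < 1) :
    nsq (tau c s z) < 1 := by
  have hd := delta_ne hn hs0 hs hz
  have h1 := delta_id hn hs z
  have h2 := nsq_var hn z
  have hdp : 0 < ‖1 - conj c * ∑ i, z i‖ ^ 2 := by positivity
  have h3 : nsq (tau c s z) = n * ‖(c - (∑ i, z i) / n) / (1 - conj c * ∑ i, z i)‖ ^ 2 +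
      ‖-s / (1 - conj c * ∑ i, z i)‖ ^ 2 * ∑ j, ‖z j - (∑ i, z i) / n‖ ^ 2 := by
    rw [← var_lemma _ _ (sum_sub_mean hn z)]
    unfold nsq tau
    refine Finset.sum_congr rfl fun j _ => ?_
    congr 2
    ring
  rw [norm_div, norm_div, norm_neg, Complex.norm_real, div_pow, div_pow, Real.norm_eq_abs, sq_abs] at h3
  rw [h3, ← sub_pos]
  have h4 : (1 - (n * (‖c - (∑ i, z i) / n‖ ^ 2 / ‖1 - conj c * ∑ i, z i‖ ^ 2) +
      s ^ 2 / ‖1 - conj c * ∑ i, z i‖ ^ 2 * ∑ j, ‖z j - (∑ i, z i) / n‖ ^ 2)) = s ^ 2 * (1 - nsq z) / ‖1 - conj c * ∑ i, z i‖ ^ 2 := by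
    have hne := hdp.ne'
    rw [h2]
    generalize ‖1 - conj c * ∑ i, z i‖ ^ 2 = X at h1 hne ⊢
    field_simp
    linear_combination h1
  rw [h4]
  exact div_pos (mul_pos (by positivity) (by linarith)) hdp

lemma tau_sum (hn : 0 < n) (c : ℂ) (s : ℝ) (z : Fin n → ℂ) :
    ∑ j, tau c s z j = n * (c - (∑ i, z i) / n) / (1 - conj c * ∑ i, z i) := by
  unfold tau
  rw [← Finset.sum_div, Finset.sum_sub_distrib, ← Finset.mul_sum, sum_sub_mean hn]
  simp
  ring

lemma tau_tau (hn : 0 < n) {c : ℂ} {s : ℝ} (hs0 : 0 < s) (hs : s ^ 2 = 1 - n * ‖c‖ ^ 2) {z : Fin n → ℂ} (hz : nsq z < 1) :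
    tau c s (tau c s z) = z := by
  have hd := delta_ne hn hs0 hs hz
  have hnc : (n:ℂ) ≠ 0 := by exact_mod_cast hn.ne'
  have hsc : (s:ℂ) ≠ 0 := by exact_mod_cast hs0.ne'
  have hs' : (s:ℂ) ^ 2 = 1 - n * (c * conj c) := by
    rw [Complex.mul_conj, Complex.normSq_eq_norm_sq]; exact_mod_cast hs
  have hsum := tau_sum hn c s z
  funext j
  have h1 : tau c s (tau c s z) j = (c - (∑ i, tau c s z i) / n - s * (tau c s z j - (∑ i, tau c s z i) / n)) / (1 - conj c * ∑ i, tau c s z i) := rfl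
  rw [h1, hsum]
  unfold tau
  set S := ∑ i, z i
  have hd' : 1 - conj c * (n * (c - S / n) / (1 - conj c * S)) = s ^ 2 / (1 - conj c * S) := by
    rw [hs']; field_simp; ring
  rw [hd', div_eq_iff (div_ne_zero (pow_ne_zero 2 hsc) hd)]
  have hx : c - n * (c - S / n) / (1 - conj c * S) / n = s ^ 2 * (S / n) / (1 - conj c * S) := by
    rw [hs']
    generalize hde : 1 - conj c * S = de at hd
    field_simp
    linear_combination (-c * n) * hde
  rw [hx]
  field_simp
  ring
end
end

section
open MeasureTheory Metric Filter Topology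
open Finset
open scoped ContDiff ComplexConjugate

section
variable {n : ℕ} {D : Set (Fin n → ℂ)} {f : (Fin n → ℂ) → (Fin n → ℂ)}

lemma piMap_first (hn : 0 < n) (z : Fin n → ℂ) : piMap n z ⟨0, hn⟩ = ∑ j, z j := by
  unfold piMap
  simp [Finset.powersetCard_one]

/-- the involution of the symmetrized ball -/
noncomputable def TT (hn : 0 < n) (c : ℂ) (s : ℝ) (w : Fin n → ℂ) : Fin n → ℂ :=
  affT (-s * (1 - conj c * w ⟨0, hn⟩)⁻¹) ((c - w ⟨0, hn⟩ / n + s * (w ⟨0, hn⟩ / n)) * (1 - conj c * w ⟨0, hn⟩)⁻¹) w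

lemma TT_spec (hn : 0 < n) (c : ℂ) (s : ℝ) (z : Fin n → ℂ) : TT hn c s (piMap n z) = piMap n (tau c s z) := by
  unfold TT
  rw [← affT_spec, piMap_first]
  congr 1
  funext j
  unfold tau
  ring

lemma gR_one (z : Fin n → ℂ) : gR 1 (piMap n z) = nsq z := by
  have := gR_pow (p := 1) (m := 1) (by simp) z
  simpa using this

lemma TT_diff (hn : 0 < n) {c : ℂ} {s : ℝ} (hs0 : 0 < s) (hs : s ^ 2 = 1 - n * ‖c‖ ^ 2) (hDe : D = {w | gR 1 w < 1}) :
    DifferentiableOn ℂ (TT hn c s) D := by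
  have hd : ∀ w ∈ D, 1 - conj c * w ⟨0, hn⟩ ≠ 0 := by
    intro w hw
    obtain ⟨z, rfl⟩ := piMap_surj n w
    rw [piMap_first]
    rw [hDe] at hw
    have hw : gR 1 (piMap n z) < 1 := hw
    rw [gR_one] at hw
    exact delta_ne hn hs0 hs hw
  have hi : DifferentiableOn ℂ (fun w : Fin n → ℂ => (1 - conj c * w ⟨0, hn⟩)⁻¹) D :=
    DifferentiableOn.inv (by fun_prop) hd
  have h1 : DifferentiableOn ℂ (fun w : Fin n → ℂ => (-s : ℂ) * (1 - conj c * w ⟨0, hn⟩)⁻¹) D := hi.const_mul _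
  have h2 : DifferentiableOn ℂ (fun w : Fin n → ℂ => (c - w ⟨0, hn⟩ / n + s * (w ⟨0, hn⟩ / n)) * (1 - conj c * w ⟨0, hn⟩)⁻¹) D :=
    DifferentiableOn.fun_mul (by fun_prop) hi
  refine differentiableOn_pi.2 fun k => ?_
  simp only [TT, affT]
  refine DifferentiableOn.fun_add ((h2.fun_pow _).mul_const _) ?_
  refine DifferentiableOn.fun_sum fun i _ => ?_
  exact ((h1.fun_pow _).fun_mul (by fun_prop)).fun_mul ((h2.fun_pow _).mul_const _)

lemma TT_maps (hn : 0 < n) {c : ℂ} {s : ℝ} (hs0 : 0 < s) (hs : s ^ 2 = 1 - n * ‖c‖ ^ 2) (hDe : D = {w | gR 1 w < 1})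
    {w : Fin n → ℂ} (hw : w ∈ D) : TT hn c s w ∈ D ∧ TT hn c s (TT hn c s w) = w := by
  obtain ⟨z, rfl⟩ := piMap_surj n w
  rw [hDe] at hw ⊢
  have hw : gR 1 (piMap n z) < 1 := hw
  rw [gR_one] at hw
  rw [TT_spec, TT_spec, tau_tau hn hs0 hs hw]
  refine ⟨?_, rfl⟩
  change gR 1 _ < 1
  rw [gR_one]
  exact tau_ball hn hs0 hs hw

lemma TT_zero (hn : 0 < n) (c : ℂ) (s : ℝ) : TT hn c s 0 = piMap n (fun _ => c) := by
  rw [← piMap_zero, TT_spec]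
  congr 1
  funext j
  simp [tau]

theorem caseI_ball (hn : 2 ≤ n) (hDe : D = {w | gR 1 w < 1}) (hf : IsProperHolomorphic f D D) :
    IsAutomorphismOf f D := by
  have hn0 : 0 < n := by omega
  have hDo : (0 : Fin n → ℂ) ∈ D := by rw [hDe]; change gR 1 _ < 1; rw [gR_zero one_pos]; exact one_pos
  obtain ⟨s3, K, L, κ, hL⟩ := locrep_exists one_pos hn hDe hf
  obtain ⟨c, hc, hfc, -, -⟩ := caseI_one hn0 one_pos hDe hf hL
  set s := Real.sqrt (1 - n * ‖c‖ ^ 2) with hsd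
  have hs0 : 0 < s := Real.sqrt_pos.2 (by linarith)
  have hs : s ^ 2 = 1 - n * ‖c‖ ^ 2 := Real.sq_sqrt (by linarith)
  have hTd := TT_diff hn0 hs0 hs hDe
  have hTm : ∀ w ∈ D, TT hn0 c s w ∈ D := fun w hw => (TT_maps hn0 hs0 hs hDe hw).1
  have hTT : ∀ w ∈ D, TT hn0 c s (TT hn0 c s w) = w := fun w hw => (TT_maps hn0 hs0 hs hDe hw).2
  set T := TT hn0 c s with hT
  have hg : IsProperHolomorphic (fun w => f (T w)) D D := by
    refine ⟨hf.1.comp hTd hTm, fun w hw => hf.2.1 (hTm w hw), fun C hCD hC => ?_⟩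
    have h1 := hf.2.2 C hCD hC
    have h2 : D ∩ (fun w => f (T w)) ⁻¹' C = T '' (D ∩ f ⁻¹' C) := by
      ext w
      constructor
      · rintro ⟨hw, hwC⟩
        exact ⟨T w, ⟨hTm w hw, hwC⟩, hTT w hw⟩
      · rintro ⟨x, ⟨hx, hxC⟩, rfl⟩
        refine ⟨hTm x hx, ?_⟩
        change f (T (T x)) ∈ C
        rw [hTT x hx]; exact hxC
    rw [h2]
    exact h1.image_of_continuousOn (hTd.continuousOn.mono Set.inter_subset_left)
  have hga : IsAutomorphismOf (fun w => f (T w)) D := by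
    obtain ⟨s3', K', L', κ', hL'⟩ := locrep_exists one_pos hn hDe hg
    refine center_zero_auto hn0 one_pos hDe hg hL' ?_
    have h0 : nsq (0 : Fin n → ℂ) < 1 := by simp [nsq]
    have h1 := caseI_main (m := 1) one_pos hDe hg hL' (by simp) 0 h0
    simp only [pow_one] at h1
    have h2 : piMap n (fun j => (0 : Fin n → ℂ) j) = 0 := piMap_zero
    rw [h2, hT, TT_zero, hfc] at h1
    obtain ⟨σ, hσ⟩ := piMap_fibre (piMap_zero.trans h1)
    funext j
    have h3 := congrFun hσ j
    simp only [Function.comp, Pi.zero_apply] at h3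
    exact (mul_eq_zero.1 h3).resolve_right (inv_ne_zero (L_ne hL'.1 hL'.2.1 h0))
  obtain ⟨-, ⟨-, hinj, hsurj⟩, ψ, hψ, hl, hr⟩ := hga
  have hψm : ∀ w ∈ D, ψ w ∈ D := by
    intro w hw
    obtain ⟨x, hx, rfl⟩ := hsurj hw
    rw [hl hx]; exact hx
  refine ⟨hf.1, ⟨hf.2.1, ?_, ?_⟩, fun w => T (ψ w), hTd.comp hψ hψm, ?_, ?_⟩
  · intro x hx y hy hxy
    have := hinj (hTm x hx) (hTm y hy) (by simp only [hTT x hx, hTT y hy]; exact hxy)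
    rw [← hTT x hx, ← hTT y hy, this]
  · intro w hw
    obtain ⟨x, hx, rfl⟩ := hsurj hw
    exact ⟨T x, hTm x hx, rfl⟩
  · intro x hx
    have h1 := hl (hTm x hx)
    simp only [hTT x hx] at h1
    change T (ψ (f x)) = x
    rw [h1, hTT x hx]
  · intro x hx
    exact hr hx

theorem main_auto {p : ℝ} (hn : 2 ≤ n) (hp : 0 < p) (hDe : D = {w | gR p w < 1}) (hf : IsProperHolomorphic f D D) :
    IsAutomorphismOf f D := by
  have hn0 : 0 < n := by omega
  by_cases hm : ∃ m : ℕ, p * m = 1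
  · obtain ⟨m, hm⟩ := hm
    have hm0 : m ≠ 0 := by rintro rfl; simp at hm
    by_cases h1 : m = 1
    · subst h1
      have : p = 1 := by simpa using hm
      subst this
      exact caseI_ball hn hDe hf
    · obtain ⟨s3, K, L, κ, hL⟩ := locrep_exists hp hn hDe hf
      exact center_zero_auto hn0 hp hDe hf hL (caseI_ge2 hp hDe hf hL hm (by omega))
  · obtain ⟨s3, K, L, κ, hL⟩ := locrep_exists hp hn hDe hf
    exact center_zero_auto hn0 hp hDe hf hL (caseII hn0 hp hDe hf hL hm)
end
end

/-- Alexander-type theorem: every proper holomorphic self-map of the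
symmetrized ellipsoid `𝔼_{p,n}` is an automorphism. -/
theorem proper_selfmap_is_automorphism (n : ℕ) (hn : 2 ≤ n) (p : ℝ) (hp : 0 < p)
    (f : (Fin n → ℂ) → (Fin n → ℂ))
    (hf : IsProperHolomorphic f (symEllipsoid p n) (symEllipsoid p n)) :
    IsAutomorphismOf f (symEllipsoid p n) := by
  exact main_auto hn hp (symE_eq hp) hf
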